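/- Let Z be an Ahlfors 2-regular metric space homeomorphic to the 2-sphere S². Then Z is quasisymmetrically homeomorphic to S² if and only if Z is linearly locally contractible. -/

import Mathlib

open MeasureTheory

/-- `μ` is Ahlfors `Q`-regular with constant `C`:
`C⁻¹ R^Q ≤ μ(B(a,R)) ≤ C R^Q` for `0 < R ≤ diam Z`. -/
def AhlforsRegular {Z : Type*} [MetricSpace Z] [MeasurableSpace Z]
    (μ : Measure Z) (Q C : ℝ) : Prop :=
  ∀ (a : Z) (R : ℝ), 0 < R → R ≤ Metric.diam (Set.univ : Set Z) →
    ENNReal.ofReal (C⁻¹ * R ^ Q) ≤ μ (Metric.ball a R) ∧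
      μ (Metric.ball a R) ≤ ENNReal.ofReal (C * R ^ Q)

/-- A control function: a homeomorphism `η : [0,∞) → [0,∞)` with `η(0) = 0`. -/
def ControlFunction (η : ℝ → ℝ) : Prop :=
  η 0 = 0 ∧ StrictMonoOn η (Set.Ici 0) ∧ ContinuousOn η (Set.Ici 0) ∧
    Set.SurjOn η (Set.Ici 0) (Set.Ici 0)

/-- `f` is `η`-quasisymmetric. -/
def IsQuasisymmetricWith {X Y : Type*} [MetricSpace X] [MetricSpace Y]
    (η : ℝ → ℝ) (f : X → Y) : Prop :=
  Function.Injective f ∧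
  ∀ x1 x2 x3 : X, x1 ≠ x2 → x1 ≠ x3 → x2 ≠ x3 →
    dist (f x1) (f x2) / dist (f x1) (f x3) ≤ η (dist x1 x2 / dist x1 x3)

/-- `U` is contractible inside `V`: there is a continuous map
`H : U × [0,1] → V` with `H(·,0) = id` and `H(·,1)` constant. -/
def ContractibleInside {Z : Type*} [MetricSpace Z] (U V : Set Z) : Prop :=
  ∃ H : Z × ℝ → Z, ContinuousOn H (U ×ˢ Set.Icc (0:ℝ) 1) ∧
    (∀ x ∈ U, H (x, 0) = x) ∧ (∃ z : Z, ∀ x ∈ U, H (x, 1) = z) ∧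
    (∀ x ∈ U, ∀ t ∈ Set.Icc (0:ℝ) 1, H (x, t) ∈ V)

/-- `Z` is `λ`-linearly locally contractible: every ball `B(a,r)` with
`0 < r ≤ diam(Z)/λ` is contractible inside `B(a, λr)`. -/
def LinLocContractible (Z : Type*) [MetricSpace Z] (lam : ℝ) : Prop :=
  ∀ (a : Z) (r : ℝ), 0 < r → r ≤ Metric.diam (Set.univ : Set Z) / lam →
    ContractibleInside (Metric.ball a r) (Metric.ball a (lam * r))

section Linked

variable {α β : Type*}

/-- `u` and `v` are joined by a finite chain of `adj`-neighbours inside `A`. -/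
def Linked (adj : α → α → Prop) (A : Set α) (u v : α) : Prop :=
  u ∈ A ∧ Relation.ReflTransGen (fun a b => adj a b ∧ b ∈ A) u v

variable {adj : α → α → Prop} {A B : Set α} {u v w : α}

theorem Linked.refl (h : u ∈ A) : Linked adj A u u := ⟨h, .refl⟩

theorem Linked.left_mem (h : Linked adj A u v) : u ∈ A := h.1

theorem Linked.right_mem (h : Linked adj A u v) : v ∈ A := by
  obtain ⟨hu, h⟩ := h
  cases h with
  | refl => exact hu
  | tail _ h => exact h.2

theorem Linked.trans (h : Linked adj A u v) (h' : Linked adj A v w) : Linked adj A u w :=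
  ⟨h.1, h.2.trans h'.2⟩

theorem Linked.single (hu : u ∈ A) (hv : v ∈ A) (h : adj u v) : Linked adj A u v :=
  ⟨hu, .single ⟨h, hv⟩⟩

theorem Linked.tail (h : Linked adj A u v) (ha : adj v w) (hw : w ∈ A) : Linked adj A u w :=
  ⟨h.1, h.2.tail ⟨ha, hw⟩⟩

theorem Linked.induction {P : α → Prop} (h : Linked adj A u v) (h0 : P u)
    (hs : ∀ a b, Linked adj A u a → P a → adj a b → b ∈ A → P b) : P v := by
  obtain ⟨hu, h⟩ := h
  induction h with
  | refl => exact h0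
  | tail h1 h2 ih => exact hs _ _ ⟨hu, h1⟩ ih h2.1 h2.2

theorem Linked.mono (h : Linked adj A u v) (hAB : A ⊆ B) : Linked adj B u v :=
  h.induction (.refl (hAB h.1)) fun _ _ _ ih ha hb => ih.tail ha (hAB hb)

theorem Linked.symm (hs : ∀ ⦃a b⦄, adj a b → adj b a) (h : Linked adj A u v) : Linked adj A v u :=
  h.induction (.refl h.1) fun _ _ h1 ih ha hb => (Linked.single hb h1.right_mem (hs ha)).trans ih

/-- A chain can be restricted to the part of `A` it reaches. -/
theorem Linked.restrict (h : Linked adj A u v) : Linked adj {x | Linked adj A u x} u v :=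
  h.induction (.refl (.refl h.1)) fun _ _ h1 ih ha hb => ih.tail ha (h1.tail ha hb)

/-- A chain from a point of `S` to a point outside `S` leaves `S` somewhere. -/
theorem Linked.exists_exit (h : Linked adj A u v) {S : Set α} (hu : u ∈ S) (hv : v ∉ S) :
    ∃ a b, Linked adj (A ∩ S) u a ∧ adj a b ∧ b ∈ A ∧ b ∉ S := by
  by_contra hc
  push Not at hc
  have := h.induction (P := fun x => Linked adj (A ∩ S) u x) (.refl ⟨h.1, hu⟩)
    fun a b _ ih ha hb => ih.tail ha ⟨hb, hc a b ih ha hb⟩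
  exact hv this.right_mem.2

/-- Transport of chains along a relation-preserving map into another graph. -/
theorem Linked.map {adj' : β → β → Prop} {A' : Set β} (f : α → β) (h : Linked adj A u v)
    (hf : ∀ a ∈ A, f a ∈ A')
    (hadj : ∀ a ∈ A, ∀ b ∈ A, adj a b → Linked adj' A' (f a) (f b)) :
    Linked adj' A' (f u) (f v) :=
  h.induction (P := fun x => Linked adj' A' (f u) (f x)) (.refl (hf _ h.1)) fun _ _ h1 ih ha hb =>
      ih.trans (hadj _ h1.right_mem _ hb ha)

theorem Linked.exists_path (h : Linked adj A u v) :
    ∃ (m : ℕ) (p : ℕ → α), p 0 = u ∧ p m = v ∧ (∀ k ≤ m, p k ∈ A) ∧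
      ∀ k < m, adj (p k) (p (k + 1)) := by
  classical
  refine h.induction (P := fun v => ∃ (m : ℕ) (p : ℕ → α), p 0 = u ∧ p m = v ∧
    (∀ k ≤ m, p k ∈ A) ∧ ∀ k < m, adj (p k) (p (k + 1))) ⟨0, fun _ => u, rfl, rfl, fun _ _ => h.1,
        by simp⟩ ?_
  rintro a b - ⟨m, p, h0, hm, hA, hp⟩ hab hb
  refine ⟨m + 1, fun k => if k ≤ m then p k else b, by simp [h0], by simp, ?_, ?_⟩
  · intro k hk
    dsimp only
    split_ifs with h
    exacts [hA k h, hb]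
  · intro k hk
    dsimp only
    rcases Nat.lt_succ_iff_lt_or_eq.1 hk with h | h
    · rw [if_pos h.le, if_pos (Nat.succ_le_of_lt h)]; exact hp k h
    · subst h; simpa [hm] using hab

end Linked

section Hex

/-- Adjacency in the triangular lattice `ℤ × ℤ`. -/
def hexAdj (u v : ℤ × ℤ) : Prop :=
  (v.1 = u.1 + 1 ∧ v.2 = u.2) ∨ (v.1 = u.1 ∧ v.2 = u.2 + 1) ∨ (v.1 = u.1 + 1 ∧ v.2 = u.2 + 1) ∨
  (u.1 = v.1 + 1 ∧ u.2 = v.2) ∨ (u.1 = v.1 ∧ u.2 = v.2 + 1) ∨ (u.1 = v.1 + 1 ∧ u.2 = v.2 + 1)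

theorem hexAdj_symm ⦃u v : ℤ × ℤ⦄ (h : hexAdj u v) : hexAdj v u := by
  unfold hexAdj at *; omega

/-- The square board of side `2n`. -/
def board (n : ℕ) : Set (ℤ × ℤ) := {v | -n ≤ v.1 ∧ v.1 ≤ n ∧ -n ≤ v.2 ∧ v.2 ≤ n}

theorem square_parity (a b c d : Fin 4) (h1 : b ≠ a + 2) (h2 : d ≠ a + 2) (h3 : c ≠ a + 2)
    (h4 : c ≠ b + 2) (h5 : c ≠ d + 2) :
    let e : Fin 4 → Fin 4 → ZMod 2 := fun x y => if (x = 0 ∧ y = 1) ∨ (x = 1 ∧ y = 0) then 1 else 0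
    e a b + e b c + e a d + e d c = 0 := by
  revert a b c d; decide

/-- A Sperner-type lemma: there is no labelling of the square by `Fin 4` with neighbours never
opposite and with each side avoiding one label, in cyclic order. -/
theorem no_cyclic_labelling (m : ℕ) (f : ℕ → ℕ → Fin 4)
    (h1 : ∀ i j, i < m → j ≤ m → f (i + 1) j ≠ f i j + 2)
    (h2 : ∀ i j, i ≤ m → j < m → f i (j + 1) ≠ f i j + 2)
    (h3 : ∀ i j, i < m → j < m → f (i + 1) (j + 1) ≠ f i j + 2)
    (hL : ∀ j ≤ m, f 0 j ≠ 2) (hT : ∀ i ≤ m, f i m ≠ 1) (hR : ∀ j ≤ m, f m j ≠ 0)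
    (hB : ∀ i ≤ m, f i 0 ≠ 3) : False := by
  let e : Fin 4 → Fin 4 → ZMod 2 := fun x y => if (x = 0 ∧ y = 1) ∨ (x = 1 ∧ y = 0) then 1 else 0
  have esymm : ∀ x y, e x y = e y x := by decide
  have key : ∀ j, j < m → ∀ k, k ≤ m →
      ∑ i ∈ Finset.range k, e (f i j) (f (i + 1) j) +
        ∑ i ∈ Finset.range k, e (f i (j + 1)) (f (i + 1) (j + 1)) =
      e (f 0 j) (f 0 (j + 1)) + e (f k j) (f k (j + 1)) := by
    intro j hj k
    induction k with
    | zero =>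
      intro _
      simp only [Finset.range_zero, Finset.sum_empty]
      generalize e _ _ = x; revert x; decide
    | succ k ih =>
      intro hk
      replace ih := ih (by omega)
      have sq := square_parity (f k j) (f (k + 1) j) (f (k + 1) (j + 1)) (f k (j + 1))
        (h1 _ _ (by omega) (by omega)) (h2 _ _ (by omega) (by omega)) (h3 _ _ (by omega) (by omega))
        (h2 _ _ (by omega) (by omega)) (h1 _ _ (by omega) (by omega))
      change e _ _ + e _ _ + e _ _ + e _ _ = 0 at sq
      rw [Finset.sum_range_succ, Finset.sum_range_succ]
      generalize ∑ i ∈ Finset.range k, e (f i j) (f (i + 1) j) = x1 at *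
      generalize ∑ i ∈ Finset.range k, e (f i (j + 1)) (f (i + 1) (j + 1)) = x2 at *
      generalize e (f k j) (f (k + 1) j) = y1 at *
      generalize e (f (k + 1) j) (f (k + 1) (j + 1)) = y2 at *
      generalize e (f k j) (f k (j + 1)) = y3 at *
      generalize e (f k (j + 1)) (f (k + 1) (j + 1)) = y4 at *
      generalize e (f 0 j) (f 0 (j + 1)) = y5 at *
      revert x1 x2 y1 y2 y3 y4 y5
      decide
  have hRe : ∀ x y : Fin 4, x ≠ 0 → y ≠ 0 → e x y = 0 := by decide
  have hTe : ∀ x y : Fin 4, x ≠ 1 → y ≠ 1 → e x y = 0 := by decide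
  have hLe : ∀ x y : Fin 4, x ≠ 2 → y ≠ 2 → y ≠ x + 2 →
    e x y = (if x = 1 then 1 else 0) + (if y = 1 then 1 else 0) := by decide
  have hBe : ∀ x y : Fin 4, x ≠ 3 → y ≠ 3 → y ≠ x + 2 →
    e x y = (if x = 0 then 1 else 0) + (if y = 0 then 1 else 0) := by decide
  have inv : ∀ j ≤ m, ∑ i ∈ Finset.range m, e (f i j) (f (i + 1) j) +
      (if f 0 j = 1 then 1 else 0) = 1 := by
    intro j
    induction j with
    | zero =>
      intro _
      have : ∀ k ≤ m, ∑ i ∈ Finset.range k, e (f i 0) (f (i + 1) 0) =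
          (if f 0 0 = 0 then 1 else 0) + (if f k 0 = 0 then 1 else 0) := by
        intro k
        induction k with
        | zero =>
          intro _; simp only [Finset.range_zero, Finset.sum_empty]
          split_ifs <;> decide
        | succ k ih =>
          intro hk
          rw [Finset.sum_range_succ, ih (by omega), hBe _ _ (hB _ (by omega)) (hB _ hk)
            (h1 _ _ (by omega) (by omega))]
          split_ifs <;> decide
      rw [this m le_rfl, if_neg (hR 0 (by omega))]
      have a2 := hL 0 (by omega)
      have a3 := hB 0 (by omega)
      clear this
      generalize f 0 0 = x at *
      revert x; decide
    | succ j ih =>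
      intro hj
      replace ih := ih (by omega)
      have k := key j (by omega) m le_rfl
      rw [hRe _ _ (hR j (by omega)) (hR (j + 1) hj), hLe _ _ (hL j (by omega)) (hL (j + 1) hj)
        (h2 _ _ (by omega) (by omega))] at k
      generalize ∑ i ∈ Finset.range m, e (f i j) (f (i + 1) j) = x1 at *
      generalize ∑ i ∈ Finset.range m, e (f i (j + 1)) (f (i + 1) (j + 1)) = x2 at *
      generalize (if f 0 j = 1 then (1 : ZMod 2) else 0) = x3 at *
      generalize (if f 0 (j + 1) = 1 then (1 : ZMod 2) else 0) = x4 at *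
      revert x1 x2 x3 x4
      decide
  have := inv m le_rfl
  rw [if_neg (hT 0 (by omega)), Finset.sum_eq_zero] at this
  · simp at this
  · intro i hi
    rw [Finset.mem_range] at hi
    exact hTe _ _ (hT _ (by omega)) (hT _ (by omega))

/-- Hex theorem, existence of a winner. -/
theorem hex_exists (n : ℕ) (X : Set (ℤ × ℤ)) :
    (∃ u v : ℤ × ℤ, u.1 = -n ∧ v.1 = n ∧ Linked hexAdj (board n \ X) u v) ∨
    (∃ u v : ℤ × ℤ, u.2 = -n ∧ v.2 = n ∧ Linked hexAdj (board n ∩ X) u v) := by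
  classical
  by_contra hc
  push Not at hc
  obtain ⟨hLR, hBT⟩ := hc
  let W : ℤ × ℤ → Prop := fun v => ∃ u : ℤ × ℤ, u.1 = -n ∧ Linked hexAdj (board n \ X) u v
  let K : ℤ × ℤ → Prop := fun v => ∃ u : ℤ × ℤ, u.2 = -n ∧ Linked hexAdj (board n ∩ X) u v
  let lab : ℤ × ℤ → Fin 4 := fun v => if v ∈ X then (if K v then 1 else 3) else
      (if W v then 0 else 2)
  have hadj : ∀ u v, u ∈ board n → v ∈ board n → hexAdj u v → lab v ≠ lab u + 2 := by
    intro u v hu hv h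
    by_cases hX : u ∈ X <;> by_cases hX' : v ∈ X
    · have : K u ↔ K v := ⟨fun ⟨a, ha, hj⟩ => ⟨a, ha, hj.tail h ⟨hv, hX'⟩⟩,
        fun ⟨a, ha, hj⟩ => ⟨a, ha, hj.tail (hexAdj_symm h) ⟨hu, hX⟩⟩⟩
      simp only [lab, hX, hX', this, if_true]; split_ifs <;> decide
    · simp only [lab, hX, hX', if_true, if_false]; split_ifs <;> decide
    · simp only [lab, hX, hX', if_true, if_false]; split_ifs <;> decide
    · have : W u ↔ W v := ⟨fun ⟨a, ha, hj⟩ => ⟨a, ha, hj.tail h ⟨hv, hX'⟩⟩,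
        fun ⟨a, ha, hj⟩ => ⟨a, ha, hj.tail (hexAdj_symm h) ⟨hu, hX⟩⟩⟩
      simp only [lab, hX, hX', this, if_false]; split_ifs <;> decide
  refine no_cyclic_labelling (2 * n) (fun i j => lab (-n + i, -n + j)) ?_ ?_ ?_ ?_ ?_ ?_ ?_
  · intro i j hi hj
    apply hadj <;> simp only [board, hexAdj, Set.mem_ofPred_eq, and_true] <;> omega
  · intro i j hi hj
    apply hadj <;> simp only [board, hexAdj, Set.mem_ofPred_eq, true_and] <;> omega
  · intro i j hi hj
    apply hadj <;> simp only [board, hexAdj, Set.mem_ofPred_eq] <;> omega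
  · intro j hj
    have hb : ((-n + (0 : ℕ), -n + j) : ℤ × ℤ) ∈ board n := by
      simp only [board, Set.mem_ofPred_eq]; push_cast; omega
    simp only [lab]
    split_ifs with hX hK hW
    · decide
    · decide
    · decide
    · exact absurd ⟨_, by simp, Linked.refl ⟨hb, hX⟩⟩ hW
  · intro i hi
    simp only [lab]
    split_ifs with hX hK hW
    · obtain ⟨u, hu, hj⟩ := hK
      exact absurd hj (hBT _ _ hu (by push_cast; ring))
    all_goals decide
  · intro j hi
    simp only [lab]
    split_ifs with hX hK hW
    · decide
    · decide
    · obtain ⟨u, hu, hj⟩ := hW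
      exact absurd hj (hLR _ _ hu (by push_cast; ring))
    all_goals decide
  · intro i hj
    have hb : ((-n + i, -n + (0 : ℕ)) : ℤ × ℤ) ∈ board n := by
      simp only [board, Set.mem_ofPred_eq]; push_cast; omega
    simp only [lab]
    split_ifs with hX hK hW
    · decide
    · exact absurd ⟨_, by simp, Linked.refl ⟨hb, hX⟩⟩ hK
    all_goals decide

/-- Indicator (mod 2) of the open vertical ray above `v`. -/
def rayInd (v a : ℤ × ℤ) : ZMod 2 := if a.1 = v.1 ∧ v.2 < a.2 then 1 else 0

/-- Indicator (mod 2) that the edge `ab` leaves the ray above `v` to the right. -/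
def rayCross (v a b : ℤ × ℤ) : ZMod 2 :=
  (if b.1 = a.1 + 1 then rayInd v a else 0) + (if a.1 = b.1 + 1 then rayInd v b else 0)

theorem rayCross_up {v a b : ℤ × ℤ} (ha : a ≠ (v.1, v.2 + 1)) (hb : b ≠ (v.1, v.2 + 1)) :
    rayCross v a b = rayCross (v.1, v.2 + 1) a b := by
  have key : ∀ a, a ≠ (v.1, v.2 + 1) → rayInd v a = rayInd (v.1, v.2 + 1) a := by
    intro a ha
    unfold rayInd
    refine if_congr ?_ rfl rfl
    have : ¬ (a.1 = v.1 ∧ a.2 = v.2 + 1) := fun h => ha (Prod.ext h.1 h.2)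
    dsimp only; omega
  simp only [rayCross, key a ha, key b hb]

theorem rayCross_right {v v' a b : ℤ × ℤ} (hv1 : v'.1 = v.1 + 1)
    (hv2 : v'.2 = v.2 ∨ v'.2 = v.2 + 1) (hab : hexAdj a b)
    (ha : a ≠ v) (hb : b ≠ v) (ha' : a ≠ v') (hb' : b ≠ v') :
    rayCross v a b + rayCross v' a b = rayInd v' a + rayInd v' b := by
  obtain ⟨v1, v2⟩ := v; obtain ⟨w1, w2⟩ := v'; obtain ⟨a1, a2⟩ := a; obtain ⟨b1, b2⟩ := b
  simp only [ne_eq, Prod.mk.injEq, hexAdj] at *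
  subst hv1
  unfold rayCross rayInd
  dsimp only
  rcases hab with h | h | h | h | h | h <;> obtain ⟨h1, h2⟩ := h <;> subst h1 <;> subst h2 <;>
    split_ifs <;> first | rfl | (exfalso; omega)

theorem sum_telescope (g : ℕ → ZMod 2) (m : ℕ) :
    ∑ k ∈ Finset.range m, (g k + g (k + 1)) = g 0 + g m := by
  induction m with
  | zero => simp only [Finset.range_zero, Finset.sum_empty]; generalize g 0 = x; revert x; decide
  | succ m ih =>
    rw [Finset.sum_range_succ, ih]
    generalize g 0 = x; generalize g m = y; generalize g (m + 1) = z
    revert x y z; decide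

/-- Hex theorem, uniqueness of the winner. -/
theorem hex_unique (n : ℕ) {A B : Set (ℤ × ℤ)} (hA : A ⊆ board n) (hB : B ⊆ board n)
    {a a' b b' : ℤ × ℤ} (ha : a.1 = -n) (ha' : a'.1 = n) (hb : b.2 = -n) (hb' : b'.2 = n)
    (hAj : Linked hexAdj A a a') (hBj : Linked hexAdj B b b') : (A ∩ B).Nonempty := by
  by_contra hne
  have hdis : ∀ x ∈ A, x ∉ B := fun x h1 h2 => hne ⟨x, h1, h2⟩
  obtain ⟨m, p, h0, hm, hpA, hp⟩ := hAj.exists_path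
  let c : ℤ × ℤ → ZMod 2 := fun v =>
    ∑ k ∈ Finset.range m, rayCross v (p k) (p (k + 1)) + rayInd v (p m)
  have hne' : ∀ v ∈ B, ∀ k ≤ m, p k ≠ v := fun v hv k hk h => hdis _ (hpA k hk) (h ▸ hv)
  have hup : ∀ v, v ∈ B → (v.1, v.2 + 1) ∈ B → c v = c (v.1, v.2 + 1) := by
    intro v hv hv'
    have h1 : rayInd v (p m) = rayInd (v.1, v.2 + 1) (p m) := by
      unfold rayInd
      refine if_congr ?_ rfl rfl
      have : ¬ ((p m).1 = v.1 ∧ (p m).2 = v.2 + 1) :=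
        fun h => hne' _ hv' m le_rfl (Prod.ext h.1 h.2)
      dsimp only; omega
    simp only [c, h1]
    congr 1
    refine Finset.sum_congr rfl fun k hk => ?_
    rw [Finset.mem_range] at hk
    exact rayCross_up (hne' _ hv' _ hk.le) (hne' _ hv' _ hk)
  have hright : ∀ v v', v ∈ B → v' ∈ B → v'.1 = v.1 + 1 → (v'.2 = v.2 ∨ v'.2 = v.2 + 1) →
      c v = c v' := by
    intro v v' hv hv' h1 h2
    have hsum : ∑ k ∈ Finset.range m, rayCross v (p k) (p (k + 1)) +
        ∑ k ∈ Finset.range m, rayCross v' (p k) (p (k + 1)) =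
          rayInd v' (p 0) + rayInd v' (p m) := by
      rw [← Finset.sum_add_distrib, ← sum_telescope (fun k => rayInd v' (p k))]
      refine Finset.sum_congr rfl fun k hk => ?_
      rw [Finset.mem_range] at hk
      exact rayCross_right h1 h2 (hp k hk) (hne' _ hv _ hk.le) (hne' _ hv _ hk)
        (hne' _ hv' _ hk.le) (hne' _ hv' _ hk)
    have e0 : rayInd v' (p 0) = 0 := by
      have := hB hv
      simp only [board, Set.mem_ofPred_eq] at this
      unfold rayInd; rw [if_neg]; rw [h0]; omega
    have e1 : rayInd v (p m) = 0 := by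
      have := hB hv'
      simp only [board, Set.mem_ofPred_eq] at this
      unfold rayInd; rw [if_neg]; rw [hm]; omega
    rw [e0] at hsum
    simp only [c, e1]
    generalize ∑ k ∈ Finset.range m, rayCross v (p k) (p (k + 1)) = x at *
    generalize ∑ k ∈ Finset.range m, rayCross v' (p k) (p (k + 1)) = y at *
    generalize rayInd v' (p m) = z at *
    revert x y z; decide
  have hinv : c b = c b' := by
    refine hBj.induction (P := fun x => c b = c x) rfl ?_
    intro x y hx ih hxy hy
    have hx := hx.right_mem
    rw [ih]
    rcases hxy with h | h | h | h | h | h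
    · exact hright _ _ hx hy h.1 (.inl h.2)
    · have : y = (x.1, x.2 + 1) := Prod.ext h.1 h.2
      rw [this]; exact hup x hx (this ▸ hy)
    · exact hright _ _ hx hy h.1 (.inr h.2)
    · exact (hright _ _ hy hx h.1 (.inl h.2)).symm
    · have : x = (y.1, y.2 + 1) := Prod.ext h.1 h.2
      rw [this]; exact (hup y hy (this ▸ hx)).symm
    · exact (hright _ _ hy hx h.1 (.inr h.2)).symm
  have hpb : ∀ k ≤ m, p k ∈ board n := fun k hk => hA (hpA k hk)
  have htop : c b' = 0 := by
    have : ∀ k ≤ m, rayInd b' (p k) = 0 := by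
      intro k hk
      have := hpb k hk
      simp only [board, Set.mem_ofPred_eq] at this
      unfold rayInd; rw [if_neg]; omega
    simp only [c, this m le_rfl, add_zero]
    refine Finset.sum_eq_zero fun k hk => ?_
    rw [Finset.mem_range] at hk
    simp [rayCross, this k hk.le, this (k + 1) hk]
  have hbot : c b = 1 := by
    let g : ℕ → ZMod 2 := fun k => if (p k).1 ≤ b.1 then 1 else 0
    have hbb := hB hBj.left_mem
    simp only [board, Set.mem_ofPred_eq] at hbb
    have e : ∀ k < m, rayCross b (p k) (p (k + 1)) = g k + g (k + 1) := by
      intro k hk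
      have hadj := hp k hk
      have h1 := hne' _ hBj.left_mem k hk.le
      have h2 := hne' _ hBj.left_mem (k + 1) hk
      have h3 := hpb k hk.le
      have h4 := hpb (k + 1) hk
      simp only [g, rayCross, rayInd]
      generalize p k = x at *
      generalize p (k + 1) = y at *
      obtain ⟨x1, x2⟩ := x; obtain ⟨y1, y2⟩ := y; obtain ⟨b1, b2⟩ := b
      simp only [board, Set.mem_ofPred_eq, ne_eq, Prod.mk.injEq, hexAdj] at *
      split_ifs <;> first | rfl | (exfalso; omega)
    have e2 : rayInd b (p m) = g m := by
      have h1 := hne' _ hBj.left_mem m le_rfl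
      have h3 := hpb m le_rfl
      simp only [g, rayInd]
      rw [hm] at *
      refine if_congr ?_ rfl rfl
      have : ¬ (a'.1 = b.1 ∧ a'.2 = b.2) := fun h => h1 (Prod.ext h.1 h.2)
      simp only [board, Set.mem_ofPred_eq] at h3
      omega
    simp only [c]
    rw [Finset.sum_congr rfl fun k hk => e k (Finset.mem_range.1 hk), sum_telescope, e2]
    have : g 0 = 1 := by
      simp only [g, h0]; rw [if_pos]; omega
    rw [this]
    generalize g m = x
    revert x; decide
  rw [htop, hbot] at hinv
  exact one_ne_zero hinv

end Hex

section TileComplex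

/-- A finite graph with four distinguished sides satisfying the combinatorial Hex alternative. -/
structure TileComplex (I : Type*) where
  adj : I → I → Prop
  adj_symm : ∀ ⦃i j⦄, adj i j → adj j i
  sL : Set I
  sR : Set I
  sB : Set I
  sT : Set I
  conn : ∀ i j, Linked adj Set.univ i j
  hexA : ∀ S : Set I, (∃ u ∈ sL, ∃ v ∈ sR, Linked adj Sᶜ u v) ∨ ∃ u ∈ sB, ∃ v ∈ sT, Linked adj S u v
  hexB : ∀ A B : Set I, ∀ u ∈ sL, ∀ v ∈ sR, ∀ u' ∈ sB, ∀ v' ∈ sT,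
    Linked adj A u v → Linked adj B u' v' → (A ∩ B).Nonempty

variable {I : Type*} [Fintype I]

theorem TileComplex.exists_weights (T : TileComplex I) : ∃ w : I → ℝ, (∀ i, 0 ≤ w i) ∧
    0 < ∑ i, w i ^ 2 ∧
    (∀ A : Finset I, ∀ u ∈ T.sL, ∀ v ∈ T.sR, Linked T.adj A u v → ∑ i, w i ^ 2 ≤ ∑ i ∈ A, w i) ∧
    (∀ A : Finset I, ∀ u ∈ T.sB, ∀ v ∈ T.sT, Linked T.adj A u v → 1 ≤ ∑ i ∈ A, w i) := by
  classical
  let ind : Finset I → EuclideanSpace ℝ I := fun A => WithLp.toLp 2 fun i => if i ∈ A then 1 else 0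
  let F : Set (EuclideanSpace ℝ I) :=
    ind '' {A : Finset I | ∃ u ∈ T.sL, ∃ v ∈ T.sR, Linked T.adj A u v}
  have hBT : ∃ u ∈ T.sB, ∃ v ∈ T.sT, Linked T.adj Set.univ u v := by
    rcases T.hexA Set.univ with ⟨u, _, v, _, h⟩ | h
    · exact absurd h.left_mem (by simp)
    · exact h
  have hLR : ∃ u ∈ T.sL, ∃ v ∈ T.sR, Linked T.adj Set.univ u v := by
    rcases T.hexA ∅ with h | ⟨u, _, v, _, h⟩
    · simpa using h
    · exact absurd h.left_mem (by simp)
  have hFfin : F.Finite := (Set.toFinite _).image _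
  have hne : (convexHull ℝ F).Nonempty := by
    obtain ⟨u, hu, v, hv, h⟩ := hLR
    exact ⟨_, subset_convexHull ℝ F ⟨Finset.univ, ⟨u, hu, v, hv, by simpa using h⟩, rfl⟩⟩
  obtain ⟨w, hwK, hw⟩ := exists_norm_eq_iInf_of_complete_convex hne
    (hFfin.isCompact_convexHull (𝕜 := ℝ)).isComplete (convex_convexHull ℝ F) 0
  rw [norm_eq_iInf_iff_real_inner_le_zero (convex_convexHull ℝ F) hwK] at hw
  have hhalf : ∀ (a : I → ℝ) (c : ℝ), (∀ A : Finset I,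
      (∃ u ∈ T.sL, ∃ v ∈ T.sR, Linked T.adj A u v) →
      c ≤ ∑ i ∈ A, a i) → c ≤ ∑ i, a i * w i := by
    intro a c h
    have hconv : Convex ℝ {z : EuclideanSpace ℝ I | c ≤ inner ℝ (WithLp.toLp 2 a) z} :=
      convex_halfSpace_ge (IsLinearMap.mk (fun x y => inner_add_right _ _ _)
        (fun r x => by rw [inner_smul_right]; rfl)) c
    have hsub : F ⊆ {z : EuclideanSpace ℝ I | c ≤ inner ℝ (WithLp.toLp 2 a) z} := by
      rintro _ ⟨A, hA, rfl⟩
      have := h A hA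
      simpa [ind, PiLp.inner_apply] using this
    have := convexHull_min hsub hconv hwK
    simpa [PiLp.inner_apply, mul_comm] using this
  have hnn : ∀ i, 0 ≤ w i := by
    intro i
    have := hhalf (fun j => if j = i then 1 else 0) 0 (fun A _ => Finset.sum_nonneg fun j _ => by
      split_ifs <;> norm_num)
    simpa using this
  have hB : ∀ A : Finset I, ∀ u ∈ T.sB, ∀ v ∈ T.sT, Linked T.adj A u v → 1 ≤ ∑ i ∈ A, w i := by
    intro B u hu v hv h
    have := hhalf (fun j => if j ∈ B then 1 else 0) 1 (fun A ⟨u', hu', v', hv', h'⟩ => by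
      obtain ⟨x, hx, hx'⟩ := T.hexB _ _ _ hu' _ hv' _ hu _ hv h' h
      calc (1 : ℝ) = (if x ∈ B then 1 else 0) := by rw [if_pos (by simpa using hx')]
        _ ≤ _ := Finset.single_le_sum (f := fun j => if j ∈ B then (1 : ℝ) else 0)
            (fun j _ => by split_ifs <;> norm_num) (by simpa using hx))
    simpa using this
  refine ⟨fun i => w i, hnn, ?_, ?_, hB⟩
  · obtain ⟨u, hu, v, hv, h⟩ := hBT
    have := hB Finset.univ u hu v hv (by simpa using h)
    by_contra hc
    have h0 : ∑ i, w i ^ 2 = 0 := le_antisymm (not_lt.1 hc)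
        (Finset.sum_nonneg fun i _ => sq_nonneg _)
    rw [Finset.sum_eq_zero_iff_of_nonneg fun i _ => sq_nonneg _] at h0
    have : ∑ i, w i = 0 := Finset.sum_eq_zero fun i hi => by simpa using h0 i hi
    linarith
  · intro A u hu v hv h
    have := hw (ind A) (subset_convexHull ℝ F ⟨A, ⟨u, hu, v, hv, h⟩, rfl⟩)
    rw [zero_sub, inner_neg_left, inner_sub_right, real_inner_self_eq_norm_sq,
      EuclideanSpace.real_norm_sq_eq] at this
    simp [PiLp.inner_apply, ind] at this
    exact this

/-- Vertex-weighted distance from a set of sources in a connected finite graph. -/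
theorem exists_weight_dist {adj : I → I → Prop} (conn : ∀ i j, Linked adj Set.univ i j)
    {w : I → ℝ} (hw : ∀ i, 0 ≤ w i) {S : Set I}
    (hS : S.Nonempty) :
    ∃ x : I → ℝ, (∀ i, 0 ≤ x i) ∧ (∀ i j, adj i j → x j ≤ x i + w i) ∧ (∀ i ∈ S, x i = 0) ∧
      ∀ i, ∃ A : Finset I, ∃ u ∈ S, Linked adj A u i ∧ ∑ k ∈ A, w k = x i + w i := by
  classical
  have hmin : ∀ i, ∃ A : Finset I, (∃ u ∈ S, Linked adj A u i) ∧
      ∀ B : Finset I, (∃ u ∈ S, Linked adj B u i) → ∑ k ∈ A, w k ≤ ∑ k ∈ B, w k := by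
    intro i
    obtain ⟨u, hu⟩ := hS
    obtain ⟨A, hA, hA'⟩ := (Set.toFinite
        {A : Finset I | ∃ u ∈ S, Linked adj A u i}).exists_minimalFor
      (fun A => ∑ k ∈ A, w k) _ ⟨Finset.univ, u, hu, by simpa using conn u i⟩
    refine ⟨A, hA, fun B hB => ?_⟩
    rcases le_total (∑ k ∈ A, w k) (∑ k ∈ B, w k) with h | h
    exacts [h, hA' hB h]
  choose A hA hA' using hmin
  have hwA : ∀ i, w i ≤ ∑ k ∈ A i, w k := fun i => by
    obtain ⟨u, _, h⟩ := hA i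
    exact Finset.single_le_sum (fun k _ => hw k) (by simpa using h.right_mem)
  refine ⟨fun i => ∑ k ∈ A i, w k - w i, fun i => sub_nonneg.2 (hwA i), ?_, ?_, ?_⟩
  · intro i j hij
    obtain ⟨u, hu, h⟩ := hA i
    have := hA' j (insert j (A i)) ⟨u, hu, (h.mono (by simp)).tail hij (by simp)⟩
    have h2 : ∑ k ∈ insert j (A i), w k ≤ w j + ∑ k ∈ A i, w k := by
      by_cases hj : j ∈ A i
      · rw [Finset.insert_eq_of_mem hj]; linarith [hw j]
      · rw [Finset.sum_insert hj]
    dsimp only; linarith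
  · intro i hi
    have := hA' i {i} ⟨i, hi, .refl (by simp)⟩
    rw [Finset.sum_singleton] at this
    dsimp only; linarith [hwA i]
  · intro i
    obtain ⟨u, hu, h⟩ := hA i
    exact ⟨A i, u, hu, h, by ring⟩

end TileComplex

section SqTiling

/-- A tiling of the rectangle `[0, L] × [0, H]` by squares `[x i, x i + w i] × [y i, y i + w i]`
whose contacts are controlled by a graph. Degenerate squares are allowed. -/
structure SqTiling (I : Type*) where
  adj : I → I → Prop
  adj_symm : ∀ ⦃i j⦄, adj i j → adj j i
  sL : Set I
  sR : Set I
  sB : Set I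
  sT : Set I
  L : ℝ
  H : ℝ
  L_pos : 0 < L
  H_pos : 0 < H
  x : I → ℝ
  y : I → ℝ
  w : I → ℝ
  w_nonneg : ∀ i, 0 ≤ w i
  adj_x : ∀ i j, adj i j → x j ≤ x i + w i
  adj_y : ∀ i j, adj i j → y j ≤ y i + w i
  x_sL : ∀ i ∈ sL, x i = 0
  x_sR : ∀ i ∈ sR, L ≤ x i + w i
  y_sB : ∀ i ∈ sB, y i = 0
  y_sT : ∀ i ∈ sT, H ≤ y i + w i
  vert : ∀ t, 0 ≤ t → t ≤ L → ∃ u ∈ sB, ∃ v ∈ sT, Linked adj {i | x i ≤ t ∧ t ≤ x i + w i} u v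
  horiz : ∀ t, 0 ≤ t → t ≤ H → ∃ u ∈ sL, ∃ v ∈ sR, Linked adj {i | y i ≤ t ∧ t ≤ y i + w i} u v
  disj : ∀ i j, i ≠ j → 0 < w i → 0 < w j → x i < x j + w j → x j < x i + w i →
    y i < y j + w j → y j < y i + w i → False
  inR : ∀ i, 0 < w i → 0 ≤ x i ∧ x i + w i ≤ L ∧ 0 ≤ y i ∧ y i + w i ≤ H

/-- Every tile complex carries a square tiling of some rectangle. -/
theorem TileComplex.exists_sqTiling {I : Type*} [Fintype I] (T : TileComplex I) :
    ∃ S : SqTiling I, S.adj = T.adj ∧ S.sL = T.sL ∧ S.sR = T.sR ∧ S.sB = T.sB ∧ S.sT = T.sT := by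
  classical
  obtain ⟨w, hw, hL, hLR, hBT⟩ := T.exists_weights
  set L := ∑ i, w i ^ 2 with hLdef
  have hsL : T.sL.Nonempty := by
    rcases T.hexA ∅ with ⟨u, hu, _⟩ | ⟨u, _, v, _, h⟩
    exacts [⟨u, hu⟩, absurd h.left_mem (by simp)]
  have hsB : T.sB.Nonempty := by
    rcases T.hexA Set.univ with ⟨u, _, v, _, h⟩ | ⟨u, hu, _⟩
    exacts [absurd h.left_mem (by simp), ⟨u, hu⟩]
  obtain ⟨x, hx0, hxadj, hxL, hxA⟩ := exists_weight_dist T.conn hw hsL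
  obtain ⟨y, hy0, hyadj, hyB, hyA⟩ := exists_weight_dist T.conn hw hsB
  have hxR : ∀ i ∈ T.sR, L ≤ x i + w i := fun i hi => by
    obtain ⟨A, u, hu, h, e⟩ := hxA i
    exact e ▸ hLR A u hu i hi h
  have hyT : ∀ i ∈ T.sT, 1 ≤ y i + w i := fun i hi => by
    obtain ⟨A, u, hu, h, e⟩ := hyA i
    exact e ▸ hBT A u hu i hi h
  have nocross : ∀ (z : I → ℝ) (t : ℝ), (∀ i j, T.adj i j → z j ≤ z i + w i) → ∀ A u v,
      A ⊆ {i | z i ≤ t ∧ t ≤ z i + w i}ᶜ → Linked T.adj A u v → z u ≤ t →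
        t ≤ z v + w v → False := by
    intro z t hz A u v hA h hu hv
    have : z v + w v < t := by
      refine h.induction (P := fun v => z v + w v < t) ?_ ?_
      · by_contra hc; exact hA h.left_mem ⟨hu, not_lt.1 hc⟩
      · intro a b _ ih hab hb
        by_contra hc
        exact hA hb ⟨(hz a b hab).trans ih.le, not_lt.1 hc⟩
    linarith
  have hvert : ∀ t, 0 ≤ t → t ≤ L →
      ∃ u ∈ T.sB, ∃ v ∈ T.sT, Linked T.adj {i | x i ≤ t ∧ t ≤ x i + w i} u v := by
    intro t h0 h1
    rcases T.hexA {i | x i ≤ t ∧ t ≤ x i + w i} with ⟨u, hu, v, hv, h⟩ | h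
    · exact (nocross x t hxadj _ u v le_rfl h (by rw [hxL u hu]; exact h0)
        (h1.trans (hxR v hv))).elim
    · exact h
  have hhoriz : ∀ t, 0 ≤ t → t ≤ 1 →
      ∃ u ∈ T.sL, ∃ v ∈ T.sR, Linked T.adj {i | y i ≤ t ∧ t ≤ y i + w i} u v := by
    intro t h0 h1
    rcases T.hexA {i | y i ≤ t ∧ t ≤ y i + w i}ᶜ with h | ⟨u, hu, v, hv, h⟩
    · rwa [compl_compl] at h
    · exact (nocross y t hyadj _ u v le_rfl h (by rw [hyB u hu]; exact h0)
        (h1.trans (hyT v hv))).elim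
  let Q : I → Set (ℝ × ℝ) := fun i => Set.Icc (x i) (x i + w i) ×ˢ Set.Icc (y i) (y i + w i)
  have hcov : Set.Icc 0 L ×ˢ Set.Icc 0 1 ⊆ ⋃ i, Q i := by
    rintro ⟨s, t⟩ ⟨⟨hs0, hs1⟩, ht0, ht1⟩
    dsimp only at hs0 hs1 ht0 ht1
    obtain ⟨u, hu, v, hv, h⟩ := hvert s hs0 hs1
    by_contra hc
    refine nocross y t hyadj _ u v ?_ h (by rw [hyB u hu]; exact ht0) (ht1.trans (hyT v hv))
    intro i hi hi'
    exact hc (Set.mem_iUnion.2 ⟨i, ⟨hi, hi'⟩⟩)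
  have hvol : ∀ i, volume (Q i) = ENNReal.ofReal (w i ^ 2) := by
    intro i
    simp only [Q, Measure.volume_eq_prod, Measure.prod_prod, Real.volume_Icc]
    rw [add_sub_cancel_left, add_sub_cancel_left, ← ENNReal.ofReal_mul (hw i), pow_two]
  have hvolR : volume (Set.Icc (0 : ℝ) L ×ˢ Set.Icc (0 : ℝ) 1) = ENNReal.ofReal L := by
    simp only [Measure.volume_eq_prod, Measure.prod_prod, Real.volume_Icc]
    simp
  have harea : ∀ i (O : Set (ℝ × ℝ)), IsOpen O → O.Nonempty → O ⊆ Q i →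
      Set.Icc 0 L ×ˢ Set.Icc 0 1 ⊆ (Q i \ O) ∪ ⋃ k ∈ Finset.univ.erase i, Q k → False := by
    intro i O hO hOn hOQ hsub
    have h1 : volume (Set.Icc (0 : ℝ) L ×ˢ Set.Icc (0 : ℝ) 1) ≤
        volume (Q i \ O) + ∑ k ∈ Finset.univ.erase i, volume (Q k) :=
      (measure_mono hsub).trans ((measure_union_le _ _).trans
        (add_le_add le_rfl (measure_biUnion_finset_le _ _)))
    have hfin : ∀ k, volume (Q k) ≠ ⊤ := fun k => by rw [hvol]; exact ENNReal.ofReal_ne_top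
    have hO' : volume (Q i \ O) < volume (Q i) := by
      rw [measure_sdiff hOQ hO.measurableSet.nullMeasurableSet
        ((measure_mono hOQ).trans_lt (hfin i).lt_top).ne]
      refine ENNReal.sub_lt_self (hfin i) ?_ (hO.measure_pos volume hOn).ne'
      exact ((hO.measure_pos volume hOn).trans_le (measure_mono hOQ)).ne'
    have h2 : volume (Q i \ O) + ∑ k ∈ Finset.univ.erase i, volume (Q k) < ∑ k, volume (Q k) := by
      rw [← Finset.add_sum_erase _ _ (Finset.mem_univ i)]
      refine ENNReal.add_lt_add_right ?_ hO'
      exact (ENNReal.sum_lt_top.2 fun k _ => (hfin k).lt_top).ne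
    have h3 : ∑ k, volume (Q k) = ENNReal.ofReal L := by
      rw [hLdef, ENNReal.ofReal_sum_of_nonneg fun k _ => sq_nonneg _]
      exact Finset.sum_congr rfl fun k _ => hvol k
    exact absurd (hvolR ▸ h1.trans_lt h2) (by rw [h3]; exact lt_irrefl _)
  have hcov' : ∀ i z, z ∈ Set.Icc 0 L ×ˢ Set.Icc 0 1 → z ∉ Q i →
      z ∈ ⋃ k ∈ Finset.univ.erase i, Q k := by
    intro i z hz hi
    obtain ⟨k, hk⟩ := Set.mem_iUnion.1 (hcov hz)
    exact Set.mem_biUnion (x := k) (by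
      simp only [Finset.coe_erase, Finset.coe_univ, Set.mem_sdiff, Set.mem_univ, true_and,
        Set.mem_singleton_iff]
      rintro rfl; exact hi hk) hk
  refine ⟨⟨T.adj, T.adj_symm, T.sL, T.sR, T.sB, T.sT, L, 1, hL, one_pos, x, y, w, hw, hxadj, hyadj,
    hxL, hxR, hyB, hyT, hvert, hhoriz, ?_, ?_⟩, rfl, rfl, rfl, rfl, rfl⟩
  · intro i j hij hi hj h1 h2 h3 h4
    let U : I → Set (ℝ × ℝ) := fun i => Set.Ioo (x i) (x i + w i) ×ˢ Set.Ioo (y i) (y i + w i)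
    have hU : ∀ i, U i ⊆ Q i := fun i => Set.prod_mono Set.Ioo_subset_Icc_self
        Set.Ioo_subset_Icc_self
    refine harea i (U i ∩ U j) ((isOpen_Ioo.prod isOpen_Ioo).inter (isOpen_Ioo.prod isOpen_Ioo)) ?_
      (Set.inter_subset_left.trans (hU i)) ?_
    · obtain ⟨s, hs1, hs2⟩ := exists_between (a₁ := max (x i) (x j))
        (a₂ := min (x i + w i) (x j + w j))
        (by rw [max_lt_iff, lt_min_iff, lt_min_iff]; refine ⟨⟨?_, ?_⟩, ?_, ?_⟩ <;> linarith)
      obtain ⟨t, ht1, ht2⟩ := exists_between (a₁ := max (y i) (y j))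
          (a₂ := min (y i + w i) (y j + w j))
        (by rw [max_lt_iff, lt_min_iff, lt_min_iff]; refine ⟨⟨?_, ?_⟩, ?_, ?_⟩ <;> linarith)
      rw [max_lt_iff] at hs1 ht1
      rw [lt_min_iff] at hs2 ht2
      exact ⟨(s, t), ⟨⟨hs1.1, hs2.1⟩, ht1.1, ht2.1⟩, ⟨⟨hs1.2, hs2.2⟩, ht1.2, ht2.2⟩⟩
    · intro z hz
      by_cases hzi : z ∈ Q i
      · by_cases hzO : z ∈ U i ∩ U j
        · right
          exact Set.mem_biUnion (x := j) (by simpa using hij.symm) (hU j hzO.2)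
        · exact .inl ⟨hzi, hzO⟩
      · exact .inr (hcov' i z hz hzi)
  · intro i hi
    suffices h : Q i ⊆ Set.Icc 0 L ×ˢ Set.Icc 0 1 by
      have h1 := @h (x i, y i) ⟨⟨le_rfl, by simp [hi.le]⟩, le_rfl, by simp [hi.le]⟩
      have h2 := @h (x i + w i, y i + w i) ⟨⟨by simp [hi.le], le_rfl⟩, by simp [hi.le], le_rfl⟩
      exact ⟨h1.1.1, h2.1.2, h1.2.1, h2.2.2⟩
    have hcl : IsClosed (Set.Icc (0 : ℝ) L ×ˢ Set.Icc (0 : ℝ) 1) := isClosed_Icc.prod isClosed_Icc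
    have hQ : Q i = closure (Set.Ioo (x i) (x i + w i) ×ˢ Set.Ioo (y i) (y i + w i)) := by
      rw [closure_prod_eq, closure_Ioo (by linarith), closure_Ioo (by linarith)]
    rw [hQ]
    refine closure_minimal ?_ hcl
    intro z hz
    by_contra hzR
    refine harea i ((Set.Ioo (x i) (x i + w i) ×ˢ Set.Ioo (y i) (y i + w i)) \
      (Set.Icc (0 : ℝ) L ×ˢ Set.Icc (0 : ℝ) 1)) ((isOpen_Ioo.prod isOpen_Ioo).sdiff hcl)
      ⟨z, hz, hzR⟩ (fun p hp => by rw [hQ]; exact subset_closure hp.1) ?_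
    intro p hp
    by_cases hpi : p ∈ Q i
    · exact .inl ⟨hpi, fun h => h.2 hp⟩
    · exact .inr (hcov' i p hp hpi)

end SqTiling

namespace SqTiling

variable {I : Type*} (S : SqTiling I)

/-- Exchange of the two coordinates. -/
def swap : SqTiling I where
  adj := S.adj
  adj_symm := S.adj_symm
  sL := S.sB
  sR := S.sT
  sB := S.sL
  sT := S.sR
  L := S.H
  H := S.L
  L_pos := S.H_pos
  H_pos := S.L_pos
  x := S.y
  y := S.x
  w := S.w
  w_nonneg := S.w_nonneg
  adj_x := S.adj_y
  adj_y := S.adj_x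
  x_sL := S.y_sB
  x_sR := S.y_sT
  y_sB := S.x_sL
  y_sT := S.x_sR
  vert := S.horiz
  horiz := S.vert
  disj := fun i j h1 h2 h3 h4 h5 h6 h7 => S.disj i j h1 h2 h3 h6 h7 h4 h5
  inR := fun i h => ⟨(S.inR i h).2.2.1, (S.inR i h).2.2.2, (S.inR i h).1, (S.inR i h).2.1⟩

/-- The tiles met by the interior of a vertical line. -/
def line (t : ℝ) : Set I := {i | S.x i < t ∧ t < S.x i + S.w i}

/-- The tiles met by a vertical segment. -/
def segTiles (t a b : ℝ) : Set I := {i | i ∈ S.line t ∧ S.y i ≤ b ∧ a ≤ S.y i + S.w i}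

variable {S} {t a b : ℝ} {i j : I}

theorem w_pos_of_mem_line (h : i ∈ S.line t) : 0 < S.w i := by
  have := h.1.trans h.2; linarith

theorem line_disj (hi : i ∈ S.line t) (hj : j ∈ S.line t) (h : i ≠ j) :
    S.y i + S.w i ≤ S.y j ∨ S.y j + S.w j ≤ S.y i := by
  by_contra hc
  push Not at hc
  exact S.disj i j h (w_pos_of_mem_line hi) (w_pos_of_mem_line hj) (hi.1.trans hj.2)
    (hj.1.trans hi.2) hc.2 hc.1

theorem exists_linked_line (ht : ∀ i, t ≠ S.x i ∧ t ≠ S.x i + S.w i) (h0 : 0 < t) (h1 : t < S.L) :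
    ∃ u ∈ S.sB, ∃ v ∈ S.sT, Linked S.adj (S.line t) u v := by
  obtain ⟨u, hu, v, hv, h⟩ := S.vert t h0.le h1.le
  exact ⟨u, hu, v, hv, h.mono fun i hi =>
    ⟨lt_of_le_of_ne hi.1 (ht i).1.symm, lt_of_le_of_ne hi.2 (ht i).2⟩⟩

theorem mem_sT_or_climb (ht : ∀ i, t ≠ S.x i ∧ t ≠ S.x i + S.w i) (h0 : 0 < t) (h1 : t < S.L)
    (hi : i ∈ S.line t) :
    (i ∈ S.sT ∧ S.y i + S.w i = S.H) ∨ ∃ j ∈ S.line t, S.adj i j ∧ S.y j = S.y i + S.w i := by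
  obtain ⟨u, hu, v, hv, h⟩ := exists_linked_line ht h0 h1
  have hwi := w_pos_of_mem_line hi
  have hR := S.inR i hwi
  by_cases hiv : i = v
  · left
    exact ⟨hiv ▸ hv, le_antisymm hR.2.2.2 (hiv ▸ S.y_sT v hv)⟩
  right
  have hvi : S.y i + S.w i ≤ S.y v := by
    rcases line_disj hi h.right_mem hiv with h' | h'
    · exact h'
    · linarith [S.y_sT v hv, hR.2.2.2]
  have hwv := w_pos_of_mem_line h.right_mem
  have hui : S.y u + S.w u ≤ S.y i + S.w i := by
    by_cases hiu : i = u
    · rw [hiu]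
    · rcases line_disj hi h.left_mem hiu with h' | h'
      · linarith [S.y_sB u hu, hR.2.2.1]
      · linarith
  obtain ⟨p, q, hp, hpq, hq, hq'⟩ := h.exists_exit (S := {k | S.y k + S.w k ≤ S.y i + S.w i}) hui
    (by simp only [Set.mem_ofPred_eq]; linarith)
  have hp1 := hp.right_mem
  simp only [Set.mem_ofPred_eq, not_le] at hq'
  have hp2 : S.y p + S.w p ≤ S.y i + S.w i := hp1.2
  have hqy : S.y q ≤ S.y p + S.w p := S.adj_y p q hpq
  have hiq : i ≠ q := by rintro rfl; exact lt_irrefl _ hq'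
  have hiq2 : S.y i + S.w i ≤ S.y q := by
    rcases line_disj hi hq hiq with h' | h'
    · exact h'
    · linarith
  have hip : i = p := by
    by_contra hne
    rcases line_disj hi hp1.1 hne with h' | h'
    · linarith [w_pos_of_mem_line hp1.1]
    · linarith
  exact ⟨q, hq, hip ▸ hpq, by linarith⟩

/-- Climbing a vertical line from the tile `i`. -/
theorem climb_induction [Finite I]
    {P : I → Prop} (hP : ∀ i ∈ S.line t,
      (∀ j ∈ S.line t, S.adj i j → S.y j = S.y i + S.w i → P j) → P i) :
    ∀ i ∈ S.line t, P i := by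
  intro i
  induction i using (measure fun i => Nat.card {j | S.y i < S.y j}).wf.induction with
  | _ i ih =>
    intro hi
    refine hP i hi fun j hj hij hy => ih j ?_ hj
    have := w_pos_of_mem_line hi
    change Nat.card _ < Nat.card _
    refine Set.ncard_lt_ncard ?_ (Set.toFinite _)
    refine ⟨fun k (hk : S.y j < S.y k) => show S.y i < S.y k by linarith, fun hsub => ?_⟩
    exact lt_irrefl (S.y j) (hsub (show S.y i < S.y j by linarith))

theorem segTiles_linked [Finite I] (ht : ∀ i, t ≠ S.x i ∧ t ≠ S.x i + S.w i) (h0 : 0 < t)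
    (h1 : t < S.L)
    (hi : i ∈ S.segTiles t a b) (hj : j ∈ S.segTiles t a b) :
    Linked S.adj (S.segTiles t a b) i j := by
  have key : ∀ j ∈ S.segTiles t a b, ∀ i ∈ S.line t, i ∈ S.segTiles t a b → S.y i ≤ S.y j →
      Linked S.adj (S.segTiles t a b) i j := by
    intro j hj
    refine climb_induction ?_
    intro i hi ih hi' hij
    by_cases h : i = j
    · subst h; exact .refl hj
    have hwj := w_pos_of_mem_line hj.1
    have hle : S.y i + S.w i ≤ S.y j := by
      rcases line_disj hi hj.1 h with h' | h' <;> linarith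
    have hRj := S.inR j hwj
    rcases mem_sT_or_climb ht h0 h1 hi with ⟨_, h'⟩ | ⟨k, hk, hik, hyk⟩
    · linarith
    · have hk' : k ∈ S.segTiles t a b := by
        refine ⟨hk, ?_, ?_⟩
        · linarith [hj.2.1]
        · linarith [hi'.2.2, w_pos_of_mem_line hk]
      exact (Linked.single hi' hk' hik).trans (ih k hk hik hyk hk' (by linarith))
  rcases le_total (S.y i) (S.y j) with h | h
  · exact key j hj i hi.1 hi h
  · exact (key i hi j hj.1 hj h).symm S.adj_symm

theorem exists_linked_sT [Finite I] (ht : ∀ i, t ≠ S.x i ∧ t ≠ S.x i + S.w i) (h0 : 0 < t)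
    (h1 : t < S.L)
    (hb : S.H ≤ b) (hi : i ∈ S.segTiles t a b) :
    ∃ j ∈ S.sT, j ∈ S.segTiles t a b := by
  suffices h : ∀ i ∈ S.line t, i ∈ S.segTiles t a b → ∃ j ∈ S.sT, j ∈ S.segTiles t a b from
    h i hi.1 hi
  refine climb_induction ?_
  intro i hi ih hi'
  rcases mem_sT_or_climb ht h0 h1 hi with ⟨h', _⟩ | ⟨k, hk, hik, hyk⟩
  · exact ⟨i, h', hi'⟩
  · have hRk := S.inR k (w_pos_of_mem_line hk)
    have hwk := w_pos_of_mem_line hk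
    exact ih k hk hik hyk ⟨hk, by linarith, by linarith [hi'.2.2]⟩

theorem exists_linked_sB (ht : ∀ i, t ≠ S.x i ∧ t ≠ S.x i + S.w i) (h0 : 0 < t) (h1 : t < S.L)
    (ha : a ≤ 0) (hi : i ∈ S.segTiles t a b) :
    ∃ j ∈ S.sB, j ∈ S.segTiles t a b := by
  obtain ⟨u, hu, v, hv, h⟩ := exists_linked_line ht h0 h1
  have hwu := w_pos_of_mem_line h.left_mem
  have hy := S.y_sB u hu
  have hR := S.inR i (w_pos_of_mem_line hi.1)
  exact ⟨u, hu, h.left_mem, by linarith [hi.2.1], by linarith⟩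

/-! ### Nodes: the tiles and the exterior of the rectangle -/

variable (S)

/-- The plane set of a node; `none` is the complement of the open rectangle. -/
def Q : Option I → Set (ℝ × ℝ)
  | none => {z | ¬ (0 < z.1 ∧ z.1 < S.L ∧ 0 < z.2 ∧ z.2 < S.H)}
  | some i => Set.Icc (S.x i) (S.x i + S.w i) ×ˢ Set.Icc (S.y i) (S.y i + S.w i)

/-- The union of the four sides. -/
def sides : Set I := S.sL ∪ S.sR ∪ S.sB ∪ S.sT

/-- Adjacency of nodes. -/
def nadj : Option I → Option I → Prop
  | none, none => False
  | none, some i => i ∈ S.sides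
  | some i, none => i ∈ S.sides
  | some i, some j => S.adj i j

theorem nadj_symm : ∀ ⦃i j : Option I⦄, S.nadj i j → S.nadj j i
  | none, none, h => h
  | none, some _, h => h
  | some _, none, h => h
  | some _, some _, h => S.adj_symm h

theorem linked_some {A : Set I} {A' : Set (Option I)} (hA : ∀ i ∈ A, some i ∈ A')
    (h : Linked S.adj A i j) : Linked S.nadj A' (some i) (some j) :=
  h.map some hA fun a ha b hb hab => .single (hA a ha) (hA b hb) hab

/-- The nodes met by a plane set. -/
def hits (E : Set (ℝ × ℝ)) : Set (Option I) := {n | (S.Q n ∩ E).Nonempty}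

/-- Radii whose sphere avoids all the lines supporting sides of squares. -/
def Generic (c : ℝ × ℝ) (t : ℝ) : Prop :=
  (∀ i, c.1 + t ≠ S.x i ∧ c.1 + t ≠ S.x i + S.w i) ∧ (c.1 + t ≠ 0 ∧ c.1 + t ≠ S.L) ∧
  (∀ i, c.1 - t ≠ S.x i ∧ c.1 - t ≠ S.x i + S.w i) ∧ (c.1 - t ≠ 0 ∧ c.1 - t ≠ S.L) ∧
  (∀ i, c.2 + t ≠ S.y i ∧ c.2 + t ≠ S.y i + S.w i) ∧ (c.2 + t ≠ 0 ∧ c.2 + t ≠ S.H) ∧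
  (∀ i, c.2 - t ≠ S.y i ∧ c.2 - t ≠ S.y i + S.w i) ∧ (c.2 - t ≠ 0 ∧ c.2 - t ≠ S.H)

theorem finite_not_generic [Finite I] (c : ℝ × ℝ) : {t | ¬ S.Generic c t}.Finite := by
  have key : ∀ (u v : ℝ) (f g : I → ℝ),
      {t : ℝ | ¬ ((∀ i, u + t ≠ f i ∧ u + t ≠ g i) ∧ (u + t ≠ 0 ∧ u + t ≠ v))}.Finite := by
    intro u v f g
    refine (((Set.finite_range fun i => f i - u).union (Set.finite_range fun i => g i - u)).union
      (Set.toFinite {-u, v - u})).subset ?_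
    intro t ht
    by_contra hc
    simp only [Set.mem_union, Set.mem_range, Set.mem_insert_iff, Set.mem_singleton_iff, not_or,
      not_exists] at hc
    refine ht ⟨fun i => ⟨fun h => hc.1.1 i ?_, fun h => hc.1.2 i ?_⟩, fun h => hc.2.1 ?_,
      fun h => hc.2.2 ?_⟩ <;> linarith
  have key' : ∀ (u v : ℝ) (f g : I → ℝ),
      {t : ℝ | ¬ ((∀ i, u - t ≠ f i ∧ u - t ≠ g i) ∧ (u - t ≠ 0 ∧ u - t ≠ v))}.Finite := by
    intro u v f g
    refine (Set.Finite.preimage (f := fun t : ℝ => -t) neg_injective.injOn (key u v f g)).subset ?_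
    intro t ht
    simpa only [Set.mem_preimage, Set.mem_ofPred_eq, ← sub_eq_add_neg] using ht
  refine ((((key c.1 S.L S.x fun i => S.x i + S.w i).union
    (key' c.1 S.L S.x fun i => S.x i + S.w i)).union
    (key c.2 S.H S.y fun i => S.y i + S.w i)).union
    (key' c.2 S.H S.y fun i => S.y i + S.w i)).subset ?_
  intro t ht
  by_contra hc
  simp only [Set.mem_union, Set.mem_ofPred_eq, not_or, not_not] at hc
  exact ht ⟨hc.1.1.1.1, hc.1.1.1.2, hc.1.1.2.1, hc.1.1.2.2, hc.1.2.1, hc.1.2.2, hc.2.1, hc.2.2⟩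

theorem exists_Q (z : ℝ × ℝ) : ∃ n, z ∈ S.Q n := by
  by_cases h : 0 < z.1 ∧ z.1 < S.L ∧ 0 < z.2 ∧ z.2 < S.H
  · obtain ⟨u, hu, v, hv, hl⟩ := S.vert z.1 h.1.le h.2.1.le
    by_contra hc
    push Not at hc
    have : S.y v + S.w v < z.2 := by
      refine hl.induction (P := fun v => S.y v + S.w v < z.2) ?_ ?_
      · by_contra hn
        exact hc (some u) ⟨hl.left_mem, by rw [S.y_sB u hu]; exact h.2.2.1.le, not_lt.1 hn⟩
      · intro p q _ ih hpq hq
        by_contra hn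
        exact hc (some q) ⟨hq, (S.adj_y p q hpq).trans ih.le, not_lt.1 hn⟩
    linarith [S.y_sT v hv]
  · exact ⟨none, h⟩

/-- A vertical segment of the plane. -/
def vseg (s a b : ℝ) : Set (ℝ × ℝ) := {s} ×ˢ Set.Icc a b

variable {S}

theorem some_mem_hits_vseg {s : ℝ} (hs : ∀ i, s ≠ S.x i ∧ s ≠ S.x i + S.w i)
    (hab : a ≤ b) : some i ∈ S.hits (vseg s a b) ↔ i ∈ S.segTiles s a b := by
  constructor
  · rintro ⟨⟨z1, z2⟩, ⟨hz, hz'⟩, hz1, hz2⟩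
    dsimp only at hz hz' hz1 hz2
    obtain rfl : z1 = s := hz1
    exact ⟨⟨lt_of_le_of_ne hz.1 (hs i).1.symm, lt_of_le_of_ne hz.2 (hs i).2⟩,
      hz'.1.trans hz2.2, hz2.1.trans hz'.2⟩
  · rintro ⟨h, h1, h2⟩
    have := S.w_nonneg i
    refine ⟨(s, max a (S.y i)), ⟨⟨h.1.le, h.2.le⟩, le_max_right _ _, max_le h2 (by linarith)⟩,
      rfl, le_max_left _ _, max_le hab h1⟩

theorem vseg_linked [Finite I] {s : ℝ} (hs : ∀ i, s ≠ S.x i ∧ s ≠ S.x i + S.w i)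
    (hs' : s ≠ 0 ∧ s ≠ S.L)
    (hab : a ≤ b) {m n : Option I} (hm : m ∈ S.hits (vseg s a b))
    (hn : n ∈ S.hits (vseg s a b)) : Linked S.nadj (S.hits (vseg s a b)) m n := by
  by_cases hin : 0 < s ∧ s < S.L
  · have hnone : ∀ i, none ∈ S.hits (vseg s a b) → some i ∈ S.hits (vseg s a b) →
        Linked S.nadj (S.hits (vseg s a b)) (some i) none := by
      rintro i h0 hi
      have hi' := (some_mem_hits_vseg hs hab).1 hi
      have h0' := h0
      obtain ⟨⟨z1, z2⟩, hz, hz1, hz2⟩ := h0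
      obtain rfl : z1 = s := hz1
      have hj : ∃ j ∈ S.sides, j ∈ S.segTiles z1 a b := by
        by_cases ha : a ≤ 0
        · obtain ⟨j, hj, hj'⟩ := exists_linked_sB hs hin.1 hin.2 ha hi'
          exact ⟨j, .inl (.inr hj), hj'⟩
        · have hb : S.H ≤ b := by
            by_contra hb
            exact hz ⟨hin.1, hin.2, (not_le.1 ha).trans_le hz2.1, hz2.2.trans_lt (not_le.1 hb)⟩
          obtain ⟨j, hj, hj'⟩ := exists_linked_sT hs hin.1 hin.2 hb hi'
          exact ⟨j, .inr hj, hj'⟩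
      obtain ⟨j, hj, hj'⟩ := hj
      exact (S.linked_some (fun k hk => (some_mem_hits_vseg hs hab).2 hk)
        (segTiles_linked hs hin.1 hin.2 hi' hj')).tail hj h0'
    match m, n with
    | none, none => exact .refl hm
    | some i, none => exact hnone i hn hm
    | none, some i => exact (hnone i hm hn).symm S.nadj_symm
    | some i, some j =>
      exact S.linked_some (fun k hk => (some_mem_hits_vseg hs hab).2 hk)
        (segTiles_linked hs hin.1 hin.2 ((some_mem_hits_vseg hs hab).1 hm)
          ((some_mem_hits_vseg hs hab).1 hn))
  · have : ∀ n ∈ S.hits (vseg s a b), n = none := by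
      intro n hn
      match n with
      | none => rfl
      | some i =>
        have := (some_mem_hits_vseg hs hab).1 hn
        have hR := S.inR i (w_pos_of_mem_line this.1)
        exact (hin ⟨hR.1.trans_lt this.1.1, this.1.2.trans_le hR.2.1⟩).elim
    obtain rfl := this m hm
    obtain rfl := this n hn
    exact .refl hm

theorem swap_Q (n : Option I) : S.swap.Q n = Prod.swap ⁻¹' S.Q n := by
  match n with
  | none => ext z; simp only [Q, swap, Set.mem_ofPred_eq, Set.mem_preimage, Prod.swap]; tauto
  | some i => ext z; simp only [Q, swap, Set.mem_prod, Set.mem_preimage, Prod.swap]; tauto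

theorem swap_nadj : S.swap.nadj = S.nadj := by
  ext m n
  match m, n with
  | none, none => rfl
  | some i, none => simp only [nadj, swap, sides, Set.mem_union]; tauto
  | none, some i => simp only [nadj, swap, sides, Set.mem_union]; tauto
  | some i, some j => rfl

theorem swap_hits (E : Set (ℝ × ℝ)) : S.swap.hits E = S.hits (Prod.swap ⁻¹' E) := by
  ext n
  constructor
  · rintro ⟨z, hz, hz'⟩
    rw [swap_Q] at hz
    exact ⟨z.swap, hz, by simpa using hz'⟩
  · rintro ⟨z, hz, hz'⟩
    exact ⟨z.swap, by rw [swap_Q]; simpa using hz, hz'⟩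

/-- A horizontal segment of the plane. -/
def hseg (s a b : ℝ) : Set (ℝ × ℝ) := Prod.swap ⁻¹' vseg s a b

theorem hseg_linked [Finite I] {s : ℝ} (hs : ∀ i, s ≠ S.y i ∧ s ≠ S.y i + S.w i)
    (hs' : s ≠ 0 ∧ s ≠ S.H)
    (hab : a ≤ b) {m n : Option I} (hm : m ∈ S.hits (hseg s a b))
    (hn : n ∈ S.hits (hseg s a b)) : Linked S.nadj (S.hits (hseg s a b)) m n := by
  have := vseg_linked (S := S.swap) hs hs' hab (m := m) (n := n)
  rw [swap_hits, swap_nadj] at this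
  exact this hm hn

theorem sphere_eq {c : ℝ × ℝ} (ht : 0 ≤ t) : Metric.sphere c t =
    vseg (c.1 - t) (c.2 - t) (c.2 + t) ∪ vseg (c.1 + t) (c.2 - t) (c.2 + t) ∪
    (hseg (c.2 - t) (c.1 - t) (c.1 + t) ∪ hseg (c.2 + t) (c.1 - t) (c.1 + t)) := by
  ext z
  simp only [Metric.mem_sphere, Prod.dist_eq, Real.dist_eq, vseg, hseg, Set.mem_union,
    Set.mem_prod, Set.mem_singleton_iff, Set.mem_Icc, Set.mem_preimage, Prod.fst_swap,
    Prod.snd_swap]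
  constructor
  · intro h
    have h1 : |z.1 - c.1| ≤ t := h ▸ le_max_left _ _
    have h2 : |z.2 - c.2| ≤ t := h ▸ le_max_right _ _
    rw [abs_le] at h1 h2
    have i1 : c.1 - t ≤ z.1 ∧ z.1 ≤ c.1 + t := by constructor <;> linarith
    have i2 : c.2 - t ≤ z.2 ∧ z.2 ≤ c.2 + t := by constructor <;> linarith
    rcases max_choice |z.1 - c.1| |z.2 - c.2| with h' | h' <;> rw [h'] at h <;>
      rcases (abs_eq ht).1 h with h'' | h''
    · exact .inl (.inr ⟨by linarith, i2⟩)
    · exact .inl (.inl ⟨by linarith, i2⟩)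
    · exact .inr (.inr ⟨by linarith, i1⟩)
    · exact .inr (.inl ⟨by linarith, i1⟩)
  · rintro ((⟨h1, h2⟩ | ⟨h1, h2⟩) | (⟨h1, h2⟩ | ⟨h1, h2⟩)) <;> rw [h1]
    · have : |z.2 - c.2| ≤ t := abs_le.2 ⟨by linarith, by linarith⟩
      rw [sub_sub_cancel_left, abs_neg, abs_of_nonneg ht, max_eq_left this]
    · have : |z.2 - c.2| ≤ t := abs_le.2 ⟨by linarith, by linarith⟩
      rw [add_sub_cancel_left, abs_of_nonneg ht, max_eq_left this]
    · have : |z.1 - c.1| ≤ t := abs_le.2 ⟨by linarith, by linarith⟩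
      rw [sub_sub_cancel_left, abs_neg, abs_of_nonneg ht, max_eq_right this]
    · have : |z.1 - c.1| ≤ t := abs_le.2 ⟨by linarith, by linarith⟩
      rw [add_sub_cancel_left, abs_of_nonneg ht, max_eq_right this]

theorem hits_union (E F : Set (ℝ × ℝ)) : S.hits (E ∪ F) = S.hits E ∪ S.hits F := by
  ext n
  simp only [hits, Set.inter_union_distrib_left, Set.union_nonempty, Set.mem_ofPred_eq,
      Set.mem_union]

theorem hits_mono {E F : Set (ℝ × ℝ)} (h : E ⊆ F) : S.hits E ⊆ S.hits F :=
  fun _ hn => hn.mono (Set.inter_subset_inter_right _ h)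

/-- The nodes met by a generic sphere are linked to each other. -/
theorem sphere_linked [Finite I] {c : ℝ × ℝ} (ht : 0 ≤ t) (hg : S.Generic c t) {m n : Option I}
    (hm : m ∈ S.hits (Metric.sphere c t)) (hn : n ∈ S.hits (Metric.sphere c t)) :
    Linked S.nadj (S.hits (Metric.sphere c t)) m n := by
  obtain ⟨g1, g1', g2, g2', g3, g3', g4, g4'⟩ := hg
  have h1 : c.2 - t ≤ c.2 + t := by linarith
  have h2 : c.1 - t ≤ c.1 + t := by linarith
  have hV : ∀ s, (s = c.1 - t ∨ s = c.1 + t) → ∀ m n, m ∈ S.hits (vseg s (c.2 - t) (c.2 + t)) →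
      n ∈ S.hits (vseg s (c.2 - t) (c.2 + t)) → Linked S.nadj (S.hits (Metric.sphere c t)) m n := by
    intro s hs m n hm hn
    have hsub : S.hits (vseg s (c.2 - t) (c.2 + t)) ⊆ S.hits (Metric.sphere c t) := by
      apply hits_mono; rw [sphere_eq ht]
      rcases hs with rfl | rfl
      exacts [fun z hz => .inl (.inl hz), fun z hz => .inl (.inr hz)]
    rcases hs with rfl | rfl
    exacts [(vseg_linked g2 g2' h1 hm hn).mono hsub, (vseg_linked g1 g1' h1 hm hn).mono hsub]
  have hH : ∀ s, (s = c.2 - t ∨ s = c.2 + t) → ∀ m n, m ∈ S.hits (hseg s (c.1 - t) (c.1 + t)) →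
      n ∈ S.hits (hseg s (c.1 - t) (c.1 + t)) → Linked S.nadj (S.hits (Metric.sphere c t)) m n := by
    intro s hs m n hm hn
    have hsub : S.hits (hseg s (c.1 - t) (c.1 + t)) ⊆ S.hits (Metric.sphere c t) := by
      apply hits_mono; rw [sphere_eq ht]
      rcases hs with rfl | rfl
      exacts [fun z hz => .inr (.inl hz), fun z hz => .inr (.inr hz)]
    rcases hs with rfl | rfl
    exacts [(hseg_linked g4 g4' h2 hm hn).mono hsub, (hseg_linked g3 g3' h2 hm hn).mono hsub]
  have hVH : ∀ s, (s = c.1 - t ∨ s = c.1 + t) → ∀ u, (u = c.2 - t ∨ u = c.2 + t) → ∀ m n,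
      m ∈ S.hits (vseg s (c.2 - t) (c.2 + t)) → n ∈ S.hits (hseg u (c.1 - t) (c.1 + t)) →
      Linked S.nadj (S.hits (Metric.sphere c t)) m n := by
    intro s hs u hu m n hm hn
    obtain ⟨k, hk⟩ := S.exists_Q (s, u)
    have k1 : k ∈ S.hits (vseg s (c.2 - t) (c.2 + t)) :=
      ⟨_, hk, rfl, by rcases hu with rfl | rfl <;> constructor <;> dsimp only <;> linarith⟩
    have k2 : k ∈ S.hits (hseg u (c.1 - t) (c.1 + t)) :=
      ⟨_, hk, rfl, by
        rcases hs with rfl | rfl <;> constructor <;> simp only [Prod.snd_swap] <;> linarith⟩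
    exact (hV s hs m k hm k1).trans (hH u hu k n k2 hn)
  obtain ⟨k, hk⟩ := S.exists_Q (c.1 - t, c.2 - t)
  have k1 : k ∈ S.hits (vseg (c.1 - t) (c.2 - t) (c.2 + t)) :=
    ⟨_, hk, rfl, le_rfl, h1⟩
  have k2 : k ∈ S.hits (hseg (c.2 - t) (c.1 - t) (c.1 + t)) := ⟨_, hk, rfl, le_rfl, h2⟩
  have main : ∀ m ∈ S.hits (Metric.sphere c t), Linked S.nadj (S.hits (Metric.sphere c t)) m k := by
    intro m hm
    rw [sphere_eq ht, hits_union, hits_union, hits_union] at hm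
    rcases hm with (hm | hm) | (hm | hm)
    · exact hV _ (.inl rfl) _ _ hm k1
    · exact hVH _ (.inr rfl) _ (.inl rfl) _ _ hm k2
    · exact hH _ (.inl rfl) _ _ hm k2
    · exact (hVH _ (.inl rfl) _ (.inr rfl) _ _ k1 hm).symm S.nadj_symm
  exact (main m hm).trans ((main n hn).symm S.nadj_symm)

/-- The tiles met by a small generic sphere centred in the rectangle are linked to each other
through tiles. -/
theorem sphere_linked_tiles [Finite I] {c : ℝ × ℝ} (ht : 0 ≤ t) (hg : S.Generic c t)
    (hc1 : 0 ≤ c.1) (hc1' : c.1 ≤ S.L) (hc2 : 0 ≤ c.2) (hc2' : c.2 ≤ S.H)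
    (htL : 2 * t < S.L) (htH : 2 * t < S.H)
    (hi : some i ∈ S.hits (Metric.sphere c t)) (hj : some j ∈ S.hits (Metric.sphere c t)) :
    Linked S.adj {k | some k ∈ S.hits (Metric.sphere c t)} i j := by
  obtain ⟨g1, g1', g2, g2', g3, g3', g4, g4'⟩ := hg
  have h1 : c.2 - t ≤ c.2 + t := by linarith
  have h2 : c.1 - t ≤ c.1 + t := by linarith
  have hV : ∀ s, (s = c.1 - t ∨ s = c.1 + t) → ∀ i j, some i ∈ S.hits (vseg s (c.2 - t) (c.2 + t)) →
      some j ∈ S.hits (vseg s (c.2 - t) (c.2 + t)) →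
      Linked S.adj {k | some k ∈ S.hits (Metric.sphere c t)} i j ∧ 0 < s ∧ s < S.L := by
    intro s hs i j hi hj
    have gs : ∀ i, s ≠ S.x i ∧ s ≠ S.x i + S.w i := by rcases hs with rfl | rfl <;> assumption
    have hsub : S.hits (vseg s (c.2 - t) (c.2 + t)) ⊆ S.hits (Metric.sphere c t) := by
      apply hits_mono; rw [sphere_eq ht]
      rcases hs with rfl | rfl
      exacts [fun z hz => .inl (.inl hz), fun z hz => .inl (.inr hz)]
    have hi' := (some_mem_hits_vseg gs h1).1 hi
    have hR := S.inR i (w_pos_of_mem_line hi'.1)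
    have p1 : 0 < s := hR.1.trans_lt hi'.1.1
    have p2 : s < S.L := hi'.1.2.trans_le hR.2.1
    exact ⟨(segTiles_linked gs p1 p2 hi' ((some_mem_hits_vseg gs h1).1 hj)).mono
      fun k hk => hsub ((some_mem_hits_vseg gs h1).2 hk), p1, p2⟩
  have hH : ∀ s, (s = c.2 - t ∨ s = c.2 + t) → ∀ i j, some i ∈ S.hits (hseg s (c.1 - t) (c.1 + t)) →
      some j ∈ S.hits (hseg s (c.1 - t) (c.1 + t)) →
      Linked S.adj {k | some k ∈ S.hits (Metric.sphere c t)} i j ∧ 0 < s ∧ s < S.H := by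
    intro s hs i j hi hj
    have gs : ∀ i, s ≠ S.y i ∧ s ≠ S.y i + S.w i := by rcases hs with rfl | rfl <;> assumption
    have hsub : S.hits (hseg s (c.1 - t) (c.1 + t)) ⊆ S.hits (Metric.sphere c t) := by
      apply hits_mono; rw [sphere_eq ht]
      rcases hs with rfl | rfl
      exacts [fun z hz => .inr (.inl hz), fun z hz => .inr (.inr hz)]
    have e : S.swap.hits (vseg s (c.1 - t) (c.1 + t)) = S.hits (hseg s (c.1 - t) (c.1 + t)) :=
      swap_hits _
    rw [← e] at hi hj hsub
    have hi' := (some_mem_hits_vseg (S := S.swap) gs h2).1 hi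
    have hR := S.inR i (w_pos_of_mem_line (S := S.swap) hi'.1)
    have p1 : 0 < s := hR.2.2.1.trans_lt hi'.1.1
    have p2 : s < S.H := hi'.1.2.trans_le hR.2.2.2
    exact ⟨(segTiles_linked (S := S.swap) gs p1 p2 hi'
      ((some_mem_hits_vseg (S := S.swap) gs h2).1 hj)).mono
      fun k hk => hsub ((some_mem_hits_vseg (S := S.swap) gs h2).2 hk), p1, p2⟩
  have hcorner : ∀ s, (s = c.1 - t ∨ s = c.1 + t) → ∀ u, (u = c.2 - t ∨ u = c.2 + t) →
      0 < s → s < S.L → 0 < u → u < S.H → ∃ k, some k ∈ S.hits (vseg s (c.2 - t) (c.2 + t)) ∧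
      some k ∈ S.hits (hseg u (c.1 - t) (c.1 + t)) := by
    intro s hs u hu a1 a2 a3 a4
    obtain ⟨k, hk⟩ := S.exists_Q (s, u)
    match k with
    | none => exact (hk ⟨a1, a2, a3, a4⟩).elim
    | some k =>
      exact ⟨k, ⟨_, hk, rfl, by rcases hu with rfl | rfl <;> constructor <;> dsimp only <;>
          linarith⟩,
        ⟨_, hk, rfl, by
        rcases hs with rfl | rfl <;> constructor <;> simp only [Prod.snd_swap] <;> linarith⟩⟩
  obtain ⟨s0, hs0, s1, s2⟩ : ∃ s, (s = c.1 - t ∨ s = c.1 + t) ∧ 0 < s ∧ s < S.L := by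
    by_cases h : c.1 + t < S.L
    · exact ⟨_, .inr rfl, lt_of_le_of_ne (by linarith) g1'.1.symm, h⟩
    · exact ⟨_, .inl rfl, by linarith, lt_of_le_of_ne (by linarith) g2'.2⟩
  obtain ⟨u0, hu0, u1, u2⟩ : ∃ s, (s = c.2 - t ∨ s = c.2 + t) ∧ 0 < s ∧ s < S.H := by
    by_cases h : c.2 + t < S.H
    · exact ⟨_, .inr rfl, lt_of_le_of_ne (by linarith) g3'.1.symm, h⟩
    · exact ⟨_, .inl rfl, by linarith, lt_of_le_of_ne (by linarith) g4'.2⟩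
  obtain ⟨k, k1, k2⟩ := hcorner s0 hs0 u0 hu0 s1 s2 u1 u2
  have mainV : ∀ s, (s = c.1 - t ∨ s = c.1 + t) → ∀ i,
      some i ∈ S.hits (vseg s (c.2 - t) (c.2 + t)) →
      Linked S.adj {k | some k ∈ S.hits (Metric.sphere c t)} i k := by
    intro s hs i hi
    obtain ⟨_, b1, b2⟩ := hV s hs i i hi hi
    obtain ⟨l, l1, l2⟩ := hcorner s hs u0 hu0 b1 b2 u1 u2
    exact (hV s hs i l hi l1).1.trans (hH u0 hu0 l k l2 k2).1
  have mainH : ∀ s, (s = c.2 - t ∨ s = c.2 + t) → ∀ i,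
      some i ∈ S.hits (hseg s (c.1 - t) (c.1 + t)) →
      Linked S.adj {k | some k ∈ S.hits (Metric.sphere c t)} i k := by
    intro s hs i hi
    obtain ⟨_, b1, b2⟩ := hH s hs i i hi hi
    obtain ⟨l, l1, l2⟩ := hcorner s0 hs0 s hs s1 s2 b1 b2
    exact (hH s hs i l hi l2).1.trans (hV s0 hs0 l k l1 k1).1
  have main : ∀ m, some m ∈ S.hits (Metric.sphere c t) →
      Linked S.adj {k | some k ∈ S.hits (Metric.sphere c t)} m k := by
    intro m hm
    rw [sphere_eq ht, hits_union, hits_union, hits_union] at hm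
    rcases hm with (hm | hm) | (hm | hm)
    · exact mainV _ (.inl rfl) _ hm
    · exact mainV _ (.inr rfl) _ hm
    · exact mainH _ (.inl rfl) _ hm
    · exact mainH _ (.inr rfl) _ hm
  exact (main i hi).trans ((main j hj).symm S.adj_symm)

end SqTiling

namespace SqTiling

variable {I : Type*} {S : SqTiling I} {t : ℝ} {c : ℝ × ℝ}

theorem nadj_meet : ∀ {m n : Option I}, S.nadj m n → (S.Q m ∩ S.Q n).Nonempty := by
  have side : ∀ i ∈ S.sides, (S.Q none ∩ S.Q (some i)).Nonempty := by
    intro i hi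
    have hw := S.w_nonneg i
    rcases hi with ((hi | hi) | hi) | hi
    · refine ⟨(S.x i, S.y i), fun h => ?_, ⟨le_rfl, ?_⟩, le_rfl, ?_⟩
      · linarith [S.x_sL i hi, h.1]
      all_goals simpa using hw
    · refine ⟨(S.x i + S.w i, S.y i), fun h => ?_, ⟨?_, le_rfl⟩, le_rfl, ?_⟩
      · linarith [S.x_sR i hi, h.2.1]
      all_goals simpa using hw
    · refine ⟨(S.x i, S.y i), fun h => ?_, ⟨le_rfl, ?_⟩, le_rfl, ?_⟩
      · linarith [S.y_sB i hi, h.2.2.1]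
      all_goals simpa using hw
    · refine ⟨(S.x i, S.y i + S.w i), fun h => ?_, ⟨le_rfl, ?_⟩, ?_, le_rfl⟩
      · linarith [S.y_sT i hi, h.2.2.2]
      all_goals simpa using hw
  intro m n h
  match m, n with
  | none, none => exact h.elim
  | none, some i => exact side i h
  | some i, none => rw [Set.inter_comm]; exact side i h
  | some i, some j =>
    have h1 := S.adj_x i j h
    have h2 := S.adj_x j i (S.adj_symm h)
    have h3 := S.adj_y i j h
    have h4 := S.adj_y j i (S.adj_symm h)
    have hi := S.w_nonneg i
    have hj := S.w_nonneg j
    refine ⟨(max (S.x i) (S.x j), max (S.y i) (S.y j)), ⟨⟨le_max_left _ _, ?_⟩,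
        le_max_left _ _, ?_⟩,
      ⟨le_max_right _ _, ?_⟩, le_max_right _ _, ?_⟩ <;> refine max_le ?_ ?_ <;> linarith

theorem lt_of_not_hits (ht : 0 ≤ t) {n : Option I} (hn : n ∉ S.hits (Metric.sphere c t))
    {z z' : ℝ × ℝ} (hz : z ∈ S.Q n) (hzt : dist z c ≤ t) (hz' : z' ∈ S.Q n) : dist z' c < t := by
  match n with
  | none =>
    exfalso
    have key : ∀ p, dist p c = t → 0 < p.1 ∧ p.1 < S.L ∧ 0 < p.2 ∧ p.2 < S.H := by
      intro p hp
      by_contra h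
      exact hn ⟨p, h, hp⟩
    have h1 := key (c.1 - t, c.2 - t) (by simp [Prod.dist_eq, abs_of_nonneg ht])
    have h2 := key (c.1 + t, c.2 + t) (by simp [Prod.dist_eq, abs_of_nonneg ht])
    rw [Prod.dist_eq, max_le_iff, Real.dist_eq, Real.dist_eq, abs_le, abs_le] at hzt
    dsimp only at h1 h2
    exact hz ⟨by linarith, by linarith, by linarith, by linarith⟩
  | some i =>
    by_contra hc
    have hconn : IsPreconnected (S.Q (some i)) := isPreconnected_Icc.prod isPreconnected_Icc
    obtain ⟨p, hp, hp'⟩ := hconn.intermediate_value hz hz'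
      (f := fun p => dist p c) (by fun_prop) ⟨hzt, not_lt.1 hc⟩
    exact hn ⟨p, hp, hp'⟩

/-- A chain of nodes which reaches both sides of a sphere meets the sphere. -/
theorem exists_mem_hits_sphere (ht : 0 ≤ t) {X : Set (Option I)} {m n : Option I}
    (h : Linked S.nadj X m n) {z z' : ℝ × ℝ} (hz : z ∈ S.Q m) (hzt : dist z c ≤ t)
    (hz' : z' ∈ S.Q n) (hzt' : t ≤ dist z' c) : ∃ k ∈ X, k ∈ S.hits (Metric.sphere c t) := by
  by_contra hc
  push Not at hc
  have : ∀ p ∈ S.Q n, dist p c < t := by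
    refine h.induction (P := fun n => ∀ p ∈ S.Q n, dist p c < t)
      (fun p hp => lt_of_not_hits ht (hc m h.left_mem) hz hzt hp) ?_
    intro a b _ ih hab hb p hp
    obtain ⟨q, hqa, hqb⟩ := nadj_meet hab
    exact lt_of_not_hits ht (hc b hb) hqb (ih q hqa).le hp
  exact absurd (this z' hz') (not_lt.2 hzt')

variable [Fintype I]

open Classical in
theorem sum_min_sq_le (S : SqTiling I) (c : ℝ × ℝ) {s : ℝ} (hs : 0 < s) :
    ∑ i with some i ∈ S.hits (Metric.closedBall c s), min (S.w i) s ^ 2 ≤ 16 * s ^ 2 := by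
  set P : Finset I := {i | some i ∈ S.hits (Metric.closedBall c s)} with hP
  have hsq : ∀ i ∈ P, ∃ p : ℝ × ℝ, S.x i ≤ p.1 ∧ p.1 + min (S.w i) s ≤ S.x i + S.w i ∧
      S.y i ≤ p.2 ∧ p.2 + min (S.w i) s ≤ S.y i + S.w i ∧ c.1 - 2 * s ≤ p.1 ∧
      p.1 + min (S.w i) s ≤ c.1 + 2 * s ∧ c.2 - 2 * s ≤ p.2 ∧
        p.2 + min (S.w i) s ≤ c.2 + 2 * s := by
    intro i hi
    simp only [hP, Finset.mem_filter, Finset.mem_univ, true_and] at hi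
    obtain ⟨z, ⟨⟨h1, h2⟩, h3, h4⟩, hz⟩ := hi
    rw [Metric.mem_closedBall, Prod.dist_eq, max_le_iff, Real.dist_eq, Real.dist_eq, abs_le,
      abs_le] at hz
    have m1 := min_le_left (S.w i) s
    have m2 := min_le_right (S.w i) s
    have m3 : 0 ≤ min (S.w i) s := le_min (S.w_nonneg i) hs.le
    refine ⟨(max (S.x i) (z.1 - min (S.w i) s), max (S.y i) (z.2 - min (S.w i) s)),
        le_max_left _ _, ?_,
      le_max_left _ _, ?_, ?_, ?_, ?_, ?_⟩ <;> dsimp only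
    · rcases max_choice (S.x i) (z.1 - min (S.w i) s) with h | h <;> rw [h] <;> linarith
    · rcases max_choice (S.y i) (z.2 - min (S.w i) s) with h | h <;> rw [h] <;> linarith
    · exact le_max_of_le_right (by linarith)
    · rcases max_choice (S.x i) (z.1 - min (S.w i) s) with h | h <;> rw [h] <;> linarith
    · exact le_max_of_le_right (by linarith)
    · rcases max_choice (S.y i) (z.2 - min (S.w i) s) with h | h <;> rw [h] <;> linarith
  choose! p hp using hsq
  let U : I → Set (ℝ × ℝ) := fun i =>
    Set.Ioo (p i).1 ((p i).1 + min (S.w i) s) ×ˢ Set.Ioo (p i).2 ((p i).2 + min (S.w i) s)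
  have hU : ∀ i, volume (U i) = ENNReal.ofReal (min (S.w i) s ^ 2) := by
    intro i
    simp only [U, Measure.volume_eq_prod, Measure.prod_prod, Real.volume_Ioo]
    rw [add_sub_cancel_left, add_sub_cancel_left,
      ← ENNReal.ofReal_mul (le_min (S.w_nonneg i) hs.le), pow_two]
  have hdis : Set.PairwiseDisjoint (P : Set I) U := by
    intro i hi j hj hij
    refine Set.disjoint_left.2 ?_
    rintro z ⟨⟨a1, a2⟩, a3, a4⟩ ⟨⟨b1, b2⟩, b3, b4⟩
    have pi := hp i hi
    have pj := hp j hj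
    exact S.disj i j hij (by linarith) (by linarith) (by linarith) (by linarith) (by linarith)
      (by linarith)
  have hsub : (⋃ i ∈ P, U i) ⊆ Set.Icc (c.1 - 2 * s) (c.1 + 2 * s) ×ˢ
      Set.Icc (c.2 - 2 * s) (c.2 + 2 * s) := by
    refine Set.iUnion₂_subset fun i hi => ?_
    have pi := hp i hi
    rintro z ⟨⟨a1, a2⟩, a3, a4⟩
    exact ⟨⟨by linarith, by linarith⟩, by linarith, by linarith⟩
  have hm := measure_mono (μ := volume) hsub
  rw [measure_biUnion_finset hdis fun i _ => measurableSet_Ioo.prod measurableSet_Ioo,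
    Finset.sum_congr rfl fun i _ => hU i, ← ENNReal.ofReal_sum_of_nonneg fun i _ => sq_nonneg _,
    Measure.volume_eq_prod, Measure.prod_prod, Real.volume_Icc, Real.volume_Icc,
    ← ENNReal.ofReal_mul (by linarith), ENNReal.ofReal_le_ofReal_iff (by nlinarith)] at hm
  nlinarith [hm]

open Classical in
/-- A discrete length-area inequality. -/
theorem length_area (S : SqTiling I) (c : ℝ × ℝ) {s : ℝ} (hs : 0 < s) {v : Option I → ℝ}
    (hv : ∀ n, 0 ≤ v n) (hnone : v none ≤ 1 / 2)
    (h : ∀ t, s < t → t < 2 * s → S.Generic c t →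
      ∃ A : Finset (Option I), (A : Set (Option I)) ⊆ S.hits (Metric.sphere c t) ∧
        1 ≤ ∑ n ∈ A, v n) :
    1 / 256 ≤ ∑ i, v (some i) ^ 2 := by
  let P : Finset I := {i | some i ∈ S.hits (Metric.closedBall c (2 * s))}
  let m : I → ℝ := fun i => sInf ((fun z => dist z c) '' S.Q (some i))
  have hm : ∀ i t, some i ∈ S.hits (Metric.sphere c t) → m i ≤ t ∧ t ≤ m i + S.w i := by
    rintro i t ⟨z, hz, hzt⟩
    have hbdd : BddBelow ((fun z => dist z c) '' S.Q (some i)) :=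
      ⟨0, by rintro _ ⟨z, _, rfl⟩; exact dist_nonneg⟩
    rw [Metric.mem_sphere] at hzt
    refine ⟨hzt ▸ csInf_le hbdd ⟨z, hz, rfl⟩, ?_⟩
    suffices t - S.w i ≤ m i by linarith
    refine le_csInf ⟨_, ⟨z, hz, rfl⟩⟩ ?_
    rintro _ ⟨z', hz', rfl⟩
    have : dist z z' ≤ S.w i := by
      rw [Prod.dist_eq, Real.dist_eq, Real.dist_eq, max_le_iff, abs_le, abs_le]
      obtain ⟨⟨a1, a2⟩, a3, a4⟩ := hz
      obtain ⟨⟨b1, b2⟩, b3, b4⟩ := hz'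
      refine ⟨⟨?_, ?_⟩, ?_, ?_⟩ <;> linarith
    have := dist_triangle z z' c
    dsimp only; linarith
  let K : I → Set ℝ := fun i => Set.Icc (m i) (m i + S.w i) ∩ Set.Ioo s (2 * s)
  have hKm : ∀ i, MeasurableSet (K i) := fun i => measurableSet_Icc.inter measurableSet_Ioo
  have hK : ∀ i, volume (K i) ≤ ENNReal.ofReal (min (S.w i) (2 * s)) := by
    intro i
    rcases le_total (S.w i) (2 * s) with h' | h'
    · rw [min_eq_left h']
      exact (measure_mono Set.inter_subset_left).trans
          (by rw [Real.volume_Icc, add_sub_cancel_left])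
    · rw [min_eq_right h']
      refine (measure_mono Set.inter_subset_right).trans ?_
      rw [Real.volume_Ioo]
      exact ENNReal.ofReal_le_ofReal (by linarith)
  have hpt : ∀ᵐ t ∂(volume.restrict (Set.Ioo s (2 * s))), ENNReal.ofReal (1 / 2) ≤
      ∑ i ∈ P, (K i).indicator (fun _ => ENNReal.ofReal (v (some i))) t := by
    have hgen : ∀ᵐ t ∂(volume : Measure ℝ), S.Generic c t :=
      (S.finite_not_generic c).measure_zero volume
    filter_upwards [ae_restrict_mem measurableSet_Ioo, ae_restrict_of_ae hgen] with t ht hg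
    obtain ⟨A, hA, hA1⟩ := h t ht.1 ht.2 hg
    have e1 : ∑ n ∈ A, v n ≤ 1 / 2 + ∑ i ∈ P with some i ∈ A, v (some i) := by
      have : A ⊆ insert none (({i ∈ P | some i ∈ A} : Finset I).map Function.Embedding.some) := by
        intro n hn
        match n with
        | none => simp
        | some i =>
          obtain ⟨z, hz, hzt⟩ := hA hn
          simp only [Finset.mem_insert, reduceCtorEq, Finset.mem_map, false_or]
          refine ⟨i, ?_, rfl⟩
          simp only [P, Finset.mem_filter, Finset.mem_univ, true_and]
          refine ⟨⟨z, hz, ?_⟩, hn⟩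
          rw [Metric.mem_sphere] at hzt
          rw [Metric.mem_closedBall, hzt]; exact ht.2.le
      refine (Finset.sum_le_sum_of_subset_of_nonneg this fun n _ _ => hv n).trans ?_
      rw [Finset.sum_insert (by simp), Finset.sum_map]
      exact add_le_add hnone le_rfl
    have e2 : (1 / 2 : ℝ) ≤ ∑ i ∈ P with some i ∈ A, v (some i) := by linarith
    refine (ENNReal.ofReal_le_ofReal e2).trans ?_
    rw [ENNReal.ofReal_sum_of_nonneg fun i _ => hv _, Finset.sum_filter]
    refine Finset.sum_le_sum fun i _ => ?_
    split_ifs with hi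
    · rw [Set.indicator_of_mem]
      exact ⟨hm i t (hA hi), ht⟩
    · exact zero_le
  have hint := lintegral_mono_ae hpt
  rw [lintegral_const, lintegral_finsetSum _ fun i _ => (measurable_const.indicator (hKm i)),
    Measure.restrict_apply MeasurableSet.univ, Set.univ_inter, Real.volume_Ioo,
    ← ENNReal.ofReal_mul (by norm_num)] at hint
  have hint2 : ENNReal.ofReal (1 / 2 * (2 * s - s)) ≤
      ∑ i ∈ P, ENNReal.ofReal (v (some i) * min (S.w i) (2 * s)) := by
    refine hint.trans (Finset.sum_le_sum fun i _ => ?_)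
    rw [lintegral_indicator_const (hKm i), ENNReal.ofReal_mul (hv _)]
    gcongr
    exact (Measure.restrict_apply_le _ _).trans (hK i)
  have hmin : ∀ i, 0 ≤ min (S.w i) (2 * s) := fun i => le_min (S.w_nonneg i) (by linarith)
  rw [← ENNReal.ofReal_sum_of_nonneg fun i _ => mul_nonneg (hv _) (hmin i),
    ENNReal.ofReal_le_ofReal_iff (Finset.sum_nonneg fun i _ => mul_nonneg (hv _) (hmin i))] at hint2
  have hcs := Finset.sum_mul_sq_le_sq_mul_sq P (fun i => v (some i)) fun i => min (S.w i) (2 * s)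
  have hpack : ∑ i ∈ P, min (S.w i) (2 * s) ^ 2 ≤ 16 * (2 * s) ^ 2 :=
    S.sum_min_sq_le c (by linarith)
  have hle : ∑ i ∈ P, v (some i) ^ 2 ≤ ∑ i, v (some i) ^ 2 :=
    Finset.sum_le_sum_of_subset_of_nonneg (Finset.subset_univ _) fun i _ _ => sq_nonneg _
  have h0 : 0 ≤ ∑ i, v (some i) ^ 2 := Finset.sum_nonneg fun i _ => sq_nonneg _
  have h1 : (s / 2) ^ 2 ≤ (∑ i ∈ P, v (some i) * min (S.w i) (2 * s)) ^ 2 := by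
    gcongr; linarith
  have h2 : (∑ i ∈ P, v (some i) ^ 2) * ∑ i ∈ P, min (S.w i) (2 * s) ^ 2 ≤
      (∑ i, v (some i) ^ 2) * (16 * (2 * s) ^ 2) :=
    mul_le_mul hle hpack (Finset.sum_nonneg fun i _ => sq_nonneg _) h0
  have h3 : (s / 2) ^ 2 ≤ (∑ i, v (some i) ^ 2) * (16 * (2 * s) ^ 2) := h1.trans (hcs.trans h2)
  have hs2 : 0 < s ^ 2 := by positivity
  by_contra hcon
  push Not at hcon
  nlinarith

end SqTiling

theorem measure_univ_lt_top_of_ahlforsRegular {Z : Type*} [MetricSpace Z] [CompactSpace Z]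
    [MeasurableSpace Z] {μ : Measure Z} {C : ℝ} (hreg : AhlforsRegular μ 2 C)
    (hD : 0 < Metric.diam (Set.univ : Set Z)) : μ Set.univ < ⊤ := by
  refine isCompact_univ.induction_on (p := fun s => μ s < ⊤) (by simp)
    (fun s t hst ht => (measure_mono hst).trans_lt ht)
    (fun s t hs ht => (measure_union_le s t).trans_lt (ENNReal.add_lt_top.2 ⟨hs, ht⟩)) ?_
  intro x _
  refine ⟨Metric.ball x (Metric.diam (Set.univ : Set Z)),
    mem_nhdsWithin_of_mem_nhds (Metric.ball_mem_nhds x hD), ?_⟩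
  exact ((hreg x _ hD le_rfl).2).trans_lt ENNReal.ofReal_lt_top

/-- In an Ahlfors 2-regular compact space, `ε`-separated subsets of `r`-balls have at most
`C₀ (r / ε)²` points. -/
theorem exists_card_le_of_ahlforsRegular {Z : Type*} [MetricSpace Z] [CompactSpace Z]
    [MeasurableSpace Z] [BorelSpace Z] {μ : Measure Z} {C : ℝ} (hC : 1 ≤ C)
    (hreg : AhlforsRegular μ 2 C) :
    ∃ C₀ : ℝ, 1 ≤ C₀ ∧ ∀ (x : Z) (r ε : ℝ), 0 < ε → ε ≤ r → ∀ A : Finset Z,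
      (∀ a ∈ A, dist a x ≤ r) → (∀ a ∈ A, ∀ b ∈ A, a ≠ b → ε ≤ dist a b) →
        (A.card : ℝ) ≤ C₀ * (r / ε) ^ 2 := by
  set D := Metric.diam (Set.univ : Set Z) with hDdef
  have hbdd : Bornology.IsBounded (Set.univ : Set Z) := isCompact_univ.isBounded
  rcases Metric.diam_nonneg.eq_or_lt' (a := D) with hD | hD
  · refine ⟨1, le_rfl, fun x r ε hε hr A hA hsep => ?_⟩
    have h1 : A.card ≤ 1 := by
      rw [Finset.card_le_one]
      intro a ha b hb
      by_contra hab
      have := Metric.dist_le_diam_of_mem hbdd (Set.mem_univ a) (Set.mem_univ b)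
      have := dist_pos.2 hab
      rw [← hDdef] at *
      linarith
    have h2 : 1 ≤ r / ε := (one_le_div hε).2 hr
    calc (A.card : ℝ) ≤ 1 := by exact_mod_cast h1
      _ ≤ 1 * (r / ε) ^ 2 := by nlinarith
  have hfin := measure_univ_lt_top_of_ahlforsRegular hreg hD
  set M := (μ Set.univ).toReal with hM
  have hM0 : 0 ≤ M := ENNReal.toReal_nonneg
  have hMeq : μ Set.univ = ENNReal.ofReal M := (ENNReal.ofReal_toReal hfin.ne).symm
  refine ⟨16 * C ^ 2 + 16 * C * M / D ^ 2, ?_, fun x r ε hε hr A hA hsep => ?_⟩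
  · have : 0 ≤ 16 * C * M / D ^ 2 := by positivity
    nlinarith
  have hr0 : 0 < r := hε.trans_le hr
  have h2 : 1 ≤ r / ε := (one_le_div hε).2 hr
  have hC0 : 0 < C := by linarith
  have hT : 0 ≤ 16 * C * M / D ^ 2 := by positivity
  by_cases hεD : D < ε
  · have h1 : A.card ≤ 1 := by
      rw [Finset.card_le_one]
      intro a ha b hb
      by_contra hab
      have h3 := Metric.dist_le_diam_of_mem hbdd (Set.mem_univ a) (Set.mem_univ b)
      have h4 := hsep a ha b hb hab
      rw [← hDdef] at h3
      linarith
    calc (A.card : ℝ) ≤ 1 := by exact_mod_cast h1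
      _ ≤ 1 * (r / ε) ^ 2 := by nlinarith
      _ ≤ _ := mul_le_mul_of_nonneg_right (by nlinarith) (sq_nonneg _)
  push Not at hεD
  have hsum : (A.card : ENNReal) * ENNReal.ofReal (C⁻¹ * (ε / 2) ^ (2 : ℝ)) ≤
      μ (⋃ a ∈ A, Metric.ball a (ε / 2)) := by
    rw [measure_biUnion_finset _ (fun a _ => Metric.isOpen_ball.measurableSet), ← nsmul_eq_mul]
    · refine Finset.card_nsmul_le_sum _ _ _ fun a _ => ?_
      exact (hreg a (ε / 2) (by positivity) (by linarith)).1
    · intro a ha b hb hab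
      exact Metric.ball_disjoint_ball (by linarith [hsep a ha b hb hab])
  have key : ∀ V : ℝ, 0 ≤ V → μ (⋃ a ∈ A, Metric.ball a (ε / 2)) ≤ ENNReal.ofReal V →
      (A.card : ℝ) * (C⁻¹ * (ε / 2) ^ 2) ≤ V := by
    intro V hV h
    have h3 := hsum.trans h
    rw [← ENNReal.ofReal_natCast, ← ENNReal.ofReal_mul (Nat.cast_nonneg _)] at h3
    have := (ENNReal.ofReal_le_ofReal_iff hV).1 h3
    simpa using this
  have fin : ∀ V : ℝ, (A.card : ℝ) * (C⁻¹ * (ε / 2) ^ 2) ≤ V →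
      (A.card : ℝ) ≤ 4 * C * V / ε ^ 2 := by
    intro V h
    rw [le_div_iff₀ (by positivity)]
    have : (A.card : ℝ) * ε ^ 2 = 4 * C * ((A.card : ℝ) * (C⁻¹ * (ε / 2) ^ 2)) := by
      have : C * C⁻¹ = 1 := mul_inv_cancel₀ hC0.ne'
      linear_combination (-(A.card : ℝ) * ε ^ 2) * this
    rw [this]
    exact mul_le_mul_of_nonneg_left h (by positivity)
  by_cases hrD : 2 * r ≤ D
  · have h3 := fin _ (key (C * (2 * r) ^ 2) (by positivity) (by
      have h4 := (hreg x (2 * r) (by positivity) hrD).2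
      rw [show (2 : ℝ) = ((2 : ℕ) : ℝ) by norm_num, Real.rpow_natCast] at h4
      refine le_trans (measure_mono ?_) (by simpa using h4)
      refine Set.iUnion₂_subset fun a ha y hy => ?_
      have := hA a ha
      have := dist_triangle y a x
      simp only [Metric.mem_ball] at hy ⊢
      linarith))
    refine h3.trans ?_
    have : 4 * C * (C * (2 * r) ^ 2) / ε ^ 2 = 16 * C ^ 2 * (r / ε) ^ 2 := by field_simp; ring
    rw [this]
    exact mul_le_mul_of_nonneg_right (by linarith) (sq_nonneg _)
  · push Not at hrD
    have h3 := fin _ (key M hM0 (hMeq ▸ measure_mono (Set.subset_univ _)))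
    refine h3.trans ?_
    have h4 : 4 * C * M / ε ^ 2 ≤ 16 * C * M / D ^ 2 * (r / ε) ^ 2 := by
      have h5 : 16 * C * M / D ^ 2 * (r / ε) ^ 2 = 4 * C * M / ε ^ 2 * ((2 * r) / D) ^ 2 := by
        field_simp; ring
      rw [h5]
      have h6 : 1 ≤ 2 * r / D := (one_le_div hD).2 hrD.le
      have h7 : 0 ≤ 4 * C * M / ε ^ 2 := by positivity
      exact le_mul_of_one_le_right h7 (one_le_pow₀ h6)
    refine h4.trans (mul_le_mul_of_nonneg_right (by nlinarith) (sq_nonneg _))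

/-- Relatively separated subsets of balls have uniformly bounded cardinality. -/
def UniformlyPacked (Y : Type*) [MetricSpace Y] : Prop :=
  ∀ κ : ℝ, 0 < κ → ∃ m : ℕ, ∀ (y : Y) (r : ℝ), 0 < r → ∀ A : Finset Y,
    (∀ a ∈ A, dist a y ≤ r) → (∀ a ∈ A, ∀ b ∈ A, a ≠ b → κ * r ≤ dist a b) → A.card ≤ m

theorem uniformlyPacked_of_ahlforsRegular {Z : Type*} [MetricSpace Z] [CompactSpace Z]
    [MeasurableSpace Z] [BorelSpace Z] {μ : Measure Z} {C : ℝ} (hC : 1 ≤ C)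
    (hreg : AhlforsRegular μ 2 C) : UniformlyPacked Z := by
  obtain ⟨C₀, hC₀, h⟩ := exists_card_le_of_ahlforsRegular hC hreg
  intro κ hκ
  set k := min κ 1 with hk
  have hk0 : 0 < k := lt_min hκ one_pos
  obtain ⟨m, hm⟩ := exists_nat_ge (C₀ * (1 / k) ^ 2)
  refine ⟨m, fun y r hr A hA hsep => ?_⟩
  have h1 := h y r (k * r) (by positivity) (by nlinarith [min_le_right κ 1]) A hA
    (fun a ha b hb hab => le_trans (by nlinarith [min_le_left κ 1]) (hsep a ha b hb hab))
  have h2 : r / (k * r) = 1 / k := by field_simp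
  rw [h2] at h1
  exact_mod_cast h1.trans hm

theorem uniformlyPacked_subtype {E : Type*} [NormedAddCommGroup E] [NormedSpace ℝ E]
    [ProperSpace E] (s : Set E) : UniformlyPacked s := by
  intro κ hκ
  have htb : TotallyBounded (Metric.closedBall (0 : E) 1) :=
    (isCompact_closedBall _ _).totallyBounded
  obtain ⟨t, ht, hcov⟩ := Metric.totallyBounded_iff.1 htb (κ / 2) (by positivity)
  refine ⟨ht.toFinset.card, fun y r hr A hA hsep => ?_⟩
  have hpt : ∀ a ∈ A, ∃ c ∈ ht.toFinset, dist (r⁻¹ • ((a : E) - y)) c < κ / 2 := by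
    intro a ha
    have : r⁻¹ • ((a : E) - y) ∈ Metric.closedBall (0 : E) 1 := by
      have h1 := hA a ha
      rw [Subtype.dist_eq, dist_eq_norm] at h1
      rw [mem_closedBall_zero_iff, norm_smul, Real.norm_of_nonneg (inv_nonneg.2 hr.le),
        inv_mul_le_iff₀ hr]
      linarith
    simpa using hcov this
  choose! f hf hfd using hpt
  refine Finset.card_le_card_of_injOn f hf fun a ha b hb hab => ?_
  by_contra hne
  have h1 := hfd a ha
  have h2 := hfd b hb
  rw [← hab] at h2
  have h3 := dist_triangle_right (r⁻¹ • ((a : E) - y)) (r⁻¹ • ((b : E) - y)) (f a)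
  have h4 : dist (r⁻¹ • ((a : E) - y)) (r⁻¹ • ((b : E) - y)) = r⁻¹ * dist a b := by
    rw [dist_smul₀, Real.norm_of_nonneg (inv_nonneg.2 hr.le), dist_sub_right, Subtype.dist_eq]
  have h5 := hsep a ha b hb hne
  have h6 : κ ≤ r⁻¹ * dist a b := by
    rw [le_inv_mul_iff₀ hr]; linarith
  linarith

/-- The weak, one-scale form of quasisymmetry. -/
def WeakQS {X Y : Type*} [MetricSpace X] [MetricSpace Y] (M H : ℝ) (F : X → Y) : Prop :=
  ∀ x a b : X, M * dist x b < dist x a → dist (F x) (F b) ≤ H * dist (F x) (F a)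

theorem WeakQS.symm {X Y : Type*} [MetricSpace X] [MetricSpace Y] {M H : ℝ} {F : X ≃ Y}
    (h : WeakQS M H F) : WeakQS H M F.symm := by
  intro x a b hab
  by_contra! hcon
  have := h (F.symm x) (F.symm b) (F.symm a) hcon
  simp only [Equiv.apply_symm_apply] at this
  linarith

theorem exists_dist_eq_of_le_dist {X : Type*} [MetricSpace X] [PreconnectedSpace X] (x a : X)
    {R : ℝ}
    (h0 : 0 ≤ R) (hR : R ≤ dist x a) : ∃ c, dist x c = R := by
  have hc : Continuous fun c => dist x c := by fun_prop
  exact mem_range_of_exists_le_of_exists_ge hc ⟨x, by simpa using h0⟩ ⟨a, hR⟩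

theorem WeakQS.exists_small {X Y : Type*} [MetricSpace X] [PreconnectedSpace X] [MetricSpace Y]
    (hY : UniformlyPacked Y) {M H : ℝ} (hM : 1 ≤ M) (hH : 1 ≤ H) {F : X → Y}
    (hF : Function.Injective F) (h : WeakQS M H F) {ε : ℝ} (hε : 0 < ε) :
    ∃ t > 0, ∀ x a b : X, dist x b ≤ t * dist x a → dist (F x) (F b) ≤ ε * dist (F x) (F a) := by
  obtain ⟨m, hm⟩ := hY (ε / H ^ 3) (by positivity)
  set s : ℝ := 1 / (2 * M + 2) with hs
  have hs0 : 0 < s := by positivity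
  have hsM : s * (2 * M + 2) = 1 := by rw [hs]; field_simp
  have hs1 : s < 1 := by nlinarith
  refine ⟨s ^ (m + 3), by positivity, fun x a b hab => ?_⟩
  by_cases hxa : x = a
  · subst hxa
    have : x = b := by simpa using dist_le_zero.1 (by simpa using hab)
    simp [this]
  have hR : 0 < dist x a := dist_pos.2 hxa
  set R := dist x a with hRdef
  have hex : ∀ j : ℕ, ∃ c, dist x c = R * s ^ j := fun j =>
    exists_dist_eq_of_le_dist x a (by positivity)
      (mul_le_of_le_one_right hR.le (pow_le_one₀ hs0.le hs1.le))
  choose c hc using hex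
  have hstep : ∀ j k : ℕ, j < k → s ^ k ≤ s ^ j * s := fun j k hjk => by
    rw [← pow_succ]; exact pow_le_pow_of_le_one hs0.le hs1.le hjk
  by_contra! hcon
  have hFR : 0 < dist (F x) (F a) := dist_pos.2 (hF.ne hxa)
  set r := dist (F x) (F a) with hr
  have hball : ∀ j, 1 ≤ j → dist (F x) (F (c j)) ≤ H * r := fun j hj => by
    refine h x a (c j) ?_
    rw [hc, ← hRdef]
    have := hstep 0 j hj
    rw [pow_zero, one_mul] at this
    have h2 : M * s ^ j ≤ M * s := by gcongr
    have h3 : M * s < 1 := by nlinarith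
    calc M * (R * s ^ j) = R * (M * s ^ j) := by ring
      _ < R * 1 := by gcongr; linarith
      _ = R := mul_one R
  have hlow : ∀ j, j ≤ m + 1 → dist (F x) (F b) ≤ H * dist (F x) (F (c j)) := fun j hj => by
    refine h x (c j) b ?_
    rw [hc]
    have := hstep j (m + 3) (by omega)
    have h2 : 0 < R * s ^ j := by positivity
    have h3 : dist x b ≤ R * s ^ j * s := hab.trans (by nlinarith)
    have h4 : M * s < 1 := by nlinarith
    calc M * dist x b ≤ M * (R * s ^ j * s) := by gcongr
      _ = R * s ^ j * (M * s) := by ring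
      _ < R * s ^ j * 1 := by gcongr
      _ = _ := mul_one _
  have hsep : ∀ j k, j < k → dist (F (c k)) (F x) ≤ H * dist (F (c k)) (F (c j)) := by
    intro j k hjk
    refine h (c k) (c j) x ?_
    have h1 := dist_triangle x (c k) (c j)
    rw [dist_comm (c k) x, hc]
    rw [hc, hc] at h1
    have := hstep j k hjk
    have h2 : 0 < R * s ^ j := by positivity
    have h3 : R * s ^ k ≤ R * s ^ j * s := by nlinarith
    have h4 : (M + 1) * s < 1 := by nlinarith
    have h5 : (M + 1) * (R * s ^ k) < R * s ^ j := calc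
      (M + 1) * (R * s ^ k) ≤ (M + 1) * (R * s ^ j * s) := by gcongr
      _ = R * s ^ j * ((M + 1) * s) := by ring
      _ < R * s ^ j * 1 := by gcongr
      _ = _ := mul_one _
    linarith
  have hsep2 : ∀ j k, j < k → k ≤ m + 1 → ε * r < H ^ 2 * dist (F (c j)) (F (c k)) := by
    intro j k hjk hk
    have h1 := hlow k hk
    have h2 := hsep j k hjk
    rw [dist_comm, dist_comm (F (c k))] at h2
    calc ε * r < dist (F x) (F b) := hcon
      _ ≤ H * dist (F x) (F (c k)) := h1
      _ ≤ H * (H * dist (F (c j)) (F (c k))) := by gcongr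
      _ = _ := by ring
  have hpos : 0 < ε * r := by positivity
  classical
  let A : Finset Y := (Finset.Icc 1 (m + 1)).image fun j => F (c j)
  have hcard : A.card = m + 1 := by
    rw [Finset.card_image_of_injOn]
    · simp
    · intro j hj k hk hjk
      simp only [Finset.coe_Icc, Set.mem_Icc] at hj hk
      simp only at hjk
      rcases lt_trichotomy j k with hlt | heq | hlt
      · have := hsep2 j k hlt hk.2
        rw [hjk, dist_self] at this
        linarith
      · exact heq
      · have := hsep2 k j hlt hj.2
        rw [hjk, dist_self] at this
        linarith
  have hfinal : ∀ j k, j < k → k ≤ m + 1 → ε / H ^ 3 * (H * r) ≤ dist (F (c j)) (F (c k)) := by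
    intro j k hjk hk
    have := hsep2 j k hjk hk
    have h2 : ε / H ^ 3 * (H * r) = ε * r / H ^ 2 := by field_simp
    rw [h2, div_le_iff₀ (by positivity)]
    linarith
  have hle := hm (F x) (H * r) (by positivity) A (by
    intro y hy
    obtain ⟨j, hj, rfl⟩ := Finset.mem_image.1 hy
    rw [dist_comm]
    exact hball j (Finset.mem_Icc.1 hj).1) (by
    intro y hy y' hy' hne
    obtain ⟨j, hj, rfl⟩ := Finset.mem_image.1 hy
    obtain ⟨k, hk, rfl⟩ := Finset.mem_image.1 hy'
    rw [Finset.mem_Icc] at hj hk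
    rcases lt_trichotomy j k with hlt | heq | hlt
    · exact hfinal j k hlt hk.2
    · exact absurd (by rw [heq]) hne
    · rw [dist_comm]; exact hfinal k j hlt hj.2)
  omega

/-- A monotone function tending to `0` at `0` is dominated by a control function. -/
theorem exists_controlFunction_ge {g : ℝ → ℝ} (hg : Monotone g) (hg0 : ∀ t, 0 ≤ g t)
    (hlim : ∀ ε > 0, ∃ t > 0, g t ≤ ε) :
    ∃ η, ControlFunction η ∧ ∀ t, 0 ≤ t → g t ≤ η t := by
  have hint : ∀ a b : ℝ, IntervalIntegrable g volume a b := fun a b => hg.intervalIntegrable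
  have hint2 : ∀ t, 0 ≤ t → IntervalIntegrable (fun s => g (t * s)) volume 1 2 := fun t ht =>
    (hg.comp fun _ _ h => mul_le_mul_of_nonneg_left h ht).intervalIntegrable
  have hge : ∀ t, 0 ≤ t → g t ≤ ∫ s in (1 : ℝ)..2, g (t * s) := by
    intro t ht
    have := intervalIntegral.integral_mono_on (by norm_num) (intervalIntegrable_const (c := g t))
      (hint2 t ht) fun s hs => hg (show t ≤ t * s by nlinarith [hs.1])
    norm_num at this
    exact this
  have hle : ∀ t, 0 ≤ t → ∫ s in (1 : ℝ)..2, g (t * s) ≤ g (t * 2) := by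
    intro t ht
    have := intervalIntegral.integral_mono_on (by norm_num) (hint2 t ht)
      (intervalIntegrable_const (c := g (t * 2))) fun s hs =>
        hg (show t * s ≤ t * 2 by nlinarith [hs.2])
    norm_num at this
    exact this
  have hmono : ∀ t u, 0 ≤ t → t ≤ u → ∫ s in (1 : ℝ)..2, g (t * s) ≤ ∫ s in (1 : ℝ)..2, g (u * s) :=
    fun t u ht htu => intervalIntegral.integral_mono_on (by norm_num) (hint2 t ht)
      (hint2 u (ht.trans htu)) fun s hs => hg (show t * s ≤ u * s by nlinarith [hs.1])
  have hz : g 0 = 0 := by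
    refine le_antisymm (le_of_forall_pos_le_add fun ε hε => ?_) (hg0 0)
    obtain ⟨t, ht, h⟩ := hlim ε hε
    linarith [hg ht.le]
  let η : ℝ → ℝ := fun t => t + ∫ s in (1 : ℝ)..2, g (t * s)
  have hη0 : η 0 = 0 := by simp [η, hz]
  have hηt : ∀ t, 0 ≤ t → t ≤ η t := fun t ht => by
    have := hge t ht
    have := hg0 t
    simp only [η]; linarith
  have hcont : ContinuousOn η (Set.Ici 0) := by
    intro t ht
    rcases (Set.mem_Ici.1 ht).eq_or_lt with rfl | ht
    · rw [Metric.continuousWithinAt_iff]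
      intro ε hε
      obtain ⟨t, ht, h⟩ := hlim (ε / 2) (by positivity)
      refine ⟨min (t / 2) (ε / 2), by positivity, fun x hx hxd => ?_⟩
      rw [hη0]
      rw [Real.dist_eq, sub_zero, abs_of_nonneg hx] at hxd
      rw [Real.dist_eq, sub_zero, abs_of_nonneg ((Set.mem_Ici.1 hx).trans (hηt x hx))]
      have h1 := hle x hx
      have h2 : g (x * 2) ≤ g t := hg (by linarith [min_le_left (t / 2) (ε / 2)])
      simp only [η]
      linarith [min_le_right (t / 2) (ε / 2)]
    · have hprim : Continuous fun u => ∫ s in (0 : ℝ)..u, g s :=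
        intervalIntegral.continuous_primitive hint 0
      have heq : ∀ u, 0 < u → η u = u + u⁻¹ * ((∫ s in (0 : ℝ)..(u * 2), g s) -
          ∫ s in (0 : ℝ)..u, g s) := by
        intro u hu
        simp only [η]
        rw [intervalIntegral.integral_comp_mul_left _ hu.ne',
          intervalIntegral.integral_interval_sub_left (hint _ _) (hint _ _)]
        simp
      have hca : ContinuousAt (fun u => u + u⁻¹ * ((∫ s in (0 : ℝ)..(u * 2), g s) -
          ∫ s in (0 : ℝ)..u, g s)) t := by
        refine continuousAt_id.add ((continuousAt_inv₀ ht.ne').mul ?_)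
        exact ((hprim.comp (by fun_prop : Continuous fun u : ℝ => u * 2)).sub hprim).continuousAt
      refine (hca.congr ?_).continuousWithinAt
      filter_upwards [lt_mem_nhds ht] with u hu using (heq u hu).symm
  refine ⟨η, ⟨hη0, ?_, hcont, ?_⟩, fun t ht => ?_⟩
  · intro t ht u hu htu
    have := hmono t u ht htu.le
    simp only [η]
    linarith
  · intro y hy
    have hy0 : (0 : ℝ) ≤ y := hy
    have := intermediate_value_Icc hy0 (hcont.mono Set.Icc_subset_Ici_self)
    obtain ⟨x, hx, hxy⟩ := this (show y ∈ Set.Icc (η 0) (η y)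
        from ⟨by rw [hη0]; exact hy0, hηt y hy0⟩)
    exact ⟨x, hx.1, hxy⟩
  · have := hge t ht
    simp only [η]
    linarith

theorem WeakQS.exists_quasisymmetric {X Y : Type*} [MetricSpace X] [PreconnectedSpace X]
    [MetricSpace Y] [PreconnectedSpace Y] (hX : UniformlyPacked X) (hY : UniformlyPacked Y)
    {M H : ℝ} (hM : 1 ≤ M) (hH : 1 ≤ H) {F : X ≃ Y} (h : WeakQS M H F) :
    ∃ η, ControlFunction η ∧ IsQuasisymmetricWith η F := by
  have hsmall := fun ε (hε : 0 < ε) => h.exists_small hY hM hH F.injective hε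
  have hsmall' := fun ε (hε : 0 < ε) => h.symm.exists_small hX hH hM F.symm.injective hε
  let S : ℝ → Set ℝ := fun t => {q | ∃ x a b : X, x ≠ a ∧ dist x b ≤ t * dist x a ∧
    q = dist (F x) (F b) / dist (F x) (F a)}
  have hbdd : ∀ t, BddAbove (S t) := by
    intro T
    obtain ⟨t, ht, h1⟩ := hsmall' (1 / (|T| + 1)) (by positivity)
    refine ⟨1 / t, ?_⟩
    rintro q ⟨x, a, b, hxa, hd, rfl⟩
    have hFR : 0 < dist (F x) (F a) := dist_pos.2 (F.injective.ne hxa)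
    have hR : 0 < dist x a := dist_pos.2 hxa
    rw [div_le_iff₀ hFR]
    by_contra! hcon
    rw [div_mul_eq_mul_div, one_mul, div_lt_iff₀ ht] at hcon
    have := h1 (F x) (F b) (F a) (by linarith)
    simp only [Equiv.symm_apply_apply] at this
    have h3 : dist x b ≤ |T| * dist x a := hd.trans (by gcongr; exact le_abs_self T)
    rw [div_mul_eq_mul_div, one_mul, le_div_iff₀ (by positivity)] at this
    linarith
  have hnn : ∀ t, ∀ q ∈ S t, 0 ≤ q := by
    rintro t q ⟨x, a, b, -, -, rfl⟩
    positivity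
  obtain ⟨η, hη, hle⟩ := exists_controlFunction_ge (g := fun t => sSup (S t)) (by
      intro t u htu
      refine Real.sSup_le (fun q hq => le_csSup (hbdd u) ?_) (Real.sSup_nonneg (hnn u))
      obtain ⟨x, a, b, hxa, hd, rfl⟩ := hq
      exact ⟨x, a, b, hxa, hd.trans (by gcongr), rfl⟩)
    (fun t => Real.sSup_nonneg (hnn t)) (by
      intro ε hε
      obtain ⟨t, ht, h1⟩ := hsmall ε hε
      refine ⟨t, ht, Real.sSup_le ?_ hε.le⟩
      rintro q ⟨x, a, b, hxa, hd, rfl⟩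
      rw [div_le_iff₀ (dist_pos.2 (F.injective.ne hxa))]
      exact h1 x a b hd)
  refine ⟨η, hη, F.injective, fun x b a hxb hxa hba => ?_⟩
  refine le_trans (le_csSup (hbdd _) ⟨x, a, b, hxa, ?_, rfl⟩) (hle _ (by positivity))
  rw [div_mul_cancel₀ _ (dist_pos.2 hxa).ne']

theorem WeakQS.continuous {Z Y : Type*} [MetricSpace Z] [MetricSpace Y] [CompactSpace Y]
    {M H : ℝ} {F : Z → Y} (h : WeakQS M H F) : Continuous F := by
  refine continuous_iff_continuousAt.2 fun x => ?_
  refine continuousAt_iff_ultrafilter.2 fun U hU => ?_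
  obtain ⟨w, -, hw⟩ := isCompact_univ.ultrafilter_le_nhds (U.map F) (by simp)
  have hw : Filter.Tendsto F U (nhds w) := hw
  by_cases hx : ∀ᶠ b in (U : Filter Z), b = x
  · exact (tendsto_const_nhds (x := F x)).congr' (hx.mono fun b hb => by rw [hb])
  have hx : ∀ᶠ b in (U : Filter Z), b ≠ x := Ultrafilter.eventually_not.2 hx
  have key : ∀ᶠ b in (U : Filter Z), dist w (F x) ≤ H * dist w (F b) := by
    filter_upwards [hx] with b hb
    have h1 : ∀ᶠ c in (U : Filter Z), M * dist c x < dist c b := by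
      have hc1 : Continuous fun c => M * dist c x := by fun_prop
      have hc2 : Continuous fun c => dist c b := by fun_prop
      refine hU ((hc1.continuousAt.eventually_lt hc2.continuousAt ?_))
      simpa using dist_pos.2 hb.symm
    exact le_of_tendsto_of_tendsto (hw.dist tendsto_const_nhds)
      ((hw.dist tendsto_const_nhds).const_mul H) (h1.mono fun c hc => h c b x hc)
  have hle : dist w (F x) ≤ H * dist w w :=
    ge_of_tendsto ((tendsto_const_nhds.dist hw).const_mul H) key
  rw [dist_self, mul_zero] at hle
  rw [← dist_le_zero.1 hle]
  exact hw

theorem WeakQS.injective {Z Y : Type*} [MetricSpace Z] [PreconnectedSpace Z] [MetricSpace Y]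
    {M H : ℝ} {F : Z → Y} (h : WeakQS M H F) (hc : Continuous F) {a₀ b₀ : Z}
    (hne : F a₀ ≠ F b₀) : Function.Injective F := by
  intro x y hxy
  by_contra hxy'
  have hcl : IsClopen {z | F z = F x} := by
    refine ⟨isClosed_singleton.preimage hc, isOpen_iff_mem_nhds.2 fun z hz => ?_⟩
    obtain ⟨y', hy', hzy'⟩ : ∃ y', F y' = F x ∧ z ≠ y' := by
      by_cases hzx : z = x
      · exact ⟨y, hxy.symm, hzx ▸ hxy'⟩
      · exact ⟨x, rfl, hzx⟩
    have hc1 : Continuous fun c => M * dist z c := by fun_prop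
    have hev : ∀ᶠ c in nhds z, M * dist z c < dist z y' :=
      hc1.continuousAt.eventually_lt continuousAt_const (by simpa using dist_pos.2 hzy')
    filter_upwards [hev] with c hc
    have := h z y' c hc
    rw [show F z = F x from hz, hy', dist_self, mul_zero] at this
    exact (dist_le_zero.1 this).symm
  have huniv := hcl.eq_univ ⟨x, rfl⟩
  have h1 : F a₀ = F x := (huniv ▸ Set.mem_univ a₀ : a₀ ∈ {z | F z = F x})
  have h2 : F b₀ = F x := (huniv ▸ Set.mem_univ b₀ : b₀ ∈ {z | F z = F x})
  exact hne (h1.trans h2.symm)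

/-- A limit of set-valued maps which are weakly quasisymmetric above a vanishing scale. -/
theorem exists_weakQS_of_approx {Z Y : Type*} [MetricSpace Z] [CompactSpace Z]
    [PreconnectedSpace Z] [MetricSpace Y] [CompactSpace Y] {M H : ℝ} (hM : 0 < M)
    (Q : ℕ → Z → Set Y) (hne : ∀ n z, (Q n z).Nonempty)
    (hQ : ∀ n x a b, ∀ X ∈ Q n x, ∀ A ∈ Q n a, ∀ B ∈ Q n b,
      M * max (dist x b) (1 / ((n : ℝ) + 1)) ≤ dist x a → dist X B ≤ H * dist X A)
    {D : Set Y} (hD : Dense D) (hcov : ∀ n, ∀ y ∈ D, ∃ z, y ∈ Q n z)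
    {z₁ z₂ : Z} (hz : z₁ ≠ z₂) {δ : ℝ} (hδ : 0 < δ)
    (hsep : ∀ n, ∃ y₁ ∈ Q n z₁, ∃ y₂ ∈ Q n z₂, δ ≤ dist y₁ y₂) :
    ∃ F : Z ≃ₜ Y, WeakQS M H F := by
  classical
  choose Y₁ hY₁ Y₂ hY₂ hY using hsep
  choose X₀ hX₀ using hne
  let U : Ultrafilter ℕ := Filter.hyperfilter ℕ
  have hUtop : (U : Filter ℕ) ≤ Filter.atTop := by
    rw [← Nat.cofinite_eq_atTop]; exact Filter.hyperfilter_le_cofinite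
  have hlimY : ∀ f : ℕ → Y, ∃ y, Filter.Tendsto f U (nhds y) := fun f => by
    obtain ⟨w, -, hw⟩ := isCompact_univ.ultrafilter_le_nhds (U.map f) (by simp)
    exact ⟨w, hw⟩
  have hlimZ : ∀ f : ℕ → Z, ∃ y, Filter.Tendsto f U (nhds y) := fun f => by
    obtain ⟨w, -, hw⟩ := isCompact_univ.ultrafilter_le_nhds (U.map f) (by simp)
    exact ⟨w, hw⟩
  have hρ : Filter.Tendsto (fun n : ℕ => 1 / ((n : ℝ) + 1)) U (nhds 0) :=
    tendsto_one_div_add_atTop_nhds_zero_nat.mono_left hUtop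
  let X : ℕ → Z → Y := fun n z => if z = z₁ then Y₁ n else if z = z₂ then Y₂ n else X₀ n z
  have hX : ∀ n z, X n z ∈ Q n z := by
    intro n z
    simp only [X]
    split_ifs with h1 h2
    · rw [h1]; exact hY₁ n
    · rw [h2]; exact hY₂ n
    · exact hX₀ n z
  choose F hF using fun z => hlimY fun n => X n z
  have hw : WeakQS M H F := by
    intro x a b hab
    have hxa : 0 < dist x a := lt_of_le_of_lt (by positivity) hab
    have hev : ∀ᶠ n : ℕ in (U : Filter ℕ), M * (1 / ((n : ℝ) + 1)) < dist x a :=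
      (hρ.const_mul M).eventually_lt_const (by rwa [mul_zero])
    refine le_of_tendsto_of_tendsto ((hF x).dist (hF b)) (((hF x).dist (hF a)).const_mul H)
      (hev.mono fun n hn => ?_)
    refine hQ n x a b _ (hX n x) _ (hX n a) _ (hX n b) ?_
    rw [mul_max_of_nonneg _ _ hM.le]
    exact max_le hab.le hn.le
  have hcont := hw.continuous
  have hne' : F z₁ ≠ F z₂ := by
    intro heq
    have h1 : δ ≤ dist (F z₁) (F z₂) := by
      refine ge_of_tendsto ((hF z₁).dist (hF z₂)) (Filter.Eventually.of_forall fun n => ?_)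
      simpa [X, hz.symm] using hY n
    rw [heq, dist_self] at h1
    linarith
  have hinj := hw.injective hcont hne'
  have : Nontrivial Z := ⟨z₁, z₂, hz⟩
  have hDr : D ⊆ Set.range F := by
    intro y hy
    choose z hz using fun n => hcov n y hy
    obtain ⟨x, hx⟩ := hlimZ z
    refine ⟨x, ?_⟩
    have key : ∀ a, a ≠ x → dist (F x) y ≤ H * dist (F x) (F a) := by
      intro a ha
      have hev : ∀ᶠ n : ℕ in (U : Filter ℕ), M * max (dist x (z n)) (1 / ((n : ℝ) + 1)) <
          dist x a :=
        (((tendsto_const_nhds.dist hx).max hρ).const_mul M).eventually_lt_const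
          (by simpa using dist_pos.2 ha.symm)
      exact le_of_tendsto_of_tendsto ((hF x).dist tendsto_const_nhds)
        (((hF x).dist (hF a)).const_mul H) (hev.mono fun n hn =>
          hQ n x a (z n) _ (hX n x) _ (hX n a) _ (hz n) hn.le)
    have hle : dist (F x) y ≤ H * dist (F x) (F x) := by
      have : ConnectedSpace Z := ⟨⟨x⟩⟩
      refine ge_of_tendsto (x := nhdsWithin x {x}ᶜ)
        (((continuous_const.dist hcont).const_mul H |>.continuousAt (x := x)).tendsto.mono_left
          nhdsWithin_le_nhds) ?_
      filter_upwards [self_mem_nhdsWithin] with a ha using key a ha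
    rw [dist_self, mul_zero] at hle
    exact dist_le_zero.1 hle
  have hsurj : Function.Surjective F := by
    rw [← Set.range_eq_univ, ← (isCompact_range hcont).isClosed.closure_eq]
    exact (hD.mono hDr).closure_eq
  exact ⟨hcont.homeoOfEquivCompactToT2 (f := Equiv.ofBijective F ⟨hinj, hsurj⟩), hw⟩

theorem ControlFunction.exists_le {η : ℝ → ℝ} (h : ControlFunction η) {ε : ℝ} (hε : 0 < ε) :
    ∃ t > 0, ∀ s, 0 ≤ s → s ≤ t → η s ≤ ε := by
  obtain ⟨h0, hmono, hcont, hsurj⟩ := h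
  obtain ⟨t, ht, hte⟩ := hsurj hε.le
  refine ⟨t, lt_of_le_of_ne ht ?_, fun s hs hst => ?_⟩
  · rintro rfl
    rw [h0] at hte
    exact hε.ne hte
  · rw [← hte]
    exact hmono.monotoneOn hs ht hst

/-- Moving a unit vector `u` radially towards a unit vector `v` with `‖u - v‖ ≤ 1`. -/
theorem norm_smul_sub_le_of_segment {E : Type*} [NormedAddCommGroup E] [InnerProductSpace ℝ E]
    {u v : E} (hu : ‖u‖ = 1) (hv : ‖v‖ = 1) (huv : ‖u - v‖ ≤ 1) {t : ℝ} (h0 : 0 ≤ t)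
    (h1 : t ≤ 1) :
    0 < ‖(1 - t) • u + t • v‖ ∧
      ‖(‖(1 - t) • u + t • v‖)⁻¹ • ((1 - t) • u + t • v) - v‖ ≤ ‖u - v‖ := by
  set w := (1 - t) • u + t • v with hw
  set c := inner ℝ u v with hc
  have hsq : ‖u - v‖ ^ 2 = 2 - 2 * c := by
    rw [norm_sub_sq_real, hu, hv]; ring
  have hc1 : 1 / 2 ≤ c := by nlinarith [norm_nonneg (u - v)]
  have hcle : c ≤ 1 := by nlinarith [norm_nonneg (u - v), sq_nonneg ‖u - v‖]
  have hwv : inner ℝ w v = (1 - t) * c + t := by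
    rw [hw, inner_add_left, inner_smul_left, inner_smul_left, real_inner_self_eq_norm_sq, hv]
    simp [hc]
  have hge : c ≤ inner ℝ w v := by rw [hwv]; nlinarith
  have hle1 : ‖w‖ ≤ 1 := by
    calc ‖w‖ ≤ ‖(1 - t) • u‖ + ‖t • v‖ := norm_add_le _ _
      _ = 1 := by
        rw [norm_smul, norm_smul, hu, hv, Real.norm_of_nonneg h0,
          Real.norm_of_nonneg (by linarith)]
        ring
  have hw0 : 0 < ‖w‖ := by
    rw [norm_pos_iff]
    intro h
    rw [h, inner_zero_left] at hge
    linarith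
  refine ⟨hw0, ?_⟩
  have hn : ‖(‖w‖)⁻¹ • w‖ = 1 := by
    rw [norm_smul, norm_inv, norm_norm, inv_mul_cancel₀ hw0.ne']
  rw [← abs_of_nonneg (norm_nonneg (_ - v)), ← abs_of_nonneg (norm_nonneg (u - v)), ← sq_le_sq,
    hsq, norm_sub_sq_real, hn, hv, real_inner_smul_left]
  have : inner ℝ w v ≤ ‖w‖⁻¹ * inner ℝ w v :=
    le_mul_of_one_le_left (by linarith) ((one_le_inv₀ hw0).2 hle1)
  linarith

theorem exists_linLocContractible_of_quasisymmetric {Z E : Type*} [MetricSpace Z] [CompactSpace Z]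
    [NormedAddCommGroup E] [InnerProductSpace ℝ E] (f : Z ≃ₜ Metric.sphere (0 : E) 1)
    {η : ℝ → ℝ} (hη : ControlFunction η) (hf : IsQuasisymmetricWith η f) :
    ∃ lam : ℝ, 1 ≤ lam ∧ LinLocContractible Z lam := by
  obtain ⟨t, ht, hηt⟩ := hη.exists_le (ε := 1 / 2) (by norm_num)
  set lam := max 8 (4 / t) with hlam
  have hlam8 : 8 ≤ lam := le_max_left _ _
  have hlamt : 4 / lam ≤ t := by
    rw [div_le_iff₀ (by linarith), mul_comm, ← div_le_iff₀ ht]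
    exact le_max_right _ _
  refine ⟨lam, by linarith, fun a r hr hrD => ?_⟩
  have hbdd : Bornology.IsBounded (Set.univ : Set Z) := isCompact_univ.isBounded
  set D := Metric.diam (Set.univ : Set Z) with hD
  have hrD' : lam * r ≤ D := by
    rw [le_div_iff₀ (by linarith)] at hrD; linarith
  have hD0 : 0 < D := by nlinarith
  have hqs : ∀ x y : Z, dist x a < r → lam * r ≤ 4 * dist y a →
      dist (f x) (f a) ≤ 1 / 2 * dist (f y) (f a) := by
    intro x y hx hy
    by_cases hxa : x = a
    · rw [hxa, dist_self]; positivity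
    have hya : 0 < dist y a := by nlinarith
    have hya' : y ≠ a := dist_pos.1 hya
    have hxy : x ≠ y := by rintro rfl; nlinarith
    have h1 := hf.2 a x y (Ne.symm hxa) hya'.symm hxy
    rw [dist_comm a x, dist_comm a y, dist_comm (f a), dist_comm (f a)] at h1
    have h2 : dist x a / dist y a ≤ t := by
      refine le_trans ?_ hlamt
      rw [div_le_div_iff₀ hya (by linarith)]
      nlinarith
    have h3 := h1.trans (hηt _ (by positivity) h2)
    rwa [div_le_iff₀ (dist_pos.2 (f.injective.ne hya'))] at h3
  have hfar : ∃ y, D ≤ 4 * dist y a := by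
    by_contra! hcon
    have : D ≤ D / 2 := by
      refine Metric.diam_le_of_forall_dist_le (by linarith) fun x _ y _ => ?_
      have := dist_triangle_right x y a
      linarith [hcon x, hcon y]
    linarith
  obtain ⟨y₀, hy₀⟩ := hfar
  have hnorm : ∀ z : Z, ‖(f z : E)‖ = 1 := fun z => mem_sphere_zero_iff_norm.1 (f z).2
  have hclose : ∀ x ∈ Metric.ball a r, ‖(f x : E) - f a‖ ≤ 1 := by
    intro x hx
    have h1 := hqs x y₀ hx (hrD'.trans hy₀)
    rw [Subtype.dist_eq, Subtype.dist_eq, dist_eq_norm, dist_eq_norm] at h1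
    have h2 := norm_sub_le (f y₀ : E) (f a)
    rw [hnorm, hnorm] at h2
    linarith
  let w : Z × ℝ → E := fun q => (1 - q.2) • (f q.1 : E) + q.2 • (f a : E)
  have hwc : Continuous w := by fun_prop
  have hmem : ∀ q ∈ Metric.ball a r ×ˢ Set.Icc (0 : ℝ) 1,
      ‖w q‖⁻¹ • w q ∈ Metric.sphere (0 : E) 1 := by
    rintro ⟨x, s⟩ ⟨hx, hs⟩
    have := (norm_smul_sub_le_of_segment (hnorm x) (hnorm a) (hclose x hx) hs.1 hs.2).1
    rw [mem_sphere_zero_iff_norm, norm_smul, norm_inv, norm_norm, inv_mul_cancel₀ this.ne']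
  classical
  let H : Z × ℝ → Z := fun q =>
    if h : ‖w q‖⁻¹ • w q ∈ Metric.sphere (0 : E) 1 then f.symm ⟨‖w q‖⁻¹ • w q, h⟩ else a
  have hH : ∀ q ∈ Metric.ball a r ×ˢ Set.Icc (0 : ℝ) 1, (f (H q) : E) = ‖w q‖⁻¹ • w q := by
    intro q hq
    simp only [H, hmem q hq, dite_true, Homeomorph.apply_symm_apply]
  refine ⟨H, ?_, ?_, ⟨a, ?_⟩, ?_⟩
  · have hi : Topology.IsInducing fun z : Z => (f z : E) :=
      Topology.IsInducing.subtypeVal.comp f.isInducing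
    rw [hi.continuousOn_iff]
    refine ContinuousOn.congr (f := fun q => ‖w q‖⁻¹ • w q) ?_ hH
    refine (hwc.norm.continuousOn.inv₀ ?_).smul hwc.continuousOn
    rintro ⟨x, s⟩ ⟨hx, hs⟩
    exact (norm_smul_sub_le_of_segment (hnorm x) (hnorm a) (hclose x hx) hs.1 hs.2).1.ne'
  · intro x hx
    apply f.injective
    apply Subtype.ext
    rw [hH _ ⟨hx, by simp⟩]
    simp [w, hnorm]
  · intro x hx
    apply f.injective
    apply Subtype.ext
    rw [hH _ ⟨hx, by simp⟩]
    simp [w, hnorm]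
  · intro x hx s hs
    by_contra hcon
    rw [Metric.mem_ball, not_lt] at hcon
    have h1 := hqs x (H (x, s)) hx (by linarith [dist_nonneg (x := H (x, s)) (y := a)])
    have h2 := (norm_smul_sub_le_of_segment (hnorm x) (hnorm a) (hclose x hx) hs.1 hs.2).2
    have h3 := hH (x, s) ⟨hx, hs⟩
    have h4 : dist (f (H (x, s))) (f a) ≤ dist (f x) (f a) := by
      rw [Subtype.dist_eq, Subtype.dist_eq, dist_eq_norm, dist_eq_norm, h3]
      exact h2
    have h5 : dist (f (H (x, s))) (f a) ≤ 0 := by linarith [dist_nonneg (x := f x) (y := f a)]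
    have h6 := f.injective (dist_le_zero.1 h5)
    rw [h6, dist_self] at hcon
    nlinarith

theorem Complex.exists_log_of_norm_div_sub_lt {X : Type*} [TopologicalSpace X] {f g θ : X → ℂ}
    (hf : Continuous f) (hg : Continuous g) (hg0 : ∀ x, g x ≠ 0) (hθ : Continuous θ)
    (hθg : ∀ x, Complex.exp (θ x) = g x) (hfg : ∀ x, ‖f x - g x‖ < ‖g x‖) :
    ∃ θ' : X → ℂ, Continuous θ' ∧ ∀ x, Complex.exp (θ' x) = f x := by
  have hmem : ∀ x, f x / g x ∈ Complex.slitPlane := by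
    intro x
    refine Complex.ball_one_subset_slitPlane ?_
    have h0 : 0 < ‖g x‖ := norm_pos_iff.2 (hg0 x)
    rw [mem_ball_iff_norm, div_sub_one (hg0 x), norm_div, div_lt_one h0]
    exact hfg x
  refine ⟨fun x => θ x + Complex.log (f x / g x),
    hθ.add ((hf.div hg hg0).clog hmem), fun x => ?_⟩
  rw [Complex.exp_add, hθg, Complex.exp_log (Complex.slitPlane_ne_zero (hmem x)),
    mul_div_cancel₀ _ (hg0 x)]

/-- A null-homotopic map of a compact space into `ℂ \ {0}` has a continuous logarithm. -/
theorem Complex.exists_log_of_nullhomotopic {X : Type*} [MetricSpace X] [CompactSpace X]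
    {H : X × ℝ → ℂ} (hH : ContinuousOn H (Set.univ ×ˢ Set.Icc 0 1))
    (h0 : ∀ x, ∀ t ∈ Set.Icc (0 : ℝ) 1, H (x, t) ≠ 0) {c : ℂ} (hc : ∀ x, H (x, 1) = c) :
    ∃ θ : X → ℂ, Continuous θ ∧ ∀ x, Complex.exp (θ x) = H (x, 0) := by
  have hK : IsCompact ((Set.univ : Set X) ×ˢ Set.Icc (0 : ℝ) 1) := isCompact_univ.prod isCompact_Icc
  obtain ⟨m, hm, hmle⟩ : ∃ m > 0, ∀ q ∈ (Set.univ : Set X) ×ˢ Set.Icc (0 : ℝ) 1, m ≤ ‖H q‖ := by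
    rcases (Set.univ ×ˢ Set.Icc (0 : ℝ) 1 : Set (X × ℝ)).eq_empty_or_nonempty with he | hne
    · exact ⟨1, one_pos, by simp [he]⟩
    · obtain ⟨q, hq, hmin⟩ := hK.exists_isMinOn hne hH.norm
      exact ⟨‖H q‖, norm_pos_iff.2 (h0 q.1 q.2 hq.2), fun q' hq' => hmin hq'⟩
  have huc := hK.uniformContinuousOn_of_continuous hH
  rw [Metric.uniformContinuousOn_iff] at huc
  obtain ⟨δ, hδ, hd⟩ := huc m hm
  obtain ⟨n, hn⟩ := exists_nat_one_div_lt hδ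
  set N : ℝ := (n : ℝ) + 1 with hN
  have hN0 : 0 < N := by positivity
  have hcont : ∀ t ∈ Set.Icc (0 : ℝ) 1, Continuous fun x => H (x, t) := fun t ht =>
    hH.comp_continuous (by fun_prop) fun x => ⟨trivial, ht⟩
  have key : ∀ k : ℕ, (k : ℝ) ≤ N → ∃ θ : X → ℂ, Continuous θ ∧
      ∀ x, Complex.exp (θ x) = H (x, 1 - k / N) := by
    intro k
    induction k with
    | zero =>
      intro _
      refine ⟨fun _ => Complex.log c, continuous_const, fun x => ?_⟩
      rw [← hc x, Complex.exp_log (h0 x 1 (by simp))]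
      simp
    | succ k ih =>
      intro hk
      push_cast at hk
      obtain ⟨θ, hθ, hθe⟩ := ih (by linarith)
      have h1 : (1 - k / N : ℝ) ∈ Set.Icc (0 : ℝ) 1 :=
        ⟨by rw [sub_nonneg, div_le_one hN0]; linarith, by simp; positivity⟩
      have h2 : (1 - ((k + 1 : ℕ) : ℝ) / N : ℝ) ∈ Set.Icc (0 : ℝ) 1 :=
        ⟨by rw [sub_nonneg, div_le_one hN0]; push_cast; linarith, by simp; positivity⟩
      refine Complex.exists_log_of_norm_div_sub_lt (hcont _ h2) (hcont _ h1) (fun x => h0 x _ h1)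
        hθ hθe fun x => ?_
      rw [← dist_eq_norm]
      refine lt_of_lt_of_le (hd _ ⟨trivial, h2⟩ _ ⟨trivial, h1⟩ ?_) (hmle _ ⟨trivial, h1⟩)
      rw [Prod.dist_eq, dist_self, Real.dist_eq]
      have : (1 - ((k + 1 : ℕ) : ℝ) / N) - (1 - k / N) = -(1 / N) := by push_cast; ring
      rw [this, abs_neg, abs_of_pos (by positivity)]
      exact max_lt hδ hn
  obtain ⟨θ, hθ, hθe⟩ := key (n + 1) (by push_cast; exact le_rfl)
  refine ⟨θ, hθ, fun x => ?_⟩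
  have : 1 - ((n + 1 : ℕ) : ℝ) / N = 0 := by push_cast; rw [div_self hN0.ne', sub_self]
  rw [hθe, this]

theorem Complex.not_exists_log_sphere {R : ℝ} (hR : 0 < R) :
    ¬ ∃ θ : Metric.sphere (0 : ℂ) R → ℂ, Continuous θ ∧ ∀ w, Complex.exp (θ w) = w := by
  rintro ⟨θ, hθ, he⟩
  have hmem : ∀ α : ℝ, (R : ℂ) * Complex.exp (α * Complex.I) ∈ Metric.sphere (0 : ℂ) R := by
    intro α
    rw [mem_sphere_zero_iff_norm, norm_mul, Complex.norm_exp_ofReal_mul_I, mul_one,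
      Complex.norm_of_nonneg hR.le]
  let γ : ℝ → ℂ := fun α => θ ⟨_, hmem α⟩ - α * Complex.I
  have hγ : Continuous γ := by
    have : Continuous fun α : ℝ => (⟨_, hmem α⟩ : Metric.sphere (0 : ℂ) R) := by
      apply Continuous.subtype_mk; fun_prop
    exact (hθ.comp this).sub (by fun_prop)
  have hγe : ∀ α, Complex.exp (γ α) = R := by
    intro α
    simp only [γ]
    rw [Complex.exp_sub, he, mul_div_assoc, div_self (Complex.exp_ne_zero _), mul_one]
  have him : ∀ α, ∃ n : ℤ, γ α = γ 0 + n * (2 * Real.pi * Complex.I) := fun α =>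
    Complex.exp_eq_exp_iff_exists_int.1 ((hγe α).trans (hγe 0).symm)
  choose n hn using him
  have hnc : Continuous fun α => (n α : ℝ) := by
    have : (fun α => (n α : ℝ)) = fun α => ((γ α - γ 0) / (2 * Real.pi * Complex.I)).re := by
      funext α
      rw [hn α, add_sub_cancel_left, mul_div_cancel_right₀ _ Complex.two_pi_I_ne_zero]
      simp
    rw [this]
    fun_prop
  have hnc' : Continuous n := (Int.isClosedEmbedding_coe_real.isEmbedding.continuous_iff).2 hnc
  have hconst : n (2 * Real.pi) = n 0 := PreconnectedSpace.constant inferInstance hnc'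
  have h1 : γ (2 * Real.pi) = γ 0 := by
    have h2 := hn (2 * Real.pi)
    have h3 := hn 0
    rw [hconst] at h2
    rw [h2, ← h3]
  have h2 : (⟨_, hmem (2 * Real.pi)⟩ : Metric.sphere (0 : ℂ) R) = ⟨_, hmem 0⟩ := by
    apply Subtype.ext
    simp [Complex.exp_two_pi_mul_I]
  simp only [γ] at h1
  rw [h2] at h1
  simp [Real.pi_ne_zero] at h1

/-- `φ` is a coordinate of the complement of `p` by the plane `E`. -/
structure IsPlaneChart {E Z : Type*} [TopologicalSpace E] [TopologicalSpace Z] (φ : E → Z)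
    (p : Z) : Prop where
  isOpenEmbedding : Topology.IsOpenEmbedding φ
  range_eq : Set.range φ = {p}ᶜ

namespace IsPlaneChart

variable {E E' Z : Type*} [TopologicalSpace E] [TopologicalSpace E'] [TopologicalSpace Z]
  {φ : E → Z} {p : Z}

theorem comp_homeomorph (h : IsPlaneChart φ p) (e : E' ≃ₜ E) : IsPlaneChart (φ ∘ e) p :=
  ⟨h.isOpenEmbedding.comp e.isOpenEmbedding, by rw [e.surjective.range_comp, h.range_eq]⟩

theorem continuous (h : IsPlaneChart φ p) : Continuous φ := h.isOpenEmbedding.continuous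

theorem ne (h : IsPlaneChart φ p) (a : E) : φ a ≠ p := by
  have : φ a ∈ ({p}ᶜ : Set Z) := h.range_eq ▸ Set.mem_range_self a
  exact this

theorem exists_eq (h : IsPlaneChart φ p) {z : Z} (hz : z ≠ p) : ∃ a, φ a = z := by
  have : z ∈ Set.range φ := h.range_eq ▸ hz
  exact this

theorem tendsto [CompactSpace Z] [T2Space Z] (h : IsPlaneChart φ p) :
    Filter.Tendsto φ (Filter.cocompact E) (nhds p) := by
  refine (nhds_basis_opens p).tendsto_right_iff.2 fun V hV => ?_
  have hK : IsCompact (φ ⁻¹' Vᶜ) := by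
    refine h.isOpenEmbedding.isInducing.isCompact_preimage_iff ?_ |>.2 hV.2.isClosed_compl.isCompact
    rw [h.range_eq]
    exact fun z hz hzp => hz (hzp ▸ hV.1)
  filter_upwards [hK.compl_mem_cocompact] with a ha
  simpa using ha

end IsPlaneChart

theorem exists_isPlaneChart {Z : Type*} [TopologicalSpace Z]
    (e : Z ≃ₜ Metric.sphere (0 : EuclideanSpace ℝ (Fin 3)) 1) (p : Z) :
    ∃ φ : EuclideanSpace ℝ (Fin 2) → Z, IsPlaneChart φ p := by
  have : Fact (Module.finrank ℝ (EuclideanSpace ℝ (Fin 3)) = 2 + 1) := ⟨by simp⟩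
  let s := (stereographic' 2 (e p)).symm
  have hs : s.source = Set.univ := by simp [s]
  have ht : s.target = {e p}ᶜ := by simp [s]
  refine ⟨e.symm ∘ s, e.symm.isOpenEmbedding.comp (s.isOpenEmbedding hs), ?_⟩
  rw [Set.range_comp, ← Set.image_univ, ← hs, s.image_source_eq_target, ht,
    e.symm.image_compl, Set.image_singleton, e.symm_apply_apply]

theorem exists_isPlaneChart_complex {Z : Type*} [TopologicalSpace Z]
    (e : Z ≃ₜ Metric.sphere (0 : EuclideanSpace ℝ (Fin 3)) 1) {p u : Z} (hu : u ≠ p) :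
    ∃ φ : ℂ → Z, IsPlaneChart φ p ∧ φ 0 = u := by
  obtain ⟨φ, hφ⟩ := exists_isPlaneChart e p
  have h1 := hφ.comp_homeomorph Complex.orthonormalBasisOneI.repr.toHomeomorph
  obtain ⟨a, ha⟩ := h1.exists_eq hu
  exact ⟨_, h1.comp_homeomorph (Homeomorph.addRight a), by simpa using ha⟩

theorem exists_isPlaneChart_prod {Z : Type*} [TopologicalSpace Z]
    (e : Z ≃ₜ Metric.sphere (0 : EuclideanSpace ℝ (Fin 3)) 1) (p : Z) :
    ∃ φ : ℝ × ℝ → Z, IsPlaneChart φ p := by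
  obtain ⟨φ, hφ⟩ := exists_isPlaneChart e p
  exact ⟨_, hφ.comp_homeomorph ((Homeomorph.finTwoArrow (X := ℝ)).symm.trans
    (EuclideanSpace.equiv (Fin 2) ℝ).symm.toHomeomorph)⟩

/-- Complements of a compact set that contracts away from two points do not separate them. -/
theorem mem_connectedComponentIn_of_contractible {Z : Type*} [MetricSpace Z] [CompactSpace Z]
    [LocallyConnectedSpace Z]
    (e : Z ≃ₜ Metric.sphere (0 : EuclideanSpace ℝ (Fin 3)) 1) {K B V : Set Z} (hK : IsClosed K)
    (hKB : K ⊆ B) (hc : ContractibleInside B V) {u v : Z} (hu : u ∉ V) (hv : v ∉ V)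
    (huK : u ∉ K) (hvK : v ∉ K) :
    v ∈ connectedComponentIn Kᶜ u := by
  classical
  by_contra hvU
  set U := connectedComponentIn Kᶜ u with hU
  have huU : u ∈ U := mem_connectedComponentIn huK
  have huv : u ≠ v := by rintro rfl; exact hvU huU
  have hUo : IsOpen U := hK.isOpen_compl.connectedComponentIn
  obtain ⟨φ, hφ, hφ0⟩ := exists_isPlaneChart_complex e huv
  let Φ := hφ.isOpenEmbedding.isEmbedding.toHomeomorph
  let c : Z → ℂ := fun z => if h : z ∈ Set.range φ then Φ.symm ⟨z, h⟩ else 0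
  have hcφ : ∀ w, c (φ w) = w := fun w => by
    have h : φ w ∈ Set.range φ := ⟨w, rfl⟩
    simp only [c, h, dite_true]
    exact Φ.symm_apply_apply w
  have hφc : ∀ z, z ≠ v → φ (c z) = z := fun z hz => by
    obtain ⟨w, rfl⟩ := hφ.exists_eq hz
    rw [hcφ]
  have hcc : ContinuousOn c {v}ᶜ := by
    rw [← hφ.range_eq, hφ.isOpenEmbedding.isInducing.continuousOn_iff]
    refine continuousOn_id.congr fun z hz => hφc z ?_
    rw [hφ.range_eq] at hz
    exact hz
  have hc0 : ∀ z, z ≠ v → z ≠ u → c z ≠ 0 := fun z hz hzu h => by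
    apply hzu
    rw [← hφc z hz, h, hφ0]
  obtain ⟨H, hH, hH0, ⟨z₀, hH1⟩, hHV⟩ := hc
  have hHv : ∀ x ∈ K, ∀ t ∈ Set.Icc (0 : ℝ) 1, H (x, t) ≠ v := fun x hx t ht h =>
    hv (h ▸ hHV x (hKB hx) t ht)
  have hHu : ∀ x ∈ K, ∀ t ∈ Set.Icc (0 : ℝ) 1, H (x, t) ≠ u := fun x hx t ht h =>
    hu (h ▸ hHV x (hKB hx) t ht)
  have : CompactSpace K := isCompact_iff_compactSpace.1 hK.isCompact
  obtain ⟨θ, hθ, hθe⟩ := Complex.exists_log_of_nullhomotopic (X := K)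
    (H := fun q => c (H ((q.1 : Z), q.2))) (c := c z₀)
    (hcc.comp (hH.comp (by fun_prop : Continuous fun q : K × ℝ => ((q.1 : Z), q.2)).continuousOn
      fun q hq => ⟨hKB q.1.2, hq.2⟩) fun q hq => hHv q.1 q.1.2 q.2 hq.2)
    (fun x t ht => hc0 _ (hHv x x.2 t ht) (hHu x x.2 t ht))
    (fun x => by rw [hH1 x (hKB x.2)])
  obtain ⟨Θ, hΘ⟩ := ContinuousMap.exists_restrict_eq hK ⟨θ, hθ⟩
  have hΘe : ∀ z ∈ K, Complex.exp (Θ z) = c z := fun z hz => by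
    have h1 : Θ z = θ ⟨z, hz⟩ := congrArg (fun g : C(K, ℂ) => g ⟨z, hz⟩) hΘ
    rw [h1, hθe, hH0 z (hKB hz)]
  let g : ℂ → ℂ := fun w => if φ w ∈ U then Complex.exp (Θ (φ w)) else w
  have hg : Continuous g := by
    refine continuous_if (fun a ha => ?_) ?_ continuousOn_id
    · have h1 : a ∈ closure (φ ⁻¹' U) := frontier_subset_closure ha
      have h2 : a ∉ φ ⁻¹' U := by
        have h3 : IsOpen (φ ⁻¹' U) := hUo.preimage hφ.continuous
        rw [show {w | φ w ∈ U} = φ ⁻¹' U from rfl, h3.frontier_eq] at ha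
        exact ha.2
      by_cases haK : φ a ∈ K
      · rw [hΘe _ haK, hcφ]
      · exfalso
        have h3 : IsOpen (φ ⁻¹' (connectedComponentIn Kᶜ (φ a))) :=
          hK.isOpen_compl.connectedComponentIn.preimage hφ.continuous
        obtain ⟨b, hb1, hb2⟩ := mem_closure_iff.1 h1 _ h3 (mem_connectedComponentIn haK)
        have h4 := connectedComponentIn_eq hb1
        have h5 := connectedComponentIn_eq hb2
        apply h2
        show φ a ∈ U
        rw [hU, h5, ← h4]
        exact mem_connectedComponentIn haK
    · exact (Complex.continuous_exp.comp (Θ.continuous.comp hφ.continuous)).continuousOn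
  have hg0 : ∀ w, g w ≠ 0 := by
    intro w
    simp only [g]
    split_ifs with h
    · exact Complex.exp_ne_zero _
    · rintro rfl
      exact h (hφ0 ▸ huU)
  obtain ⟨R, hR, hgR⟩ : ∃ R > 0, ∀ w, ‖w‖ = R → g w = w := by
    have h1 : connectedComponentIn Kᶜ v ∈ nhds v :=
      hK.isOpen_compl.connectedComponentIn.mem_nhds (mem_connectedComponentIn hvK)
    have h2 : ∀ᶠ w in Filter.cocompact ℂ, φ w ∉ U := by
      filter_upwards [hφ.tendsto h1] with w hw hwU
      have h4 := connectedComponentIn_eq hw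
      have h5 := connectedComponentIn_eq hwU
      apply hvU
      rw [hU, h5, ← h4]
      exact mem_connectedComponentIn hvK
    rw [← Metric.cobounded_eq_cocompact] at h2
    obtain ⟨R, hR, h3⟩ := Filter.hasBasis_cobounded_norm.eventually_iff.1 h2
    refine ⟨max R 1, by positivity, fun w hw => ?_⟩
    have : φ w ∉ U := h3 (by simp [hw])
    simp [g, this]
  apply Complex.not_exists_log_sphere hR
  obtain ⟨θ', hθ', he⟩ := Complex.exists_log_of_nullhomotopic (X := Metric.sphere (0 : ℂ) R)
    (H := fun q => g ((1 - q.2 : ℝ) * (q.1 : ℂ))) (c := g 0)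
    (by fun_prop) (fun _ _ _ => hg0 _) (fun x => by simp)
  refine ⟨θ', hθ', fun w => ?_⟩
  rw [he]
  simpa using hgR w (mem_sphere_zero_iff_norm.1 w.2)

theorem ContractibleInside.exists_isPreconnected {Z : Type*} [MetricSpace Z] {U V : Set Z}
    (h : ContractibleInside U V) {u v : Z} (hu : u ∈ U) (hv : v ∈ U) :
    ∃ K ⊆ V, IsPreconnected K ∧ u ∈ K ∧ v ∈ K := by
  obtain ⟨H, hH, hH0, ⟨z₀, hH1⟩, hHV⟩ := h
  have hpre : ∀ x ∈ U, IsPreconnected ((fun t => H (x, t)) '' Set.Icc (0 : ℝ) 1) := fun x hx =>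
    isPreconnected_Icc.image _ (hH.comp (by fun_prop) fun t ht => ⟨hx, ht⟩)
  have h0 : ∀ x ∈ U, x ∈ (fun t => H (x, t)) '' Set.Icc (0 : ℝ) 1 := fun x hx =>
    ⟨0, by simp, hH0 x hx⟩
  have h1 : ∀ x ∈ U, z₀ ∈ (fun t => H (x, t)) '' Set.Icc (0 : ℝ) 1 := fun x hx =>
    ⟨1, by simp, hH1 x hx⟩
  refine ⟨(fun t => H (u, t)) '' Set.Icc (0 : ℝ) 1 ∪ (fun t => H (v, t)) '' Set.Icc (0 : ℝ) 1, ?_,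
    (hpre u hu).union z₀ (h1 u hu) (h1 v hv) (hpre v hv), Or.inl (h0 u hu), Or.inr (h0 v hv)⟩
  rintro _ (⟨t, ht, rfl⟩ | ⟨t, ht, rfl⟩)
  · exact hHV u hu t ht
  · exact hHV v hv t ht

/-- Linear local connectivity. -/
structure LinLocConnected (Z : Type*) [MetricSpace Z] (Λ : ℝ) : Prop where
  inside : ∀ (x : Z) (r : ℝ) (u v : Z), dist u x < r → dist v x < r →
    ∃ K ⊆ Metric.ball x (Λ * r), IsPreconnected K ∧ u ∈ K ∧ v ∈ K
  outside : ∀ (x : Z) (r : ℝ) (u v : Z), 0 < r → Λ * r ≤ dist u x → Λ * r ≤ dist v x →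
    ∃ K ⊆ (Metric.ball x r)ᶜ, IsPreconnected K ∧ u ∈ K ∧ v ∈ K

theorem LinLocContractible.linLocConnected {Z : Type*} [MetricSpace Z] [CompactSpace Z]
    [ConnectedSpace Z] [LocallyConnectedSpace Z]
    (e : Z ≃ₜ Metric.sphere (0 : EuclideanSpace ℝ (Fin 3)) 1) {lam : ℝ} (hlam : 1 ≤ lam)
    (h : LinLocContractible Z lam) : LinLocConnected Z (2 * lam) := by
  have hbdd : Bornology.IsBounded (Set.univ : Set Z) := isCompact_univ.isBounded
  have hd : ∀ x y : Z, dist x y ≤ Metric.diam (Set.univ : Set Z) := fun x y =>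
    Metric.dist_le_diam_of_mem hbdd trivial trivial
  have hl0 : 0 < lam := by linarith
  constructor
  · intro x r u v hu hv
    have hr : 0 < r := dist_nonneg.trans_lt hu
    by_cases hrD : r ≤ Metric.diam (Set.univ : Set Z) / lam
    · obtain ⟨K, hK, h1⟩ := (h x r hr hrD).exists_isPreconnected (u := u) (v := v) hu hv
      exact ⟨K, hK.trans (Metric.ball_subset_ball (by nlinarith)), h1⟩
    · refine ⟨Set.univ, fun y _ => ?_, isPreconnected_univ, trivial, trivial⟩
      rw [not_le, div_lt_iff₀ hl0] at hrD
      have := hd y x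
      rw [Metric.mem_ball]
      nlinarith
  · intro x r u v hr hu hv
    have hrD : 2 * r ≤ Metric.diam (Set.univ : Set Z) / lam := by
      rw [le_div_iff₀ hl0]
      have := hd u x
      linarith
    have hr2 : r ≤ 2 * lam * r := by nlinarith
    by_cases hr' : dist u x ≤ r ∨ dist v x ≤ r
    · exfalso
      have : r < 2 * lam * r := by nlinarith
      rcases hr' with h' | h' <;> linarith
    push Not at hr'
    refine ⟨connectedComponentIn (Metric.closedBall x r)ᶜ u, ?_,
      isPreconnected_connectedComponentIn,
      mem_connectedComponentIn (by simpa using hr'.1), ?_⟩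
    · exact (connectedComponentIn_subset _ _).trans
        (Set.compl_subset_compl.2 Metric.ball_subset_closedBall)
    · refine mem_connectedComponentIn_of_contractible e Metric.isClosed_closedBall
        (Metric.closedBall_subset_ball (by linarith)) (h x (2 * r) (by linarith) hrD) ?_ ?_ ?_ ?_
      · rw [Metric.mem_ball]; linarith
      · rw [Metric.mem_ball]; linarith
      · simpa using hr'.1
      · simpa using hr'.2

/-- The planar expression comparable to the chordal distance on the sphere. -/
noncomputable def chord (a b : ℝ × ℝ) : ℝ := dist a b / ((1 + ‖a‖) * (1 + ‖b‖))

/-- Inverse stereographic projection. -/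
noncomputable def invStereo (a : ℝ × ℝ) : EuclideanSpace ℝ (Fin 3) :=
  (1 + a.1 ^ 2 + a.2 ^ 2)⁻¹ • !₂[2 * a.1, 2 * a.2, a.1 ^ 2 + a.2 ^ 2 - 1]

theorem invStereo_mem (a : ℝ × ℝ) :
    invStereo a ∈ Metric.sphere (0 : EuclideanSpace ℝ (Fin 3)) 1 := by
  have h : 0 < 1 + a.1 ^ 2 + a.2 ^ 2 := by positivity
  rw [mem_sphere_zero_iff_norm, ← sq_eq_sq₀ (norm_nonneg _) zero_le_one, EuclideanSpace.norm_sq_eq]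
  simp only [invStereo, Fin.sum_univ_three, PiLp.smul_apply, smul_eq_mul, norm_mul, norm_inv,
    Real.norm_eq_abs, mul_pow, inv_pow, sq_abs, Matrix.cons_val]
  field_simp
  ring

theorem dist_invStereo_sq (a b : ℝ × ℝ) : dist (invStereo a) (invStereo b) ^ 2 =
    4 * ((a.1 - b.1) ^ 2 + (a.2 - b.2) ^ 2) /
      ((1 + a.1 ^ 2 + a.2 ^ 2) * (1 + b.1 ^ 2 + b.2 ^ 2)) := by
  have h : 0 < 1 + a.1 ^ 2 + a.2 ^ 2 := by positivity
  have h' : 0 < 1 + b.1 ^ 2 + b.2 ^ 2 := by positivity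
  rw [dist_eq_norm, EuclideanSpace.norm_sq_eq]
  simp only [invStereo, Fin.sum_univ_three, PiLp.sub_apply, PiLp.smul_apply, smul_eq_mul,
    Real.norm_eq_abs, sq_abs, Matrix.cons_val]
  field_simp
  ring

theorem norm_sq_prod_le (a : ℝ × ℝ) :
    ‖a‖ ^ 2 ≤ a.1 ^ 2 + a.2 ^ 2 ∧ a.1 ^ 2 + a.2 ^ 2 ≤ 2 * ‖a‖ ^ 2 := by
  have h1 : a.1 ^ 2 ≤ ‖a‖ ^ 2 := by
    rw [← sq_abs]; exact pow_le_pow_left₀ (abs_nonneg _) (norm_fst_le a) 2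
  have h2 : a.2 ^ 2 ≤ ‖a‖ ^ 2 := by
    rw [← sq_abs]; exact pow_le_pow_left₀ (abs_nonneg _) (norm_snd_le a) 2
  refine ⟨?_, by linarith⟩
  rw [Prod.norm_def]
  rcases max_choice ‖a.1‖ ‖a.2‖ with h | h <;> rw [h, Real.norm_eq_abs, sq_abs] <;>
    nlinarith [sq_nonneg a.1, sq_nonneg a.2]

theorem chord_nonneg (a b : ℝ × ℝ) : 0 ≤ chord a b := by
  unfold chord; positivity

theorem chord_le_dist (a b : ℝ × ℝ) : chord a b ≤ dist (invStereo a) (invStereo b) := by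
  refine le_of_sq_le_sq ?_ dist_nonneg
  rw [dist_invStereo_sq, chord, div_pow, div_le_div_iff₀ (by positivity) (by positivity)]
  have h1 := (norm_sq_prod_le (a - b)).1
  have ha := (norm_sq_prod_le a).2
  have hb := (norm_sq_prod_le b).2
  rw [← dist_eq_norm] at h1
  have ha' : 1 + a.1 ^ 2 + a.2 ^ 2 ≤ 2 * (1 + ‖a‖) ^ 2 := by nlinarith [norm_nonneg a]
  have hb' : 1 + b.1 ^ 2 + b.2 ^ 2 ≤ 2 * (1 + ‖b‖) ^ 2 := by nlinarith [norm_nonneg b]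
  calc dist a b ^ 2 * ((1 + a.1 ^ 2 + a.2 ^ 2) * (1 + b.1 ^ 2 + b.2 ^ 2))
      ≤ ((a - b).1 ^ 2 + (a - b).2 ^ 2) * ((2 * (1 + ‖a‖) ^ 2) * (2 * (1 + ‖b‖) ^ 2)) := by gcongr
    _ = _ := by simp only [Prod.fst_sub, Prod.snd_sub]; ring

theorem dist_le_chord (a b : ℝ × ℝ) : dist (invStereo a) (invStereo b) ≤ 6 * chord a b := by
  refine le_of_sq_le_sq ?_ (by have := chord_nonneg a b; positivity)
  rw [dist_invStereo_sq, chord, ← mul_div_assoc, div_pow,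
    div_le_div_iff₀ (by positivity) (by positivity)]
  have h1 := (norm_sq_prod_le (a - b)).2
  have ha := (norm_sq_prod_le a).1
  have hb := (norm_sq_prod_le b).1
  rw [← dist_eq_norm] at h1
  have ha' : (1 + ‖a‖) ^ 2 ≤ 2 * (1 + a.1 ^ 2 + a.2 ^ 2) := by nlinarith [sq_nonneg (1 - ‖a‖)]
  have hb' : (1 + ‖b‖) ^ 2 ≤ 2 * (1 + b.1 ^ 2 + b.2 ^ 2) := by nlinarith [sq_nonneg (1 - ‖b‖)]
  calc 4 * ((a.1 - b.1) ^ 2 + (a.2 - b.2) ^ 2) * ((1 + ‖a‖) * (1 + ‖b‖)) ^ 2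
      = 4 * ((a - b).1 ^ 2 + (a - b).2 ^ 2) * ((1 + ‖a‖) ^ 2 * (1 + ‖b‖) ^ 2) := by
        simp only [Prod.fst_sub, Prod.snd_sub]; ring
    _ ≤ 4 * (2 * dist a b ^ 2) * ((2 * (1 + a.1 ^ 2 + a.2 ^ 2)) *
        (2 * (1 + b.1 ^ 2 + b.2 ^ 2))) := by
        gcongr
    _ = 32 * (dist a b ^ 2 * ((1 + a.1 ^ 2 + a.2 ^ 2) * (1 + b.1 ^ 2 + b.2 ^ 2))) := by ring
    _ ≤ 36 * (dist a b ^ 2 * ((1 + a.1 ^ 2 + a.2 ^ 2) * (1 + b.1 ^ 2 + b.2 ^ 2))) := by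
        gcongr; norm_num
    _ = _ := by ring

/-- Inverse stereographic projection as a map to the sphere. -/
noncomputable def stereoPt (a : ℝ × ℝ) : Metric.sphere (0 : EuclideanSpace ℝ (Fin 3)) 1 :=
  ⟨invStereo a, invStereo_mem a⟩

theorem dense_range_stereoPt : Dense (Set.range stereoPt) := by
  have hsurj : ∀ y : Metric.sphere (0 : EuclideanSpace ℝ (Fin 3)) 1,
      (y : EuclideanSpace ℝ (Fin 3)) 2 ≠ 1 → y ∈ Set.range stereoPt := by
    intro y hy
    have hn : (y : EuclideanSpace ℝ (Fin 3)) 0 ^ 2 + (y : EuclideanSpace ℝ (Fin 3)) 1 ^ 2 +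
        (y : EuclideanSpace ℝ (Fin 3)) 2 ^ 2 = 1 := by
      have h1 := mem_sphere_zero_iff_norm.1 y.2
      rw [← sq_eq_sq₀ (norm_nonneg _) zero_le_one, EuclideanSpace.norm_sq_eq] at h1
      simpa [Fin.sum_univ_three] using h1
    set p := (y : EuclideanSpace ℝ (Fin 3)) 0
    set q := (y : EuclideanSpace ℝ (Fin 3)) 1
    set s := (y : EuclideanSpace ℝ (Fin 3)) 2
    have hs : 1 - s ≠ 0 := sub_ne_zero.2 (Ne.symm hy)
    have h2 : 1 + (p / (1 - s)) ^ 2 + (q / (1 - s)) ^ 2 = 2 / (1 - s) := by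
      field_simp
      linear_combination hn
    refine ⟨(p / (1 - s), q / (1 - s)), Subtype.ext ?_⟩
    ext i
    simp only [stereoPt, invStereo, PiLp.smul_apply, smul_eq_mul]
    rw [h2]
    fin_cases i
    · show (2 / (1 - s))⁻¹ * (2 * (p / (1 - s))) = p
      field_simp
    · show (2 / (1 - s))⁻¹ * (2 * (q / (1 - s))) = q
      field_simp
    · show (2 / (1 - s))⁻¹ * ((p / (1 - s)) ^ 2 + (q / (1 - s)) ^ 2 - 1) = s
      have h3 : (p / (1 - s)) ^ 2 + (q / (1 - s)) ^ 2 - 1 = 2 / (1 - s) - 2 := by linarith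
      rw [h3]
      field_simp
      ring
  intro y
  by_cases hy : (y : EuclideanSpace ℝ (Fin 3)) 2 = 1
  · refine Metric.mem_closure_iff.2 fun ε hε => ?_
    refine ⟨_, ⟨(2 / ε, 0), rfl⟩, ?_⟩
    have h1 := mem_sphere_zero_iff_norm.1 y.2
    rw [← sq_eq_sq₀ (norm_nonneg _) zero_le_one, EuclideanSpace.norm_sq_eq] at h1
    simp only [Fin.sum_univ_three, Real.norm_eq_abs, sq_abs, hy] at h1
    have hp : (y : EuclideanSpace ℝ (Fin 3)) 0 = 0 := by
      nlinarith [sq_nonneg ((y : EuclideanSpace ℝ (Fin 3)) 0),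
        sq_nonneg ((y : EuclideanSpace ℝ (Fin 3)) 1)]
    have hq : (y : EuclideanSpace ℝ (Fin 3)) 1 = 0 := by
      nlinarith [sq_nonneg ((y : EuclideanSpace ℝ (Fin 3)) 0),
        sq_nonneg ((y : EuclideanSpace ℝ (Fin 3)) 1)]
    rw [Subtype.dist_eq]
    refine lt_of_pow_lt_pow_left₀ 2 hε.le ?_
    rw [dist_eq_norm, EuclideanSpace.norm_sq_eq]
    simp only [stereoPt, invStereo, Fin.sum_univ_three, PiLp.sub_apply, PiLp.smul_apply,
      smul_eq_mul, Real.norm_eq_abs, sq_abs, Matrix.cons_val, hp, hq, hy]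
    have h4 : (0 - (1 + (2 / ε) ^ 2 + (0 : ℝ) ^ 2)⁻¹ * (2 * (2 / ε))) ^ 2 +
        (0 - (1 + (2 / ε) ^ 2 + (0 : ℝ) ^ 2)⁻¹ * (2 * 0)) ^ 2 +
        (1 - (1 + (2 / ε) ^ 2 + (0 : ℝ) ^ 2)⁻¹ * ((2 / ε) ^ 2 + (0 : ℝ) ^ 2 - 1)) ^ 2 =
        4 * ε ^ 2 / (ε ^ 2 + 4) := by
      field_simp
      ring
    rw [h4, div_lt_iff₀ (by positivity)]
    nlinarith [sq_pos_of_pos hε]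
  · exact subset_closure (hsurj y hy)

/-- A labelling of the board by tiles and four sectors, each tile being connected and each
sector being attached to its part of the outer region. -/
structure BoardLabelling (n M₀ M₁ : ℕ) (J : Type*) where
  lab : ℤ × ℤ → J ⊕ Fin 4
  one_le : 1 ≤ M₁
  lt : M₁ < M₀
  le : M₀ ≤ n
  outer0 : ∀ v ∈ board n, v.1 ≤ -M₀ → v.1 ≤ v.2 → v.2 ≤ -v.1 → lab v = .inr 0
  outer1 : ∀ v ∈ board n, M₀ ≤ v.1 → -v.1 ≤ v.2 → v.2 ≤ v.1 → lab v = .inr 1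
  outer2 : ∀ v ∈ board n, v.2 ≤ -M₀ → v.2 < v.1 → v.1 < -v.2 → lab v = .inr 2
  outer3 : ∀ v ∈ board n, M₀ ≤ v.2 → -v.2 < v.1 → v.1 < v.2 → lab v = .inr 3
  tile : ∀ v ∈ board n, ∀ v' ∈ board n, ∀ j, lab v = .inl j → lab v' = .inl j →
    Linked hexAdj (board n ∩ {w | lab w = .inl j}) v v'
  sector : ∀ v ∈ board n, ∀ s, lab v = .inr s → ∃ w ∈ board n,
    (w.1 ≤ -M₀ ∨ M₀ ≤ w.1 ∨ w.2 ≤ -M₀ ∨ M₀ ≤ w.2) ∧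
      Linked hexAdj (board n ∩ {w | lab w = .inr s}) v w
  loc0 : ∀ v ∈ board n, lab v = .inr 0 → v.1 < -M₁
  loc1 : ∀ v ∈ board n, lab v = .inr 1 → M₁ < v.1
  loc2 : ∀ v ∈ board n, lab v = .inr 2 → v.2 < -M₁
  loc3 : ∀ v ∈ board n, lab v = .inr 3 → M₁ < v.2

namespace BoardLabelling

variable {n M₀ M₁ : ℕ} {J : Type*} (T : BoardLabelling n M₀ M₁ J)

/-- The vertices of the outer region carry sector labels determined by their position. -/
theorem outer_cases {w : ℤ × ℤ} (hw : w ∈ board n)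
    (h : w.1 ≤ -M₀ ∨ M₀ ≤ w.1 ∨ w.2 ≤ -M₀ ∨ M₀ ≤ w.2) :
    (T.lab w = .inr 0 ∧ w.1 ≤ -M₀ ∧ w.1 ≤ w.2 ∧ w.2 ≤ -w.1) ∨
    (T.lab w = .inr 1 ∧ M₀ ≤ w.1 ∧ -w.1 ≤ w.2 ∧ w.2 ≤ w.1) ∨
    (T.lab w = .inr 2 ∧ w.2 ≤ -M₀ ∧ w.2 < w.1 ∧ w.1 < -w.2) ∨
    (T.lab w = .inr 3 ∧ M₀ ≤ w.2 ∧ -w.2 < w.1 ∧ w.1 < w.2) := by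
  have h1 := T.one_le
  have h2 := T.lt
  by_cases h0 : w.1 ≤ -M₀ ∧ w.1 ≤ w.2 ∧ w.2 ≤ -w.1
  · exact .inl ⟨T.outer0 w hw h0.1 h0.2.1 h0.2.2, h0⟩
  by_cases h0' : M₀ ≤ w.1 ∧ -w.1 ≤ w.2 ∧ w.2 ≤ w.1
  · exact .inr (.inl ⟨T.outer1 w hw h0'.1 h0'.2.1 h0'.2.2, h0'⟩)
  by_cases h3 : w.2 ≤ -M₀ ∧ w.2 < w.1 ∧ w.1 < -w.2
  · exact .inr (.inr (.inl ⟨T.outer2 w hw h3.1 h3.2.1 h3.2.2, h3⟩))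
  have h4 : M₀ ≤ w.2 ∧ -w.2 < w.1 ∧ w.1 < w.2 := by omega
  exact .inr (.inr (.inr ⟨T.outer3 w hw h4.1 h4.2.1 h4.2.2, h4⟩))

theorem exists_linked_left {v : ℤ × ℤ} (hv : v ∈ board n) (h : T.lab v = .inr 0) :
    ∃ w : ℤ × ℤ, w.1 = -n ∧ Linked hexAdj (board n ∩ {w | T.lab w = .inr 0}) v w := by
  obtain ⟨w, hw, hM, hl⟩ := T.sector v hv _ h
  have hlw : T.lab w = .inr 0 := hl.right_mem.2
  have hw' : w.1 ≤ -M₀ ∧ w.1 ≤ w.2 ∧ w.2 ≤ -w.1 := by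
    rcases T.outer_cases hw hM with h | h | h | h
    · exact h.2
    all_goals simp [h.1] at hlw
  have key : ∀ k : ℕ, (k : ℤ) ≤ w.1 + n →
      Linked hexAdj (board n ∩ {w | T.lab w = .inr 0}) v (w.1 - k, w.2) := by
    intro k
    induction k with
    | zero => intro; simpa using hl
    | succ k ih =>
      intro hk
      push_cast at hk
      unfold board at hw
      simp only [Set.mem_ofPred_eq] at hw
      have hb : (w.1 - ((k + 1 : ℕ) : ℤ), w.2) ∈ board n := by
        unfold board; simp only [Set.mem_ofPred_eq]; push_cast; omega
      refine (ih (by omega)).tail ?_ ⟨hb, T.outer0 _ hb ?_ ?_ ?_⟩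
      · unfold hexAdj; push_cast; omega
      all_goals push_cast; omega
  unfold board at hw
  simp only [Set.mem_ofPred_eq] at hw
  refine ⟨_, ?_, key (w.1 + n).toNat (by omega)⟩
  omega

theorem exists_linked_right {v : ℤ × ℤ} (hv : v ∈ board n) (h : T.lab v = .inr 1) :
    ∃ w : ℤ × ℤ, w.1 = n ∧ Linked hexAdj (board n ∩ {w | T.lab w = .inr 1}) v w := by
  obtain ⟨w, hw, hM, hl⟩ := T.sector v hv _ h
  have hlw : T.lab w = .inr 1 := hl.right_mem.2
  have hw' : M₀ ≤ w.1 ∧ -w.1 ≤ w.2 ∧ w.2 ≤ w.1 := by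
    rcases T.outer_cases hw hM with h | h | h | h
    · simp [h.1] at hlw
    · exact h.2
    all_goals simp [h.1] at hlw
  have key : ∀ k : ℕ, (k : ℤ) ≤ n - w.1 →
      Linked hexAdj (board n ∩ {w | T.lab w = .inr 1}) v (w.1 + k, w.2) := by
    intro k
    induction k with
    | zero => intro; simpa using hl
    | succ k ih =>
      intro hk
      push_cast at hk
      unfold board at hw
      simp only [Set.mem_ofPred_eq] at hw
      have hb : (w.1 + ((k + 1 : ℕ) : ℤ), w.2) ∈ board n := by
        unfold board; simp only [Set.mem_ofPred_eq]; push_cast; omega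
      refine (ih (by omega)).tail ?_ ⟨hb, T.outer1 _ hb ?_ ?_ ?_⟩
      · unfold hexAdj; push_cast; omega
      all_goals push_cast; omega
  unfold board at hw
  simp only [Set.mem_ofPred_eq] at hw
  refine ⟨_, ?_, key (n - w.1).toNat (by omega)⟩
  omega

theorem exists_linked_bottom {v : ℤ × ℤ} (hv : v ∈ board n) (h : T.lab v = .inr 2) :
    ∃ w : ℤ × ℤ, w.2 = -n ∧ Linked hexAdj (board n ∩ {w | T.lab w = .inr 2}) v w := by
  obtain ⟨w, hw, hM, hl⟩ := T.sector v hv _ h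
  have hlw : T.lab w = .inr 2 := hl.right_mem.2
  have hw' : w.2 ≤ -M₀ ∧ w.2 < w.1 ∧ w.1 < -w.2 := by
    rcases T.outer_cases hw hM with h | h | h | h
    · simp [h.1] at hlw
    · simp [h.1] at hlw
    · exact h.2
    · simp [h.1] at hlw
  have key : ∀ k : ℕ, (k : ℤ) ≤ w.2 + n →
      Linked hexAdj (board n ∩ {w | T.lab w = .inr 2}) v (w.1, w.2 - k) := by
    intro k
    induction k with
    | zero => intro; simpa using hl
    | succ k ih =>
      intro hk
      push_cast at hk
      unfold board at hw
      simp only [Set.mem_ofPred_eq] at hw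
      have hb : (w.1, w.2 - ((k + 1 : ℕ) : ℤ)) ∈ board n := by
        unfold board; simp only [Set.mem_ofPred_eq]; push_cast; omega
      refine (ih (by omega)).tail ?_ ⟨hb, T.outer2 _ hb ?_ ?_ ?_⟩
      · unfold hexAdj; push_cast; omega
      all_goals push_cast; omega
  unfold board at hw
  simp only [Set.mem_ofPred_eq] at hw
  refine ⟨_, ?_, key (w.2 + n).toNat (by omega)⟩
  omega

theorem exists_linked_top {v : ℤ × ℤ} (hv : v ∈ board n) (h : T.lab v = .inr 3) :
    ∃ w : ℤ × ℤ, w.2 = n ∧ Linked hexAdj (board n ∩ {w | T.lab w = .inr 3}) v w := by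
  obtain ⟨w, hw, hM, hl⟩ := T.sector v hv _ h
  have hlw : T.lab w = .inr 3 := hl.right_mem.2
  have hw' : M₀ ≤ w.2 ∧ -w.2 < w.1 ∧ w.1 < w.2 := by
    rcases T.outer_cases hw hM with h | h | h | h
    · simp [h.1] at hlw
    · simp [h.1] at hlw
    · simp [h.1] at hlw
    · exact h.2
  have key : ∀ k : ℕ, (k : ℤ) ≤ n - w.2 →
      Linked hexAdj (board n ∩ {w | T.lab w = .inr 3}) v (w.1, w.2 + k) := by
    intro k
    induction k with
    | zero => intro; simpa using hl
    | succ k ih =>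
      intro hk
      push_cast at hk
      unfold board at hw
      simp only [Set.mem_ofPred_eq] at hw
      have hb : (w.1, w.2 + ((k + 1 : ℕ) : ℤ)) ∈ board n := by
        unfold board; simp only [Set.mem_ofPred_eq]; push_cast; omega
      refine (ih (by omega)).tail ?_ ⟨hb, T.outer3 _ hb ?_ ?_ ?_⟩
      · unfold hexAdj; push_cast; omega
      all_goals push_cast; omega
  unfold board at hw
  simp only [Set.mem_ofPred_eq] at hw
  refine ⟨_, ?_, key (n - w.2).toNat (by omega)⟩
  omega

/-- Adjacency of tiles. -/
def tadj (i j : J) : Prop :=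
  ∃ v ∈ board n, ∃ v' ∈ board n, hexAdj v v' ∧ T.lab v = .inl i ∧ T.lab v' = .inl j

theorem tadj_symm ⦃i j : J⦄ : T.tadj i j → T.tadj j i := by
  rintro ⟨v, hv, v', hv', h, h1, h2⟩
  exact ⟨v', hv', v, hv, hexAdj_symm h, h2, h1⟩

/-- The tiles adjacent to a sector. -/
def side (s : Fin 4) : Set J :=
  {i | ∃ v ∈ board n, ∃ v' ∈ board n, hexAdj v v' ∧ T.lab v = .inl i ∧ T.lab v' = .inr s}

theorem exists_linked_side {s s' : Fin 4} (hss : ∀ v ∈ board n, ∀ v' ∈ board n, hexAdj v v' →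
    T.lab v = .inr s → T.lab v' = .inr s' → False) {G : Set J} {a b : ℤ × ℤ}
    (h : Linked hexAdj {v | v ∈ board n ∧
      (T.lab v = .inr s ∨ T.lab v = .inr s' ∨ ∃ i ∈ G, T.lab v = .inl i)} a b)
    (ha : T.lab a = .inr s) (hb : T.lab b = .inr s') (hne : s ≠ s') :
    ∃ u ∈ T.side s, ∃ v ∈ T.side s', Linked T.tadj G u v := by
  obtain ⟨x, y, hx, hxy, hy, hyn⟩ := h.exists_exit
    (S := {v | T.lab v = .inr s ∨ ∃ i, T.lab v = .inl i ∧ ∃ u ∈ T.side s, Linked T.tadj G u i})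
    (.inl ha) (by simp [hb, hne.symm])
  have hxm := hx.right_mem
  simp only [Set.mem_ofPred_eq, not_or, not_exists, not_and] at hyn
  rcases hxm.2 with hxs | ⟨i, hxi, u, hu, hui⟩
  · rcases hy.2 with h1 | h1 | ⟨j, hj, h1⟩
    · exact absurd h1 hyn.1
    · exact (hss x hxm.1.1 y hy.1 hxy hxs h1).elim
    · have hjs : j ∈ T.side s := ⟨y, hy.1, x, hxm.1.1, hexAdj_symm hxy, h1, hxs⟩
      exact (hyn.2 j h1 j hjs (.refl hj)).elim
  · rcases hy.2 with h1 | h1 | ⟨j, hj, h1⟩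
    · exact absurd h1 hyn.1
    · exact ⟨u, hu, i, ⟨x, hxm.1.1, y, hy.1, hxy, hxi, h1⟩, hui⟩
    · exact (hyn.2 j h1 u hu (hui.tail ⟨x, hxm.1.1, y, hy.1, hxy, hxi, h1⟩ hj)).elim

theorem linked_lift {A : Set J} {u v : J} (h : Linked T.tadj A u v) {x y : ℤ × ℤ}
    (hx : x ∈ board n) (hy : y ∈ board n) (hxu : T.lab x = .inl u) (hyv : T.lab y = .inl v) :
    Linked hexAdj {v | v ∈ board n ∧ ∃ i ∈ A, T.lab v = .inl i} x y := by
  refine h.induction (P := fun v => ∀ y ∈ board n, T.lab y = .inl v →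
    Linked hexAdj {v | v ∈ board n ∧ ∃ i ∈ A, T.lab v = .inl i} x y) ?_ ?_ y hy hyv
  · intro y hy hyu
    refine (T.tile x hx y hy u hxu hyu).mono ?_
    rintro z ⟨hz, hzu⟩
    exact ⟨hz, u, h.left_mem, hzu⟩
  · rintro a b - ih ⟨z, hz, z', hz', hzz, hza, hzb⟩ hb y hy hyb
    refine ((ih z hz hza).tail hzz ⟨hz', b, hb, hzb⟩).trans
      ((T.tile z' hz' y hy b hzb hyb).mono ?_)
    rintro z ⟨hz, hzu⟩
    exact ⟨hz, b, hb, hzu⟩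

theorem hexA (S : Set J) : (∃ u ∈ T.side 0, ∃ v ∈ T.side 1, Linked T.tadj Sᶜ u v) ∨
    ∃ u ∈ T.side 2, ∃ v ∈ T.side 3, Linked T.tadj S u v := by
  have h1 := T.one_le
  have h2 := T.lt
  have h3 := T.le
  rcases hex_exists n {v | T.lab v = .inr 2 ∨ T.lab v = .inr 3 ∨ ∃ i ∈ S, T.lab v = .inl i} with
    ⟨u, v, hu, hv, h⟩ | ⟨u, v, hu, hv, h⟩
  · left
    have hub := h.left_mem.1
    have hvb := h.right_mem.1
    have hub' := hub
    have hvb' := hvb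
    unfold board at hub' hvb'
    simp only [Set.mem_ofPred_eq] at hub' hvb'
    refine T.exists_linked_side (a := u) (b := v) ?_ (h.mono ?_)
      (T.outer0 u hub (by omega) (by omega) (by omega))
      (T.outer1 v hvb (by omega) (by omega) (by omega)) (by decide)
    · intro v hv v' hv' hvv h0 h1
      have := T.loc0 v hv h0
      have := T.loc1 v' hv' h1
      unfold hexAdj at hvv
      omega
    · rintro z ⟨hz, hzn⟩
      simp only [Set.mem_ofPred_eq, not_or, not_exists, not_and] at hzn
      refine ⟨hz, ?_⟩
      rcases hl : T.lab z with i | s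
      · exact .inr (.inr ⟨i, fun hi => hzn.2.2 i hi hl, rfl⟩)
      · rw [hl] at hzn
        fin_cases s <;> simp_all
  · right
    have hub := h.left_mem.1
    have hvb := h.right_mem.1
    have hub' := hub
    have hvb' := hvb
    unfold board at hub' hvb'
    simp only [Set.mem_ofPred_eq] at hub' hvb'
    have hub2 : T.lab u = .inr 2 := by
      have hx := h.left_mem.2
      rcases T.outer_cases hub (by omega) with h | h | h | h
      · simp [h.1] at hx
      · simp [h.1] at hx
      · exact h.1
      · omega
    have hvb2 : T.lab v = .inr 3 := by
      have hx := h.right_mem.2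
      rcases T.outer_cases hvb (by omega) with h | h | h | h
      · simp [h.1] at hx
      · simp [h.1] at hx
      · omega
      · exact h.1
    refine T.exists_linked_side (a := u) (b := v) ?_ h hub2 hvb2 (by decide)
    intro v hv v' hv' hvv h0 h1
    have := T.loc2 v hv h0
    have := T.loc3 v' hv' h1
    unfold hexAdj at hvv
    omega

theorem hexB (A B : Set J) {u v u' v' : J} (hu : u ∈ T.side 0) (hv : v ∈ T.side 1)
    (hu' : u' ∈ T.side 2) (hv' : v' ∈ T.side 3) (hA : Linked T.tadj A u v)
    (hB : Linked T.tadj B u' v') : (A ∩ B).Nonempty := by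
  have key : ∀ (s s' : Fin 4) (A : Set J) (u v : J), Linked T.tadj A u v → u ∈ T.side s →
      v ∈ T.side s' → ∃ x ∈ board n, ∃ y ∈ board n, T.lab x = .inr s ∧ T.lab y = .inr s' ∧
      Linked hexAdj {v | v ∈ board n ∧
        (T.lab v = .inr s ∨ T.lab v = .inr s' ∨ ∃ i ∈ A, T.lab v = .inl i)} x y := by
    rintro s s' A u v h ⟨a, ha, x, hx, hax, hau, hxs⟩ ⟨b, hb, y, hy, hby, hbv, hys⟩
    refine ⟨x, hx, y, hy, hxs, hys, ?_⟩
    refine Linked.trans (.single ?_ ?_ (hexAdj_symm hax)) (Linked.tail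
      ((T.linked_lift h ha hb hau hbv).mono fun z hz => ⟨hz.1, .inr (.inr hz.2)⟩) hby ?_)
    · exact ⟨hx, .inl hxs⟩
    · exact ⟨ha, .inr (.inr ⟨u, h.left_mem, hau⟩)⟩
    · exact ⟨hy, .inr (.inl hys)⟩
  obtain ⟨x, hx, y, hy, hxs, hys, hl⟩ := key 0 1 A u v hA hu hv
  obtain ⟨x', hx', y', hy', hxs', hys', hl'⟩ := key 2 3 B u' v' hB hu' hv'
  obtain ⟨p, hp, hpl⟩ := T.exists_linked_left hx hxs
  obtain ⟨q, hq, hql⟩ := T.exists_linked_right hy hys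
  obtain ⟨p', hp', hpl'⟩ := T.exists_linked_bottom hx' hxs'
  obtain ⟨q', hq', hql'⟩ := T.exists_linked_top hy' hys'
  have hl₁ : Linked hexAdj {v | v ∈ board n ∧ (T.lab v = .inr 0 ∨ T.lab v = .inr 1 ∨
      ∃ i ∈ A, T.lab v = .inl i)} p q :=
    Linked.trans ((hpl.symm hexAdj_symm).mono fun z hz => ⟨hz.1, .inl hz.2⟩)
      (hl.trans (hql.mono fun z hz => ⟨hz.1, .inr (.inl hz.2)⟩))
  have hl₂ : Linked hexAdj {v | v ∈ board n ∧ (T.lab v = .inr 2 ∨ T.lab v = .inr 3 ∨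
      ∃ i ∈ B, T.lab v = .inl i)} p' q' :=
    Linked.trans ((hpl'.symm hexAdj_symm).mono fun z hz => ⟨hz.1, .inl hz.2⟩)
      (hl'.trans (hql'.mono fun z hz => ⟨hz.1, .inr (.inl hz.2)⟩))
  obtain ⟨z, ⟨-, hzA⟩, -, hzB⟩ := hex_unique n (fun z hz => hz.1) (fun z hz => hz.1) hp hq hp' hq'
    hl₁ hl₂
  rcases hzA with h | h | ⟨i, hi, h⟩ <;> rcases hzB with h' | h' | ⟨i', hi', h'⟩ <;>
    rw [h] at h' <;> simp at h'
  exact ⟨i, hi, h' ▸ hi'⟩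

/-- A set of vertices running from a tile to the outer region, and avoiding the sectors other
than `s`, gives a chain of tiles ending at the side `s`. -/
theorem exists_linked_ray {s : Fin 4} {W : Set (ℤ × ℤ)} (hW : W ⊆ board n)
    (hWs : ∀ v ∈ W, ∀ s', T.lab v = .inr s' → s' = s) {a b : ℤ × ℤ} {i : J}
    (h : Linked hexAdj W a b) (ha : T.lab a = .inl i) (hb : T.lab b = .inr s) :
    ∃ j ∈ T.side s, Linked T.tadj {j | ∃ v ∈ W, T.lab v = .inl j} i j := by
  obtain ⟨x, y, hx, hxy, hy, hyn⟩ := h.exists_exit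
    (S := {v | ∃ j, T.lab v = .inl j ∧ Linked T.tadj {j | ∃ v ∈ W, T.lab v = .inl j} i j})
    ⟨i, ha, .refl ⟨a, h.left_mem, ha⟩⟩ (by simp [hb])
  obtain ⟨hxW, j, hxj, hj⟩ := hx.right_mem
  refine ⟨j, ⟨x, hW hxW, y, hW hy, hxy, hxj, ?_⟩, hj⟩
  rcases hl : T.lab y with k | s'
  · exact (hyn ⟨k, hl, hj.tail ⟨x, hW hxW, y, hW hy, hxy, hxj, hl⟩ ⟨y, hy, hl⟩⟩).elim
  · rw [hWs y hy s' hl]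

end BoardLabelling

theorem Linked.of_seq {α : Type*} {adj : α → α → Prop} {W : Set α} (f : ℕ → α) (m : ℕ)
    (hf : ∀ k ≤ m, f k ∈ W) (hadj : ∀ k < m, adj (f k) (f (k + 1))) :
    Linked adj W (f 0) (f m) := by
  induction m with
  | zero => exact .refl (hf 0 le_rfl)
  | succ m ih =>
    exact (ih (fun k hk => hf k (by omega)) fun k hk => hadj k (by omega)).tail
      (hadj m (by omega)) (hf _ le_rfl)

theorem Linked.subtype {α : Type*} {adj : α → α → Prop} {A : Set α} {u v : α}
    (h : Linked adj A u v) {p : α → Prop} (hp : ∀ a b, p a → adj a b → p b) (hu : p u) :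
    ∃ hv : p v, Linked (fun a b : Subtype p => adj a b) (Subtype.val ⁻¹' A) ⟨u, hu⟩ ⟨v, hv⟩ :=
  h.induction (P := fun v => ∃ hv : p v,
      Linked (fun a b : Subtype p => adj a b) (Subtype.val ⁻¹' A) ⟨u, hu⟩ ⟨v, hv⟩)
    ⟨hu, .refl h.left_mem⟩ fun a b _ ⟨ha, hl⟩ hab hb => ⟨hp a b ha hab, hl.tail hab hb⟩

theorem board_finite (n : ℕ) : (board n).Finite :=
  ((Set.finite_Icc (-n : ℤ) n).prod (Set.finite_Icc (-n : ℤ) n)).subset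
    fun _ hv => ⟨⟨hv.1, hv.2.1⟩, hv.2.2.1, hv.2.2.2⟩

namespace BoardLabelling

variable {n M₀ M₁ : ℕ} {J : Type} (T : BoardLabelling n M₀ M₁ J)

/-- The vertices of the inner part of the board. -/
def _root_.innerBoard (m : ℕ) : Set (ℤ × ℤ) := {v | -m < v.1 ∧ v.1 < m ∧ -m < v.2 ∧ v.2 < m}

theorem exists_tile {v : ℤ × ℤ} (hv : v ∈ innerBoard M₁) : ∃ i, T.lab v = .inl i := by
  have h1 := T.lt
  have h2 := T.le
  unfold innerBoard at hv
  simp only [Set.mem_ofPred_eq] at hv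
  have hb : v ∈ board n := by
    unfold board; simp only [Set.mem_ofPred_eq]; omega
  rcases hl : T.lab v with i | s
  · exact ⟨i, rfl⟩
  · exfalso
    fin_cases s
    · have := T.loc0 v hb hl; omega
    · have := T.loc1 v hb hl; omega
    · have := T.loc2 v hb hl; omega
    · have := T.loc3 v hb hl; omega

theorem exists_ray {v : ℤ × ℤ} (hv : v ∈ innerBoard M₁) {i : J} (hi : T.lab v = .inl i)
    (s : Fin 4) :
    ∃ j ∈ T.side s, Linked T.tadj {j | ∃ w ∈ board n, (s = 0 → w.1 ≤ v.1 ∧ w.2 = v.2) ∧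
      (s = 1 → v.1 ≤ w.1 ∧ w.2 = v.2) ∧ (s = 2 → w.2 ≤ v.2 ∧ w.1 = v.1) ∧
      (s = 3 → v.2 ≤ w.2 ∧ w.1 = v.1) ∧ T.lab w = .inl j} i j := by
  have h1 := T.lt
  have h2 := T.le
  unfold innerBoard at hv
  simp only [Set.mem_ofPred_eq] at hv
  have key : ∀ (W : Set (ℤ × ℤ)) (f : ℕ → ℤ × ℤ) (m : ℕ), W ⊆ board n →
      (∀ v ∈ W, ∀ s', T.lab v = .inr s' → s' = s) → f 0 = v → (∀ k ≤ m, f k ∈ W) →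
      (∀ k < m, hexAdj (f k) (f (k + 1))) → T.lab (f m) = .inr s →
      ∃ j ∈ T.side s, Linked T.tadj {j | ∃ v ∈ W, T.lab v = .inl j} i j := by
    intro W f m hW hWs h0 hf hadj hm
    refine T.exists_linked_ray hW hWs (Linked.of_seq f m hf hadj) (by rw [h0, hi]) hm
  have hloc : ∀ w ∈ board n, ∀ s', T.lab w = .inr s' → s' ≠ s →
      (s' = 0 ∧ w.1 < -M₁) ∨ (s' = 1 ∧ M₁ < w.1) ∨ (s' = 2 ∧ w.2 < -M₁) ∨ (s' = 3 ∧ M₁ < w.2) := by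
    intro w hw s' hl hne
    fin_cases s'
    · exact .inl ⟨rfl, T.loc0 w hw hl⟩
    · exact .inr (.inl ⟨rfl, T.loc1 w hw hl⟩)
    · exact .inr (.inr (.inl ⟨rfl, T.loc2 w hw hl⟩))
    · exact .inr (.inr (.inr ⟨rfl, T.loc3 w hw hl⟩))
  have hb : ∀ w : ℤ × ℤ, w ∈ board n ↔ -n ≤ w.1 ∧ w.1 ≤ n ∧ -n ≤ w.2 ∧ w.2 ≤ n := fun w => Iff.rfl
  fin_cases s
  · refine (key {w | w ∈ board n ∧ w.1 ≤ v.1 ∧ w.2 = v.2} (fun k => (v.1 - k, v.2))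
      (v.1 + n).toNat (fun w hw => hw.1) ?_ (by simp) ?_ ?_
        (T.outer0 _ ?_ ?_ ?_ ?_)).imp fun j ⟨hj, hl⟩ =>
        ⟨hj, hl.mono fun k ⟨w, hw, hk⟩ => ⟨w, hw.1, fun _ => hw.2, by simp, by simp, by simp, hk⟩⟩
    · intro w hw s' hs'
      by_contra hne
      have := hloc w hw.1 s' hs' hne
      have := hw.2
      simp only [Fin.mk_zero] at hne
      omega
    · intro k hk
      refine ⟨(hb _).2 ?_, ?_, ?_⟩ <;> dsimp only <;> omega
    · intro k hk
      unfold hexAdj; push_cast; omega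
    · rw [hb]; dsimp only; omega
    all_goals dsimp only; omega
  · refine (key {w | w ∈ board n ∧ v.1 ≤ w.1 ∧ w.2 = v.2} (fun k => (v.1 + k, v.2))
      (n - v.1).toNat (fun w hw => hw.1) ?_ (by simp) ?_ ?_
        (T.outer1 _ ?_ ?_ ?_ ?_)).imp fun j ⟨hj, hl⟩ =>
        ⟨hj, hl.mono fun k ⟨w, hw, hk⟩ => ⟨w, hw.1, by simp, fun _ => hw.2, by simp, by simp, hk⟩⟩
    · intro w hw s' hs'
      by_contra hne
      have := hloc w hw.1 s' hs' hne
      have := hw.2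
      simp only [Fin.mk_one] at hne
      omega
    · intro k hk
      refine ⟨(hb _).2 ?_, ?_, ?_⟩ <;> dsimp only <;> omega
    · intro k hk
      unfold hexAdj; push_cast; omega
    · rw [hb]; dsimp only; omega
    all_goals dsimp only; omega
  · refine (key {w | w ∈ board n ∧ w.2 ≤ v.2 ∧ w.1 = v.1} (fun k => (v.1, v.2 - k))
      (v.2 + n).toNat (fun w hw => hw.1) ?_ (by simp) ?_ ?_
        (T.outer2 _ ?_ ?_ ?_ ?_)).imp fun j ⟨hj, hl⟩ =>
        ⟨hj, hl.mono fun k ⟨w, hw, hk⟩ => ⟨w, hw.1, by simp, by simp, fun _ => hw.2, by simp, hk⟩⟩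
    · intro w hw s' hs'
      by_contra hne
      have := hloc w hw.1 s' hs' hne
      have := hw.2
      simp only [Fin.reduceFinMk] at hne
      omega
    · intro k hk
      refine ⟨(hb _).2 ?_, ?_, ?_⟩ <;> dsimp only <;> omega
    · intro k hk
      unfold hexAdj; push_cast; omega
    · rw [hb]; dsimp only; omega
    all_goals dsimp only; omega
  · refine (key {w | w ∈ board n ∧ v.2 ≤ w.2 ∧ w.1 = v.1} (fun k => (v.1, v.2 + k))
      (n - v.2).toNat (fun w hw => hw.1) ?_ (by simp) ?_ ?_
        (T.outer3 _ ?_ ?_ ?_ ?_)).imp fun j ⟨hj, hl⟩ =>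
        ⟨hj, hl.mono fun k ⟨w, hw, hk⟩ => ⟨w, hw.1, by simp, by simp, by simp, fun _ => hw.2, hk⟩⟩
    · intro w hw s' hs'
      by_contra hne
      have := hloc w hw.1 s' hs' hne
      have := hw.2
      simp only [Fin.reduceFinMk] at hne
      omega
    · intro k hk
      refine ⟨(hb _).2 ?_, ?_, ?_⟩ <;> dsimp only <;> omega
    · intro k hk
      unfold hexAdj; push_cast; omega
    · rw [hb]; dsimp only; omega
    all_goals dsimp only; omega

/-- The square tiling of a labelled board: nodes are the tiles in the main component, and all the
remaining vertices are sent to the node `none`. -/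
theorem exists_sqTiling : ∃ (I : Type) (_ : Fintype I) (S : SqTiling I) (ν : ℤ × ℤ → Option I)
    (c : I → J), Function.Injective c ∧
    (∀ v ∈ board n, ∀ v' ∈ board n, hexAdj v v' → ν v = ν v' ∨ S.nadj (ν v) (ν v')) ∧
    (∀ v s, T.lab v = .inr s → ν v = none) ∧
    (∀ m m', S.nadj m m' → ∃ v ∈ board n, ∃ v' ∈ board n, hexAdj v v' ∧ ν v = m ∧ ν v' = m') ∧
    (∀ i, ∃ v ∈ board n, ν v = some i) ∧
    (∀ v i, ν v = some i → T.lab v = .inl (c i)) ∧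
    (∀ v ∈ innerBoard M₁, ∃ i, ν v = some i ∧ ∀ s : Fin 4,
      ∃ j ∈ ![S.sL, S.sR, S.sB, S.sT] s, Linked S.adj {j | ∃ w ∈ board n,
        (s = 0 → w.1 ≤ v.1 ∧ w.2 = v.2) ∧ (s = 1 → v.1 ≤ w.1 ∧ w.2 = v.2) ∧
        (s = 2 → w.2 ≤ v.2 ∧ w.1 = v.1) ∧ (s = 3 → v.2 ≤ w.2 ∧ w.1 = v.1) ∧
        ν w = some j} i j) := by
  classical
  obtain ⟨b, hb, b', hb', hbb⟩ : ∃ u ∈ T.side 2, ∃ v ∈ T.side 3, Linked T.tadj Set.univ u v := by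
    rcases T.hexA Set.univ with ⟨u, hu, v, hv, h⟩ | h
    · exact absurd h.left_mem (by simp)
    · exact h
  set p : J → Prop := fun i => Linked T.tadj Set.univ b i with hp
  have hpadj : ∀ i j, p i → T.tadj i j → p j := fun i j hi hij => hi.tail hij trivial
  have hLR : ∀ u ∈ T.side 0, ∀ v ∈ T.side 1, Linked T.tadj Set.univ u v → p u := by
    intro u hu v hv h
    obtain ⟨x, hx, hx'⟩ := T.hexB _ _ hu hv hb hb' h.restrict hbb.restrict
    exact hx'.trans (Linked.symm T.tadj_symm hx)
  obtain ⟨l, hl, l', hl', hll⟩ : ∃ u ∈ T.side 0, ∃ v ∈ T.side 1, Linked T.tadj Set.univ u v := by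
    rcases T.hexA ∅ with ⟨u, hu, v, hv, h⟩ | ⟨u, hu, v, hv, h⟩
    · exact ⟨u, hu, v, hv, h.mono (Set.subset_univ _)⟩
    · exact absurd h.left_mem (by simp)
  have hBT : ∀ u ∈ T.side 2, ∀ v ∈ T.side 3, Linked T.tadj Set.univ u v → p u := by
    intro u hu v hv h
    obtain ⟨x, hx, hx'⟩ := T.hexB _ _ hl hl' hu hv hll.restrict h.restrict
    exact ((hLR l hl l' hl' hll).trans hx).trans (Linked.symm T.tadj_symm hx')
  have hused : ∀ i, p i → ∃ v ∈ board n, T.lab v = .inl i := by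
    intro i hi
    refine hi.induction (P := fun i => ∃ v ∈ board n, T.lab v = .inl i) ?_ ?_
    · obtain ⟨v, hv, -, -, -, h, -⟩ := hb
      exact ⟨v, hv, h⟩
    · rintro i j - - ⟨v, hv, v', hv', -, -, h⟩ -
      exact ⟨v', hv', h⟩
  have hfin : Finite {i // p i} := by
    choose! f hf hf' using hused
    have : (f '' {i | p i}).Finite := (board_finite n).subset (by
      rintro _ ⟨i, hi, rfl⟩
      exact hf i hi)
    refine (this.of_finite_image ?_).to_subtype
    intro i hi j hj hij
    have := hf' i hi
    rw [hij, hf' j hj] at this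
    simpa using this.symm
  let := Fintype.ofFinite {i // p i}
  let C : TileComplex {i // p i} :=
    { adj := fun i j => T.tadj i j
      adj_symm := fun i j h => T.tadj_symm h
      sL := {i | i.1 ∈ T.side 0}
      sR := {i | i.1 ∈ T.side 1}
      sB := {i | i.1 ∈ T.side 2}
      sT := {i | i.1 ∈ T.side 3}
      conn := by
        rintro ⟨i, hi⟩ ⟨j, hj⟩
        obtain ⟨_, h⟩ := ((Linked.symm T.tadj_symm hi).trans hj).subtype hpadj hi
        exact h
      hexA := by
        intro S
        rcases T.hexA (Subtype.val '' S) with ⟨u, hu, v, hv, h⟩ | ⟨u, hu, v, hv, h⟩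
        · left
          obtain ⟨h1, h2⟩ := h.subtype hpadj (hLR u hu v hv (h.mono (Set.subset_univ _)))
          refine ⟨_, hu, _, hv, h2.mono ?_⟩
          intro x hx hxS
          exact hx ⟨x, hxS, rfl⟩
        · right
          obtain ⟨h1, h2⟩ := h.subtype hpadj (hBT u hu v hv (h.mono (Set.subset_univ _)))
          refine ⟨_, hu, _, hv, h2.mono ?_⟩
          rintro x ⟨y, hy, hyx⟩
          rwa [← Subtype.ext hyx]
      hexB := by
        intro A B u hu v hv u' hu' v' hv' hA hB
        obtain ⟨_, ⟨x, hx, rfl⟩, y, hy, hxy⟩ := T.hexB (Subtype.val '' A) (Subtype.val '' B)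
            hu hv hu' hv'
          (hA.map Subtype.val (fun a ha => ⟨a, ha, rfl⟩)
            fun a ha b hb h => .single ⟨a, ha, rfl⟩ ⟨b, hb, rfl⟩ h)
          (hB.map Subtype.val (fun a ha => ⟨a, ha, rfl⟩)
            fun a ha b hb h => .single ⟨a, ha, rfl⟩ ⟨b, hb, rfl⟩ h)
        exact ⟨x, hx, by rwa [← Subtype.ext hxy]⟩ }
  obtain ⟨S, hadj, hsL, hsR, hsB, hsT⟩ := C.exists_sqTiling
  let ν : ℤ × ℤ → Option {i // p i} := fun v =>
    match T.lab v with
    | .inl i => if h : p i then some ⟨i, h⟩ else none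
    | .inr _ => none
  have hν : ∀ v i, ν v = some i ↔ T.lab v = .inl i.1 := by
    intro v i
    simp only [ν]
    rcases T.lab v with j | s
    · dsimp only
      split_ifs with h
      · simp [Subtype.ext_iff]
      · simp only [Sum.inl.injEq, false_iff]
        rintro rfl
        exact h i.2
    · simp
  have hνs : ∀ v s, T.lab v = .inr s → ν v = none := by
    intro v s h
    simp only [ν, h]
  have hmem : ∀ i : {i // p i}, i ∈ S.sides ↔ ∃ s, i.1 ∈ T.side s := by
    intro i
    unfold SqTiling.sides
    rw [hsL, hsR, hsB, hsT]
    constructor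
    · rintro (((h | h) | h) | h)
      exacts [⟨0, h⟩, ⟨1, h⟩, ⟨2, h⟩, ⟨3, h⟩]
    · rintro ⟨s, h⟩
      fin_cases s
      exacts [.inl (.inl (.inl h)), .inl (.inl (.inr h)), .inl (.inr h), .inr h]
  have hsome : ∀ v ∈ board n, ∀ v' ∈ board n, hexAdj v v' → ∀ i, ν v = some i →
      ν v' = some i ∨ S.nadj (some i) (ν v') := by
    intro v hv v' hv' hvv i hi
    right
    have hi' := (hν v i).1 hi
    rcases hl : T.lab v' with j | s
    · have hij : T.tadj i j := ⟨v, hv, v', hv', hvv, hi', hl⟩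
      rw [(hν v' ⟨j, hpadj i j i.2 hij⟩).2 hl]
      show S.adj _ _
      rw [hadj]
      exact hij
    · rw [hνs v' s hl]
      exact (hmem i).2 ⟨s, v, hv, v', hv', hvv, hi', hl⟩
  refine ⟨{i // p i}, inferInstance, S, ν, Subtype.val, Subtype.val_injective, ?_, hνs, ?_, ?_,
    fun v i h => (hν v i).1 h, ?_⟩
  · intro v hv v' hv' hvv
    rcases hi : ν v with _ | i
    · rcases hj : ν v' with _ | j
      · exact .inl rfl
      · rcases hsome v' hv' v hv (hexAdj_symm hvv) j hj with h | h
        · exact .inl (hi ▸ h)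
        · exact .inr (S.nadj_symm (hi ▸ h))
    · rcases hsome v hv v' hv' hvv i hi with h | h
      · exact .inl h.symm
      · exact .inr h
  · have hside : ∀ i : {i // p i}, i ∈ S.sides → ∃ v ∈ board n, ∃ v' ∈ board n, hexAdj v v' ∧
        ν v = some i ∧ ν v' = none := by
      intro i hi
      obtain ⟨s, v, hv, v', hv', hvv, h, h'⟩ := (hmem i).1 hi
      exact ⟨v, hv, v', hv', hvv, (hν v i).2 h, hνs v' s h'⟩
    rintro (_ | i) (_ | j) h
    · exact h.elim
    · obtain ⟨v, hv, v', hv', hvv, h, h'⟩ := hside j h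
      exact ⟨v', hv', v, hv, hexAdj_symm hvv, h', h⟩
    · exact hside i h
    · have h' : S.adj i j := h
      rw [hadj] at h'
      obtain ⟨v, hv, v', hv', hvv, h, h'⟩ := h'
      exact ⟨v, hv, v', hv', hvv, (hν v i).2 h, (hν v' j).2 h'⟩
  · intro i
    obtain ⟨v, hv, h⟩ := hused i i.2
    exact ⟨v, hv, (hν v i).2 h⟩
  · intro v hv
    obtain ⟨i, hi⟩ := T.exists_tile hv
    obtain ⟨j, hj, hlj⟩ := T.exists_ray hv hi 0
    obtain ⟨j', hj', hlj'⟩ := T.exists_ray hv hi 1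
    have hlj := Linked.symm T.tadj_symm (hlj.mono (Set.subset_univ _))
    have hpi : p i := (hLR j hj j' hj' (hlj.trans (hlj'.mono (Set.subset_univ _)))).trans hlj
    refine ⟨⟨i, hpi⟩, (hν _ _).2 hi, fun s => ?_⟩
    obtain ⟨k, hk, hlk⟩ := T.exists_ray hv hi s
    obtain ⟨hpk, h⟩ := hlk.subtype hpadj hpi
    refine ⟨⟨k, hpk⟩, ?_, ?_⟩
    · rw [hsL, hsR, hsB, hsT]
      fin_cases s <;> exact hk
    · rw [hadj]
      refine h.mono ?_
      rintro x ⟨w, hw, h0, h1, h2, h3, h4⟩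
      exact ⟨w, hw, h0, h1, h2, h3, (hν w x).2 h4⟩

end BoardLabelling

theorem Finset.exists_coloring {α : Type*} [DecidableEq α] {r : α → α → Prop} [DecidableRel r]
    (hr : ∀ ⦃a b⦄, r a b → r b a) {k : ℕ} (J : Finset α)
    (hk : ∀ j ∈ J, {i ∈ J | r j i}.card ≤ k) :
    ∃ col : α → ℕ, (∀ j, col j < k + 1) ∧ ∀ i ∈ J, ∀ j ∈ J, i ≠ j → r i j → col i ≠ col j := by
  induction J using Finset.induction_on with
  | empty => exact ⟨fun _ => 0, by simp, by simp⟩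
  | insert a J ha ih =>
    obtain ⟨col, hc, hcol⟩ := ih fun j hj =>
      (Finset.card_le_card (Finset.filter_subset_filter _ (Finset.subset_insert a J))).trans
        (hk j (Finset.mem_insert_of_mem hj))
    have hcard : (({i ∈ J | r a i}).image col).card < (Finset.range (k + 1)).card := by
      rw [Finset.card_range]
      refine Nat.lt_succ_of_le (Finset.card_image_le.trans ((Finset.card_le_card
        (Finset.filter_subset_filter _ (Finset.subset_insert a J))).trans
        (hk a (Finset.mem_insert_self a J))))
    obtain ⟨x, hx, hxn⟩ := Finset.exists_mem_notMem_of_card_lt_card hcard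
    have hxn' : ∀ i ∈ J, r a i → col i ≠ x := fun i hi hri h =>
      hxn (Finset.mem_image.2 ⟨i, Finset.mem_filter.2 ⟨hi, hri⟩, h⟩)
    refine ⟨Function.update col a x, fun j => ?_, fun i hi j hj hij hr' => ?_⟩
    · rcases eq_or_ne j a with rfl | h
      · simpa using hx
      · rw [Function.update_of_ne h]; exact hc j
    · rcases Finset.mem_insert.1 hi with hia | hiJ <;> rcases Finset.mem_insert.1 hj with hja | hjJ
      · exact absurd (hia.trans hja.symm) hij
      · subst hia
        rw [Function.update_self, Function.update_of_ne hij.symm]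
        exact (hxn' j hjJ hr').symm
      · subst hja
        rw [Function.update_self, Function.update_of_ne hij]
        exact hxn' i hiJ (hr hr')
      · rw [Function.update_of_ne (by rintro rfl; exact ha hiJ),
          Function.update_of_ne (by rintro rfl; exact ha hjJ)]
        exact hcol i hiJ j hjJ hij hr'

section Cells

variable {α L X : Type*} [PseudoMetricSpace X]

/-- A partial labelling in which every labelled vertex is joined, inside its cell, to a seed of
the cell at distance at most `R`. -/
def IsCells (adj : α → α → Prop) (pos : α → X) (seed : L → Set α) (R : ℝ) (g : α → Option L) :
    Prop :=
  ∀ v l, g v = some l → ∃ w ∈ seed l, Linked adj {u | g u = some l} v w ∧ dist (pos v) (pos w) ≤ R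

variable {adj : α → α → Prop} {pos : α → X} {seed : L → Set α}

theorem IsCells.exists_extension {R D : ℝ} {g₀ : α → Option L}
    (hg₀ : IsCells adj pos seed R g₀) (hs : ∀ ⦃a b⦄, adj a b → adj b a) (hR : 0 ≤ R)
    (hD0 : 0 ≤ D) {J : Set α} {C : α → Set α}
    (hdisj : ∀ i ∈ J, ∀ j ∈ J, i ≠ j → Disjoint (C i) (C j))
    (hC : ∀ j ∈ J, ∀ v ∈ C j, Linked adj (C j) j v) (hfin : (⋃ j ∈ J, C j).Finite)
    (hD : ∀ j ∈ J, ∀ v ∈ C j, ∀ v' ∈ C j, dist (pos v) (pos v') ≤ D)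
    {new : α → L} (hnew : ∀ j ∈ J, seed (new j) = {j}) :
    ∃ g, IsCells adj pos seed (R + D) g ∧ (∀ v l, g₀ v = some l → g v = some l) ∧
      (∀ j ∈ J, ∀ v ∈ C j, g v ≠ none) ∧
      ∀ v, g v ≠ none → g₀ v ≠ none ∨ v ∈ ⋃ j ∈ J, C j := by
  classical
  let P : (α → Option L) → Prop := fun g => (∀ v l, g v = some l → ∃ w ∈ seed l,
    Linked adj {u | g u = some l} v w ∧ ((g₀ v = some l ∧ dist (pos v) (pos w) ≤ R) ∨
      ∃ j ∈ J, v ∈ C j ∧ ∃ a ∈ C j, dist (pos a) (pos w) ≤ R)) ∧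
    (∀ v l, g₀ v = some l → g v = some l) ∧ ∀ v, g v ≠ none → g₀ v ≠ none ∨ v ∈ ⋃ j ∈ J, C j
  have main : ∀ (m : ℕ) (g : α → Option L), P g → ((⋃ j ∈ J, C j) ∩ {v | g v = none}).ncard ≤ m →
      ∃ g, P g ∧ ∀ j ∈ J, ∀ v ∈ C j, g v ≠ none := by
    intro m
    induction m with
    | zero =>
      intro g hg hm
      refine ⟨g, hg, fun j hj v hv hn => ?_⟩
      have := (Set.ncard_eq_zero (hfin.inter_of_left _)).1 (Nat.le_zero.1 hm)
      exact (Set.ext_iff.1 this v).1 ⟨Set.mem_biUnion hj hv, hn⟩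
    | succ m ih =>
      intro g hg hm
      by_cases hall : ∀ j ∈ J, ∀ v ∈ C j, g v ≠ none
      · exact ⟨g, hg, hall⟩
      push Not at hall
      obtain ⟨j, hj, v, hv, hvn⟩ := hall
      suffices h : ∃ b ∈ C j, g b = none ∧ ∃ l, P (Function.update g b (some l)) by
        obtain ⟨b, hb, hbn, l, hP⟩ := h
        refine ih _ hP ?_
        have hlt : ((⋃ j ∈ J, C j) ∩ {v | Function.update g b (some l) v = none}).ncard <
            ((⋃ j ∈ J, C j) ∩ {v | g v = none}).ncard := by
          refine Set.ncard_lt_ncard ⟨?_, ?_⟩ (hfin.inter_of_left _)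
          · rintro u ⟨hu, hun⟩
            refine ⟨hu, ?_⟩
            rcases eq_or_ne u b with rfl | hne
            · exact hbn
            · simpa [Function.update_of_ne hne] using hun
          · intro hsub
            have := (hsub ⟨Set.mem_biUnion hj hb, hbn⟩).2
            simp at this
        omega
      have hupd : ∀ b ∈ C j, g b = none → ∀ l, (∃ w ∈ seed l,
          Linked adj {u | Function.update g b (some l) u = some l} b w ∧
            ∃ a ∈ C j, dist (pos a) (pos w) ≤ R) → P (Function.update g b (some l)) := by
        rintro b hb hbn l ⟨w, hw, hbw, a, ha, haw⟩
        have hne : ∀ u l', g u = some l' → u ≠ b := by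
          rintro u l' h rfl
          simp [hbn] at h
        refine ⟨fun u l' hu => ?_, fun u l' hu => ?_, fun u hu => ?_⟩
        · rcases eq_or_ne u b with rfl | hub
          · rw [Function.update_self, Option.some_inj] at hu
            subst hu
            exact ⟨w, hw, hbw, .inr ⟨j, hj, hb, a, ha, haw⟩⟩
          · rw [Function.update_of_ne hub] at hu
            obtain ⟨w', hw', hl, h⟩ := hg.1 u l' hu
            refine ⟨w', hw', hl.mono fun x hx => ?_, h⟩
            rw [Set.mem_ofPred_eq, Function.update_of_ne (hne x l' hx)]
            exact hx
        · rw [Function.update_of_ne (hne u l' (hg.2.1 u l' hu))]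
          exact hg.2.1 u l' hu
        · rcases eq_or_ne u b with rfl | hub
          · exact .inr (Set.mem_biUnion hj hb)
          · rw [Function.update_of_ne hub] at hu
            exact hg.2.2 u hu
      by_cases hex : ∃ a ∈ C j, g a ≠ none
      · obtain ⟨a, ha, han⟩ := hex
        obtain ⟨x, y, hx, hxy, hy, hyn⟩ := ((hC j hj v hv).symm hs |>.trans
            (hC j hj a ha)).exists_exit
          (S := {u | g u = none}) hvn han
        obtain ⟨l, hl⟩ := Option.ne_none_iff_exists'.1 hyn
        obtain ⟨w, hw, hyw, h⟩ := hg.1 y l hl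
        have hxm := hx.right_mem
        refine ⟨x, hxm.1, hxm.2, l, hupd x hxm.1 hxm.2 l ⟨w, hw, ?_, ?_⟩⟩
        · have hsub : {u | g u = some l} ⊆ {u | Function.update g x (some l) u = some l} := by
            intro u hu
            rw [Set.mem_ofPred_eq, Function.update_of_ne]
            · exact hu
            · rintro rfl
              have h1 : g u = none := hxm.2
              have h2 : g u = some l := hu
              rw [h1] at h2
              exact absurd h2 (by simp)
          exact (Linked.single (by simp) (hsub hl) hxy).trans (hyw.mono hsub)
        · rcases h with h | ⟨i, hi, hyi, b, hb, hbw⟩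
          · exact ⟨y, hy, h.2⟩
          · rcases eq_or_ne i j with rfl | hij
            · exact ⟨b, hb, hbw⟩
            · exact (Set.disjoint_left.1 (hdisj i hi j hj hij) hyi hy).elim
      · push Not at hex
        have hjC : j ∈ C j := (hC j hj v hv).left_mem
        exact ⟨j, hjC, hex j hjC, new j, hupd j hjC (hex j hjC) _
          ⟨j, by simp [hnew j hj], .refl (by simp), j, hjC, by simpa using hR⟩⟩
  obtain ⟨g, hg, hgC⟩ := main _ g₀ ⟨fun v l h => by
    obtain ⟨w, hw, hl, hd⟩ := hg₀ v l h
    exact ⟨w, hw, hl, .inl ⟨h, hd⟩⟩, fun _ _ h => h, fun _ h => .inl h⟩ le_rfl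
  refine ⟨g, fun v l h => ?_, hg.2.1, hgC, hg.2.2⟩
  obtain ⟨w, hw, hl, ⟨_, hd⟩ | ⟨j, hj, hv, a, ha, hd⟩⟩ := hg.1 v l h
  · exact ⟨w, hw, hl, by linarith⟩
  · exact ⟨w, hw, hl, (dist_triangle _ (pos a) _).trans (by linarith [hD j hj v hv a ha])⟩

theorem IsCells.exists_extension_of_coloring {D : ℝ} {g₀ : α → Option L}
    (hg₀ : IsCells adj pos seed 0 g₀) (hs : ∀ ⦃a b⦄, adj a b → adj b a) (hD0 : 0 ≤ D)
    {J : Set α} {C : α → Set α} {k : ℕ} {col : α → ℕ} (hk : ∀ j, col j < k)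
    (hdisj : ∀ i ∈ J, ∀ j ∈ J, i ≠ j → col i = col j → Disjoint (C i) (C j))
    (hC : ∀ j ∈ J, ∀ v ∈ C j, Linked adj (C j) j v) (hfin : (⋃ j ∈ J, C j).Finite)
    (hD : ∀ j ∈ J, ∀ v ∈ C j, ∀ v' ∈ C j, dist (pos v) (pos v') ≤ D)
    {new : α → L} (hnew : ∀ j ∈ J, seed (new j) = {j}) :
    ∃ g, IsCells adj pos seed (k * D) g ∧ (∀ v l, g₀ v = some l → g v = some l) ∧
      (∀ j ∈ J, ∀ v ∈ C j, g v ≠ none) ∧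
      ∀ v, g v ≠ none → g₀ v ≠ none ∨ v ∈ ⋃ j ∈ J, C j := by
  have main : ∀ m : ℕ, ∃ g, IsCells adj pos seed (m * D) g ∧ (∀ v l, g₀ v = some l → g v = some l) ∧
      (∀ j ∈ J, col j < m → ∀ v ∈ C j, g v ≠ none) ∧
      ∀ v, g v ≠ none → g₀ v ≠ none ∨ v ∈ ⋃ j ∈ J, C j := by
    intro m
    induction m with
    | zero => exact ⟨g₀, by simpa using hg₀, fun _ _ h => h, by simp, fun _ h => .inl h⟩
    | succ m ih =>
      obtain ⟨g, hg, hext, hdom, hsub⟩ := ih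
      have hJ : (⋃ j ∈ {j ∈ J | col j = m}, C j) ⊆ ⋃ j ∈ J, C j :=
        Set.biUnion_subset_biUnion_left fun j hj => hj.1
      obtain ⟨g', hg', hext', hdom', hsub'⟩ := hg.exists_extension hs (by positivity) hD0
        (J := {j ∈ J | col j = m}) (C := C)
        (fun i hi j hj hij => hdisj i hi.1 j hj.1 hij (hi.2.trans hj.2.symm))
        (fun j hj => hC j hj.1) (hfin.subset hJ) (fun j hj => hD j hj.1) fun j hj => hnew j hj.1
      refine ⟨g', by convert hg' using 1; push_cast; ring, fun v l h => hext' v l (hext v l h),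
        fun j hj hjm v hv => ?_, fun v hv => ?_⟩
      · rcases Nat.lt_succ_iff_lt_or_eq.1 hjm with h | h
        · obtain ⟨l, hl⟩ := Option.ne_none_iff_exists'.1 (hdom j hj h v hv)
          rw [hext' v l hl]
          simp
        · exact hdom' j ⟨hj, h⟩ v hv
      · rcases hsub' v hv with h | h
        · exact hsub v h
        · exact .inr (hJ h)
  obtain ⟨g, h1, h2, h3, h4⟩ := main k
  exact ⟨g, h1, h2, fun j hj => h3 j hj (hk j), h4⟩

end Cells

/-- The point of the mesh of width `1/m` with index `v`. -/
noncomputable def gridPoint (m : ℕ) (v : ℤ × ℤ) : ℝ × ℝ := (v.1 / m, v.2 / m)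

/-- The boundary of the board. -/
def border (n : ℕ) : Set (ℤ × ℤ) := {v | v.1 = -n ∨ v.1 = n ∨ v.2 = -n ∨ v.2 = n}

/-- Hexagonal adjacency, with any two boundary vertices declared adjacent. -/
def fineAdj (n : ℕ) (u v : ℤ × ℤ) : Prop := hexAdj u v ∨ (u ∈ border n ∧ v ∈ border n)

theorem fineAdj_symm (n : ℕ) ⦃u v : ℤ × ℤ⦄ (h : fineAdj n u v) : fineAdj n v u :=
  h.imp (fun h => hexAdj_symm h) And.symm

/-- A mesh point of the board nearest to `a`. -/
noncomputable def gridRound (m n : ℕ) (a : ℝ × ℝ) : ℤ × ℤ :=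
  (max (-n) (min n (round (a.1 * m))), max (-n) (min n (round (a.2 * m))))

theorem gridRound_mem_board (m n : ℕ) (a : ℝ × ℝ) : gridRound m n a ∈ board n := by
  simp only [board, gridRound, Set.mem_ofPred_eq]
  omega

theorem gridRound_gridPoint {m n : ℕ} (hm : 0 < m) {v : ℤ × ℤ} (hv : v ∈ board n) :
    gridRound m n (gridPoint m v) = v := by
  have hm' : (m : ℝ) ≠ 0 := by positivity
  simp only [board, Set.mem_ofPred_eq] at hv
  simp only [gridRound, gridPoint, div_mul_cancel₀ _ hm', round_intCast]
  ext <;> simp only <;> omega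

theorem abs_clamp_sub_le {n : ℕ} {r : ℤ} {x c : ℝ} (hx : |x| ≤ n) (h : |(r : ℝ) - x| ≤ c) :
    |((max (-n) (min n r) : ℤ) : ℝ) - x| ≤ c := by
  rw [abs_le] at *
  rcases le_total (n : ℤ) r with h1 | h1
  · rw [min_eq_left h1, max_eq_right (by omega)]
    have : (n : ℝ) ≤ r := by exact_mod_cast h1
    push_cast
    constructor <;> linarith
  · rw [min_eq_right h1]
    rcases le_total (-n : ℤ) r with h2 | h2
    · rw [max_eq_right h2]; exact h
    · rw [max_eq_left h2]
      have : (r : ℝ) ≤ -n := by exact_mod_cast h2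
      push_cast
      constructor <;> linarith

theorem gridRound_mem_border {m n : ℕ} (hm : 0 < m) {a : ℝ × ℝ} (ha : (n : ℝ) / m ≤ ‖a‖) :
    gridRound m n a ∈ border n := by
  have hm' : (0 : ℝ) < m := by positivity
  have key : ∀ x : ℝ, (n : ℝ) / m ≤ |x| →
      max (-n : ℤ) (min n (round (x * m))) = -n ∨ max (-n : ℤ) (min n (round (x * m))) = n := by
    intro x hx
    have h1 := abs_le.1 (abs_sub_round (x * m))
    rw [div_le_iff₀ hm'] at hx
    rcases le_total 0 x with h0 | h0
    · rw [abs_of_nonneg h0] at hx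
      have h2 : ((n - 1 : ℤ) : ℝ) < round (x * m) := by push_cast; linarith
      have := Int.cast_lt.1 h2
      omega
    · rw [abs_of_nonpos h0] at hx
      have h2 : (round (x * m) : ℝ) < ((1 - n : ℤ) : ℝ) := by push_cast; linarith
      have := Int.cast_lt.1 h2
      omega
  rw [Prod.norm_def, le_max_iff] at ha
  simp only [Real.norm_eq_abs] at ha
  rcases ha with h | h
  · rcases key _ h with h | h
    · exact .inl h
    · exact .inr (.inl h)
  · rcases key _ h with h | h
    · exact .inr (.inr (.inl h))
    · exact .inr (.inr (.inr h))

/-- A mesh on the plane which is fine as seen through the chart `φ`. -/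
structure FineGrid {Z : Type*} [MetricSpace Z] (φ : ℝ × ℝ → Z) (p : Z) (m n : ℕ) (δ : ℝ) :
    Prop where
  chart : IsPlaneChart φ p
  m_pos : 0 < m
  close : ∀ a b, dist a b ≤ 1 / m → dist (φ a) (φ b) ≤ δ
  far : ∀ a, (n : ℝ) / m ≤ ‖a‖ → dist (φ a) p ≤ δ / 2

theorem IsPlaneChart.exists_fineGrid {Z : Type*} [MetricSpace Z] [CompactSpace Z] {φ : ℝ × ℝ → Z}
    {p : Z} (h : IsPlaneChart φ p) {δ : ℝ} (hδ : 0 < δ) (N : ℕ) :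
    ∃ m N' : ℕ, N ≤ N' ∧ FineGrid φ p m (m * N') δ := by
  have hu : UniformContinuous φ := h.continuous.uniformContinuous_of_tendsto_cocompact h.tendsto
  obtain ⟨κ, hκ, hκ'⟩ := Metric.uniformContinuous_iff.1 hu δ hδ
  obtain ⟨m, hm⟩ := exists_nat_gt (1 / κ)
  have hm0 : 0 < m := by
    rcases Nat.eq_zero_or_pos m with rfl | h
    · rw [Nat.cast_zero] at hm
      exact absurd hm (not_lt.2 (by positivity))
    · exact h
  have hmr : (0 : ℝ) < m := by positivity
  have hfar := h.tendsto.eventually (Metric.closedBall_mem_nhds p (half_pos hδ))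
  obtain ⟨r, hr⟩ := (Filter.hasBasis_cocompact.eventually_iff.1 hfar).imp fun K hK => hK
  obtain ⟨hK, hrK⟩ := hr
  obtain ⟨R, hR⟩ := hK.isBounded.exists_norm_le
  obtain ⟨N', hN'⟩ := exists_nat_gt (max R N)
  refine ⟨m, N', ?_, h, hm0, fun a b hab => (hκ' ?_).le, fun a ha => ?_⟩
  · exact_mod_cast ((le_max_right R (N : ℝ)).trans_lt hN').le
  · refine hab.trans_lt ?_
    rw [div_lt_comm₀ hmr hκ]
    exact hm
  · push_cast at ha
    rw [mul_div_cancel_left₀ _ hmr.ne'] at ha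
    exact hrK fun haK => absurd (hR a haK) (not_le.2 (((le_max_left _ _).trans_lt hN').trans_le ha))

namespace FineGrid

variable {Z : Type*} [MetricSpace Z] {φ : ℝ × ℝ → Z} {p : Z} {m n : ℕ} {δ : ℝ}

theorem far_border (h : FineGrid φ p m n δ) {v : ℤ × ℤ} (hv : v ∈ border n) :
    dist (φ (gridPoint m v)) p ≤ δ / 2 := by
  have hm : (0 : ℝ) < m := by exact_mod_cast h.m_pos
  refine h.far _ ?_
  rw [Prod.norm_def, le_max_iff]
  simp only [gridPoint, norm_div, Real.norm_eq_abs, Nat.abs_cast]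
  rcases hv with hv | hv | hv | hv <;> simp [hv]

theorem dist_le_of_fineAdj (h : FineGrid φ p m n δ) {u v : ℤ × ℤ} (huv : fineAdj n u v) :
    dist (φ (gridPoint m u)) (φ (gridPoint m v)) ≤ δ := by
  have hm : (0 : ℝ) < m := by exact_mod_cast h.m_pos
  rcases huv with huv | ⟨hu, hv⟩
  · refine h.close _ _ ?_
    simp only [gridPoint, Prod.dist_eq, Real.dist_eq, ← sub_div, abs_div, Nat.abs_cast]
    rw [max_le_iff, div_le_div_iff_of_pos_right hm, div_le_div_iff_of_pos_right hm]
    have : ∀ a b : ℤ, |a - b| ≤ 1 → |(a : ℝ) - b| ≤ 1 := fun a b h => by exact_mod_cast h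
    unfold hexAdj at huv
    constructor <;> apply this <;> rw [abs_le] <;> omega
  · linarith [dist_triangle_right (φ (gridPoint m u)) (φ (gridPoint m v)) p, h.far_border hu,
      h.far_border hv]

open Classical in
/-- The vertex of the board assigned to a point of `Z`. -/
noncomputable def vertex (_ : FineGrid φ p m n δ) (z : Z) : ℤ × ℤ :=
  if z = p then ((n : ℤ), 0) else gridRound m n (Function.invFun φ z)

theorem vertex_apply (h : FineGrid φ p m n δ) (a : ℝ × ℝ) : h.vertex (φ a) = gridRound m n a := by
  rw [vertex, if_neg (h.chart.ne a),
    Function.leftInverse_invFun h.chart.isOpenEmbedding.injective]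

theorem vertex_pole (h : FineGrid φ p m n δ) : h.vertex p = ((n : ℤ), 0) := if_pos rfl

theorem vertex_gridPoint (h : FineGrid φ p m n δ) {v : ℤ × ℤ} (hv : v ∈ board n) :
    h.vertex (φ (gridPoint m v)) = v := by
  rw [vertex_apply, gridRound_gridPoint h.m_pos hv]

theorem vertex_mem_board (h : FineGrid φ p m n δ) (z : Z) : h.vertex z ∈ board n := by
  by_cases hz : z = p
  · rw [hz, vertex_pole]
    simp only [board, Set.mem_ofPred_eq]
    omega
  · rw [vertex, if_neg hz]
    exact gridRound_mem_board _ _ _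

theorem vertex_pole_mem_border (h : FineGrid φ p m n δ) : h.vertex p ∈ border n := by
  rw [vertex_pole]
  exact .inr (.inl rfl)

theorem dist_gridPoint_le (h : FineGrid φ p m n δ) {a : ℝ × ℝ} {q : ℤ × ℤ}
    (h1 : |(q.1 : ℝ) - a.1 * m| ≤ 1) (h2 : |(q.2 : ℝ) - a.2 * m| ≤ 1) :
    dist (φ (gridPoint m q)) (φ a) ≤ δ := by
  have hm : (0 : ℝ) < m := by exact_mod_cast h.m_pos
  have key : ∀ (k : ℤ) (x : ℝ), |(k : ℝ) - x * m| ≤ 1 → |(k : ℝ) / m - x| ≤ 1 / m := by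
    intro k x hk
    rw [le_div_iff₀ hm]
    rwa [← abs_of_pos hm, ← abs_mul, sub_mul, abs_of_pos hm, div_mul_cancel₀ _ hm.ne']
  refine h.close _ _ ?_
  simp only [gridPoint, Prod.dist_eq, Real.dist_eq]
  exact max_le (key _ _ h1) (key _ _ h2)

theorem eventually_linked (h : FineGrid φ p m n δ) (hδ : 0 < δ) (z : Z) :
    ∀ᶠ z' in nhds z, Linked (fineAdj n)
      (board n ∩ {u | dist (φ (gridPoint m u)) z ≤ δ ∨ dist (φ (gridPoint m u)) z' ≤ δ})
      (h.vertex z) (h.vertex z') := by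
  have hm : (0 : ℝ) < m := by exact_mod_cast h.m_pos
  have hborder : ∀ a : ℝ × ℝ, (n : ℝ) / m ≤ ‖a‖ →
      dist (φ (gridPoint m (gridRound m n a))) (φ a) ≤ δ :=
    fun a ha => by
      linarith [dist_triangle_right (φ (gridPoint m (gridRound m n a))) (φ a) p, h.far a ha,
        h.far_border (gridRound_mem_border h.m_pos ha)]
  have hpole : dist (φ (gridPoint m (h.vertex p))) p ≤ δ := by
    linarith [h.far_border h.vertex_pole_mem_border]
  by_cases hz : z = p
  · subst hz
    have hK : IsClosed (φ '' Metric.closedBall 0 (n / m)) :=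
      ((isCompact_closedBall _ _).image h.chart.continuous).isClosed
    have hp : z ∉ φ '' Metric.closedBall 0 (n / m) := by
      rintro ⟨a, -, ha⟩
      exact h.chart.ne a ha
    filter_upwards [hK.isOpen_compl.mem_nhds hp] with z' hz'
    have hv := h.vertex_mem_board
    by_cases hzz : z' = z
    · subst hzz
      exact .refl ⟨hv _, .inl hpole⟩
    obtain ⟨a, rfl⟩ := h.chart.exists_eq hzz
    have ha : (n : ℝ) / m ≤ ‖a‖ := by
      by_contra hlt
      exact hz' ⟨a, by simpa using (not_le.1 hlt).le, rfl⟩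
    refine .single ⟨hv _, .inl hpole⟩ ⟨hv _, .inr ?_⟩ (.inr ⟨h.vertex_pole_mem_border, ?_⟩)
    · rw [vertex_apply]; exact hborder a ha
    · rw [vertex_apply]; exact gridRound_mem_border h.m_pos ha
  obtain ⟨a, rfl⟩ := h.chart.exists_eq hz
  rw [← h.chart.isOpenEmbedding.map_nhds_eq, Filter.eventually_map]
  simp only [vertex_apply]
  rcases lt_or_ge ((n : ℝ) / m) ‖a‖ with ha | ha
  · filter_upwards [(isOpen_lt continuous_const continuous_norm).mem_nhds ha] with b hb
    exact .single ⟨gridRound_mem_board _ _ _, .inl (hborder a ha.le)⟩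
      ⟨gridRound_mem_board _ _ _, .inr (hborder b (le_of_lt hb))⟩
      (.inr ⟨gridRound_mem_border h.m_pos ha.le, gridRound_mem_border h.m_pos (le_of_lt hb)⟩)
  · have ha' : |a.1 * m| ≤ n ∧ |a.2 * m| ≤ n := by
      rw [Prod.norm_def, max_le_iff, Real.norm_eq_abs, Real.norm_eq_abs, le_div_iff₀ hm,
        le_div_iff₀ hm] at ha
      simpa [abs_mul] using ha
    filter_upwards [Metric.closedBall_mem_nhds a (show (0 : ℝ) < 1 / (2 * m) by positivity)]
      with b hb
    have hb' : |b.1 * m - a.1 * m| ≤ 1 / 2 ∧ |b.2 * m - a.2 * m| ≤ 1 / 2 := by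
      rw [Metric.mem_closedBall, Prod.dist_eq, max_le_iff, Real.dist_eq, Real.dist_eq,
        le_div_iff₀ (by positivity), le_div_iff₀ (by positivity)] at hb
      simp only [← sub_mul, abs_mul, Nat.abs_cast]
      constructor <;> linarith
    have hr : ∀ x : ℝ, |((round x : ℤ) : ℝ) - x| ≤ 1 / 2 := fun x => by
      rw [abs_sub_comm]; exact abs_sub_round x
    have hA1 := abs_clamp_sub_le ha'.1 (hr (a.1 * m))
    have hA2 := abs_clamp_sub_le ha'.2 (hr (a.2 * m))
    have hr' : ∀ x y : ℝ, |x - y| ≤ 1 / 2 → |((round x : ℤ) : ℝ) - y| ≤ 1 := fun x y hxy => by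
      have := abs_sub_le ((round x : ℤ) : ℝ) x y
      linarith [hr x]
    have hB1 := abs_clamp_sub_le ha'.1 (hr' _ _ hb'.1)
    have hB2 := abs_clamp_sub_le ha'.2 (hr' _ _ hb'.2)
    have hA := gridRound_mem_board m n a
    have hB := gridRound_mem_board m n b
    change |((gridRound m n a).1 : ℝ) - _| ≤ _ at hA1
    change |((gridRound m n a).2 : ℝ) - _| ≤ _ at hA2
    change |((gridRound m n b).1 : ℝ) - _| ≤ _ at hB1
    change |((gridRound m n b).2 : ℝ) - _| ≤ _ at hB2
    generalize gridRound m n a = u at *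
    generalize gridRound m n b = v at *
    have hint : ∀ (i j : ℤ) (x : ℝ), |(i : ℝ) - x| ≤ 1 / 2 → |(j : ℝ) - x| ≤ 1 →
        j = i ∨ j = i + 1 ∨ i = j + 1 := by
      intro i j x hi hj
      rw [abs_le] at hi hj
      have h1 : (j : ℝ) < ((i + 2 : ℤ) : ℝ) := by push_cast; linarith
      have h2 : (i : ℝ) < ((j + 2 : ℤ) : ℝ) := by push_cast; linarith
      have := Int.cast_lt.1 h1
      have := Int.cast_lt.1 h2
      omega
    have e1 := hint _ _ _ hA1 hB1
    have e2 := hint _ _ _ hA2 hB2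
    have hu := h.dist_gridPoint_le (hA1.trans (by norm_num)) (hA2.trans (by norm_num))
    have hv := h.dist_gridPoint_le hB1 hB2
    have hq := h.dist_gridPoint_le (q := (u.1, v.2)) (hA1.trans (by norm_num)) hB2
    have hqb : (u.1, v.2) ∈ board n := ⟨hA.1, hA.2.1, hB.2.2⟩
    refine Linked.trans (v := (u.1, v.2)) ?_ ?_
    · by_cases he : v.2 = u.2
      · rw [he]
        exact .refl ⟨hA, .inl hu⟩
      · refine .single ⟨hA, .inl hu⟩ ⟨hqb, .inl hq⟩ (.inl ?_)
        simp only [hexAdj, true_and]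
        omega
    · by_cases he : v.1 = u.1
      · have : (u.1, v.2) = v := by rw [← he]
        rw [this]
        exact .refl ⟨hB, .inl hv⟩
      · refine .single ⟨hqb, .inl hq⟩ ⟨hB, .inl hv⟩ (.inl ?_)
        simp only [hexAdj, and_true]
        omega

theorem linked_of_isPreconnected (h : FineGrid φ p m n δ) (hδ : 0 < δ) {K : Set Z}
    (hK : IsPreconnected K) {z z' : Z} (hz : z ∈ K) (hz' : z' ∈ K) :
    Linked (fineAdj n) (board n ∩ {u | ∃ κ ∈ K, dist (φ (gridPoint m u)) κ ≤ δ})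
      (h.vertex z) (h.vertex z') := by
  refine hK.induction₂ (fun z z' => Linked (fineAdj n)
    (board n ∩ {u | ∃ κ ∈ K, dist (φ (gridPoint m u)) κ ≤ δ}) (h.vertex z) (h.vertex z'))
    (fun x hx => ?_) (fun _ _ _ _ _ _ => .trans) (fun _ _ _ _ => .symm (fineAdj_symm n)) hz hz'
  filter_upwards [(h.eventually_linked hδ x).filter_mono nhdsWithin_le_nhds,
    self_mem_nhdsWithin] with y hy hyK
  exact hy.mono fun u hu => ⟨hu.1, hu.2.elim (fun h => ⟨x, hx, h⟩) fun h => ⟨y, hyK, h⟩⟩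

end FineGrid

theorem IsPlaneChart.exists_separation {Z : Type*} [MetricSpace Z] {φ : ℝ × ℝ → Z}
    {p : Z} (h : IsPlaneChart φ p) {K F : Set (ℝ × ℝ)} (hK : IsCompact K) (hF : IsClosed F)
    (hKF : Disjoint K F) :
    ∃ κ > 0, ∀ a ∈ K, κ ≤ dist (φ a) p ∧ ∀ b ∈ F, κ ≤ dist (φ a) (φ b) := by
  have hcl : IsClosed (φ '' F ∪ {p}) := by
    have : φ '' F ∪ {p} = (φ '' Fᶜ)ᶜ := by
      ext z
      by_cases hz : z = p
      · subst hz
        simp only [Set.union_singleton, Set.mem_insert_iff, true_or, Set.mem_compl_iff, true_iff]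
        rintro ⟨a, -, ha⟩
        exact h.ne a ha
      · obtain ⟨a, rfl⟩ := h.exists_eq hz
        simp [h.isOpenEmbedding.injective.eq_iff, h.ne a]
    rw [this]
    exact (h.isOpenEmbedding.isOpenMap _ hF.isOpen_compl).isClosed_compl
  have hdisj : Disjoint (φ '' K) (φ '' F ∪ {p}) := by
    rw [Set.disjoint_left]
    rintro _ ⟨a, ha, rfl⟩ (⟨b, hb, hab⟩ | hp)
    · rw [h.isOpenEmbedding.injective hab] at hb
      exact Set.disjoint_left.1 hKF ha hb
    · exact h.ne a hp
  obtain ⟨κ, hκ, hd⟩ := hdisj.exists_thickenings (hK.image h.continuous) hcl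
  have key : ∀ a ∈ K, ∀ z ∈ φ '' F ∪ {p}, κ ≤ dist (φ a) z := fun a ha z hz => by
    by_contra hlt
    exact Set.disjoint_left.1 hd (Metric.self_subset_thickening hκ _ (Set.mem_image_of_mem φ ha))
      (Metric.mem_thickening_iff.2 ⟨z, hz, not_le.1 hlt⟩)
  exact ⟨κ, hκ, fun a ha => ⟨key a ha p (.inr rfl), fun b hb => key a ha _ (.inl ⟨b, hb, rfl⟩)⟩⟩

/-- The four signed coordinates. -/
def quad {R : Type*} [Neg R] (s : Fin 4) (a : R × R) : R := ![-a.1, a.1, -a.2, a.2] s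

theorem quad_gridPoint (m : ℕ) (s : Fin 4) (v : ℤ × ℤ) :
    quad s (gridPoint m v) = (quad s v : ℤ) / m := by
  fin_cases s <;> simp [quad, gridPoint, neg_div]

theorem continuous_quad (s : Fin 4) : Continuous (quad s : ℝ × ℝ → ℝ) := by
  fin_cases s
  · exact continuous_fst.neg
  · exact continuous_fst
  · exact continuous_snd.neg
  · exact continuous_snd

/-- The index of a sector containing `v`. -/
def sector (M : ℕ) (v : ℤ × ℤ) : Fin 4 :=
  if v.1 ≤ -M ∧ v.1 ≤ v.2 ∧ v.2 ≤ -v.1 then 0 else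
  if M ≤ v.1 ∧ -v.1 ≤ v.2 ∧ v.2 ≤ v.1 then 1 else
  if v.2 ≤ -M ∧ v.2 < v.1 ∧ v.1 < -v.2 then 2 else 3

theorem le_quad_sector {M : ℕ} {v : ℤ × ℤ} (hv : v ∉ innerBoard M) :
    (M : ℤ) ≤ quad (sector M v) v := by
  simp only [innerBoard, Set.mem_ofPred_eq] at hv
  unfold sector
  split_ifs with h0 h1 h2
  · simp only [quad, Matrix.cons_val]; omega
  · simp only [quad, Matrix.cons_val]; omega
  · simp only [quad, Matrix.cons_val]; omega
  · simp only [quad, Matrix.cons_val]; omega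

theorem norm_gridPoint_le {m N : ℕ} (hm : 0 < m) {v : ℤ × ℤ} (hv : v ∈ innerBoard (N * m)) :
    ‖gridPoint m v‖ ≤ N := by
  have hm' : (0 : ℝ) < m := by exact_mod_cast hm
  obtain ⟨h1, h2, h3, h4⟩ := hv
  have key : ∀ k : ℤ, -((N * m : ℕ) : ℤ) < k → k < (N * m : ℕ) → |(k : ℝ)| ≤ N * m :=
      fun k h1 h2 => by
    exact_mod_cast (abs_lt.2 ⟨h1, h2⟩).le
  rw [Prod.norm_def]
  simp only [gridPoint, norm_div, Real.norm_eq_abs, Nat.abs_cast]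
  exact max_le ((div_le_iff₀ hm').2 (key _ h1 h2)) ((div_le_iff₀ hm').2 (key _ h3 h4))

theorem Finset.exists_maximal_separated {α X : Type*} [PseudoMetricSpace X] (pos : α → X)
    (A : Finset α) {ε : ℝ} (hε : 0 < ε) :
    ∃ J ⊆ A, (∀ i ∈ J, ∀ j ∈ J, i ≠ j → ε ≤ dist (pos i) (pos j)) ∧
      ∀ v ∈ A, ∃ j ∈ J, dist (pos v) (pos j) < ε := by
  classical
  let P : Finset α → Prop := fun J => ∀ i ∈ J, ∀ j ∈ J, i ≠ j → ε ≤ dist (pos i) (pos j)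
  obtain ⟨J, hJ⟩ := (A.powerset.filter P).exists_maximal ⟨∅, by simp [P]⟩
  have hJ' := hJ.prop
  rw [Finset.mem_filter, Finset.mem_powerset] at hJ'
  refine ⟨J, hJ'.1, hJ'.2, fun v hv => ?_⟩
  by_contra! hfar
  have hvJ : v ∉ J := fun h => by linarith [hfar v h, dist_self (pos v)]
  refine hvJ (hJ.le_of_ge (y := insert v J) ?_
      (Finset.subset_insert v J) (Finset.mem_insert_self v J))
  rw [Finset.mem_filter, Finset.mem_powerset]
  refine ⟨Finset.insert_subset hv hJ'.1, fun i hi j hj hij => ?_⟩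
  rcases Finset.mem_insert.1 hi with rfl | hi' <;> rcases Finset.mem_insert.1 hj with rfl | hj'
  · exact absurd rfl hij
  · exact hfar j hj'
  · rw [dist_comm]; exact hfar i hi'
  · exact hJ'.2 i hi' j hj' hij

namespace FineGrid

variable {Z : Type*} [MetricSpace Z] {φ : ℝ × ℝ → Z} {p : Z} {m n : ℕ} {ε Λ : ℝ}

/-- The component of `j` in its neighbourhood of radius `(Λ + 1) ε`. -/
def cell (φ : ℝ × ℝ → Z) (m n : ℕ) (ε Λ : ℝ) (j : ℤ × ℤ) : Set (ℤ × ℤ) :=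
  {u | Linked hexAdj
    (board n ∩ {u | dist (φ (gridPoint m u)) (φ (gridPoint m j)) < (Λ + 1) * ε}) j u}

theorem mem_cell (G : FineGrid φ p m n ε) (hε : 0 < ε) (hllc : LinLocConnected Z Λ)
    {j v : ℤ × ℤ} (hj : j ∈ board n) (hv : v ∈ board n)
    (hjp : (Λ + 2) * ε < dist (φ (gridPoint m j)) p)
    (hvj : dist (φ (gridPoint m v)) (φ (gridPoint m j)) < ε) : v ∈ cell φ m n ε Λ j := by
  obtain ⟨K, hKb, hK, hjK, hvK⟩ := hllc.inside (φ (gridPoint m j)) ε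
    (φ (gridPoint m j)) _ (by simpa using hε) hvj
  have hl := G.linked_of_isPreconnected hε hK hjK hvK
  rw [G.vertex_gridPoint hj, G.vertex_gridPoint hv] at hl
  have hsub : ∀ u ∈ board n ∩ {u | ∃ κ ∈ K, dist (φ (gridPoint m u)) κ ≤ ε},
      u ∈ board n ∩ {u | dist (φ (gridPoint m u)) (φ (gridPoint m j)) < (Λ + 1) * ε} := by
    rintro u ⟨hu, κ, hκ, hd⟩
    refine ⟨hu, (dist_triangle _ κ _).trans_lt ?_⟩
    have := Metric.mem_ball.1 (hKb hκ)
    linarith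
  refine hl.map id hsub fun a ha b hb hab => .single (hsub a ha) (hsub b hb) ?_
  refine hab.resolve_right fun hborder => ?_
  have h1 := (hsub a ha).2
  have h2 := G.far_border hborder.1
  rw [Set.mem_ofPred_eq] at h1
  linarith [dist_triangle_left (φ (gridPoint m j)) p (φ (gridPoint m a))]

theorem exists_labelling (G : FineGrid φ p m n ε) (hε : 0 < ε) (hΛ : 1 ≤ Λ)
    (hllc : LinLocConnected Z Λ) {C₀ : ℝ}
    (hcount : ∀ (x : Z) (r ε : ℝ), 0 < ε → ε ≤ r → ∀ A : Finset Z, (∀ a ∈ A, dist a x ≤ r) →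
      (∀ a ∈ A, ∀ b ∈ A, a ≠ b → ε ≤ dist a b) → (A.card : ℝ) ≤ C₀ * (r / ε) ^ 2)
    {k : ℕ} (hk : C₀ * (2 * (Λ + 1)) ^ 2 ≤ k) {N : ℕ} (hN : 1 ≤ N) (hn : (N + 1) * m ≤ n)
    (hp : ∀ a, ‖a‖ ≤ N + 1 → (Λ + 2) * ε < dist (φ a) p)
    (hs : ∀ s (a b : ℝ × ℝ), ‖a‖ ≤ N + 1 → quad s a ≤ N → N + 1 ≤ quad s b →
      (k + 1) * (2 * (Λ + 1)) * ε < dist (φ a) (φ b)) :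
    ∃ T : BoardLabelling n ((N + 1) * m) (N * m) (ℤ × ℤ),
      (∀ v ∈ board n, ∀ j, T.lab v = .inl j →
        dist (φ (gridPoint m v)) (φ (gridPoint m j)) ≤ (k + 1) * (2 * (Λ + 1)) * ε) ∧
      ∀ v ∈ board n, ∀ v' ∈ board n, ∀ j j', T.lab v = .inl j → T.lab v' = .inl j' → j ≠ j' →
        ε ≤ dist (φ (gridPoint m j)) (φ (gridPoint m j')) := by
  classical
  have hm := G.m_pos
  have hmr : (0 : ℝ) < m := by exact_mod_cast hm
  set pos : ℤ × ℤ → Z := fun v => φ (gridPoint m v) with hpos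
  set M := (N + 1) * m with hM
  have hNM : N * m < M := by rw [hM]; nlinarith
  have hinner : innerBoard M ⊆ board n := by
    intro v hv
    simp only [innerBoard, board, Set.mem_ofPred_eq] at hv ⊢
    omega
  have hfinI : (innerBoard M).Finite := (board_finite n).subset hinner
  obtain ⟨J, hJA, hJsep, hJnet⟩ := Finset.exists_maximal_separated pos hfinI.toFinset hε
  have hJi : ∀ j ∈ J, j ∈ innerBoard M := fun j hj => hfinI.mem_toFinset.1 (hJA hj)
  have hJp : ∀ j ∈ J, (Λ + 2) * ε < dist (pos j) p := fun j hj =>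
    hp _ (by exact_mod_cast norm_gridPoint_le hm (hJi j hj))
  obtain ⟨col, hcol, hcol'⟩ := Finset.exists_coloring
    (r := fun i j => dist (pos i) (pos j) ≤ 2 * (Λ + 1) * ε) (k := k)
    (fun a b h => by rwa [dist_comm]) J (fun j hj => by
      have hinj : Set.InjOn pos ({i ∈ J | dist (pos j) (pos i) ≤ 2 * (Λ + 1) * ε} : Finset _) := by
        intro a ha b hb hab
        by_contra hne
        have := hJsep a (Finset.mem_filter.1 ha).1 b (Finset.mem_filter.1 hb).1 hne
        rw [hab, dist_self] at this
        linarith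
      have := hcount (pos j) (2 * (Λ + 1) * ε) ε hε (by nlinarith)
        (({i ∈ J | dist (pos j) (pos i) ≤ 2 * (Λ + 1) * ε} : Finset _).image pos) (by
          simp only [Finset.mem_image, Finset.mem_filter]
          rintro _ ⟨i, hi, rfl⟩
          rw [dist_comm]
          exact hi.2) (by
          simp only [Finset.mem_image, Finset.mem_filter]
          rintro _ ⟨i, hi, rfl⟩ _ ⟨i', hi', rfl⟩ hne
          exact hJsep i hi.1 i' hi'.1 fun h => hne (by rw [h]))
      rw [Finset.card_image_of_injOn hinj, mul_div_cancel_right₀ _ hε.ne'] at this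
      exact_mod_cast this.trans hk)
  set seed : (ℤ × ℤ) ⊕ Fin 4 → Set (ℤ × ℤ) := Sum.elim (fun j => {w | w = j ∧ j ∈ J})
    (fun s => {w | w ∈ board n ∧ w ∉ innerBoard M ∧ sector M w = s}) with hseed
  set g₀ : ℤ × ℤ → Option ((ℤ × ℤ) ⊕ Fin 4) := fun v =>
    if v ∈ board n ∧ v ∉ innerBoard M then some (.inr (sector M v)) else none with hg₀
  have hg₀v : ∀ v ∈ board n, v ∉ innerBoard M → g₀ v = some (.inr (sector M v)) := fun v h1 h2 =>
    if_pos ⟨h1, h2⟩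
  have hg₀c : IsCells hexAdj pos seed 0 g₀ := by
    intro v l hv
    by_cases h : v ∈ board n ∧ v ∉ innerBoard M
    · have := hg₀v v h.1 h.2
      rw [this, Option.some_inj] at hv
      subst hv
      exact ⟨v, ⟨h.1, h.2, rfl⟩, .refl this, by simp⟩
    · simp [hg₀, h] at hv
  have hcell : ∀ j, ∀ v ∈ cell φ m n ε Λ j, v ∈ board n ∧ dist (pos v) (pos j) < (Λ + 1) * ε :=
    fun j v hv => by
      have h : v ∈ board n ∩ {u | dist (pos u) (pos j) < (Λ + 1) * ε} := Linked.right_mem hv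
      exact h
  have hCb : (⋃ j ∈ (J : Set (ℤ × ℤ)), cell φ m n ε Λ j) ⊆ board n :=
    Set.iUnion₂_subset fun j _ v hv => (hcell j v hv).1
  obtain ⟨g, hg, hext, hdom, hdom'⟩ := hg₀c.exists_extension_of_coloring hexAdj_symm
    (D := 2 * (Λ + 1) * ε) (by positivity) (J := (J : Set (ℤ × ℤ))) (C := cell φ m n ε Λ) hcol
    (fun i hi j hj hij hc => by
      rw [Set.disjoint_left]
      intro v hvi hvj
      refine hcol' i hi j hj hij ?_ hc
      linarith [dist_triangle_left (pos i) (pos j) (pos v), (hcell i v hvi).2, (hcell j v hvj).2])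
    (fun j _ v hv => Linked.restrict hv) ((board_finite n).subset hCb)
    (fun j _ v hv v' hv' => by
      linarith [dist_triangle_right (pos v) (pos v') (pos j), (hcell j v hv).2, (hcell j v' hv').2])
    (new := .inl) (fun j hj => by
      ext w
      simp only [hseed, Sum.elim_inl, Set.mem_ofPred_eq, Set.mem_singleton_iff]
      exact ⟨fun h => h.1, fun h => ⟨h, hj⟩⟩)
  have hgb : ∀ v, g v ≠ none → v ∈ board n := by
    intro v hv
    rcases hdom' v hv with h | h
    · by_contra hvb
      exact h (if_neg fun h => hvb h.1)
    · exact hCb h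
  have hgn : ∀ v ∈ board n, g v ≠ none := by
    intro v hv
    by_cases hvi : v ∈ innerBoard M
    · obtain ⟨j, hj, hvj⟩ := hJnet v (hfinI.mem_toFinset.2 hvi)
      exact hdom j hj v (G.mem_cell hε hllc (hinner (hJi j hj)) hv (hJp j hj) hvj)
    · rw [hext v _ (hg₀v v hv hvi)]
      simp
  have hlab : ∀ v ∈ board n, ∀ l, (g v).getD (.inr 0) = l → g v = some l := by
    intro v hv l hl
    obtain ⟨l', hl'⟩ := Option.ne_none_iff_exists'.1 (hgn v hv)
    rw [hl', Option.getD_some] at hl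
    rw [hl', hl]
  have hset : ∀ l, {u | g u = some l} ⊆ board n ∩ {w | (g w).getD (.inr 0) = l} := by
    intro l u hu
    rw [Set.mem_ofPred_eq] at hu
    exact ⟨hgb u (by rw [hu]; simp), by rw [Set.mem_ofPred_eq, hu, Option.getD_some]⟩
  have hlab₀ : ∀ v ∈ board n, v ∉ innerBoard M → (g v).getD (.inr 0) = .inr (sector M v) := by
    intro v hv hvi
    rw [hext v _ (hg₀v v hv hvi), Option.getD_some]
  have hR : ((k + 1 : ℕ) : ℝ) * (2 * (Λ + 1) * ε) = (k + 1) * (2 * (Λ + 1)) * ε := by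
    push_cast; ring
  rw [hR] at hg
  have hloc : ∀ v ∈ board n, ∀ s, (g v).getD (.inr 0) = .inr s → ((N * m : ℕ) : ℤ) < quad s v := by
    intro v hv s hvs
    by_contra! hle
    by_cases hvi : v ∈ innerBoard M
    · obtain ⟨w, ⟨-, hwi, hws⟩, -, hd⟩ := hg v _ (hlab v hv _ hvs)
      refine absurd hd (not_le.2 (hs s _ _ (by exact_mod_cast norm_gridPoint_le hm hvi) ?_ ?_))
      · rw [quad_gridPoint, div_le_iff₀ hmr]
        exact_mod_cast hle
      · have := le_quad_sector hwi
        rw [hws, hM] at this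
        rw [quad_gridPoint, le_div_iff₀ hmr]
        exact_mod_cast this
    · have h1 := le_quad_sector hvi
      rw [hlab₀ v hv hvi, Sum.inr.injEq] at hvs
      rw [hvs] at h1
      omega
  have hout : ∀ w, w ∉ innerBoard M ↔ (w.1 ≤ -M ∨ M ≤ w.1 ∨ w.2 ≤ -M ∨ M ≤ w.2) := by
    intro w
    simp only [innerBoard, Set.mem_ofPred_eq]
    omega
  have h1 : 1 ≤ N * m := Nat.mul_pos hN hm
  refine ⟨⟨fun v => (g v).getD (.inr 0), h1, hNM, hn, ?_, ?_, ?_, ?_, ?_, ?_, ?_, ?_, ?_, ?_⟩,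
      ?_, ?_⟩
  · intro v hv e1 e2 e3
    refine (hlab₀ v hv ((hout v).2 (.inl e1))).trans (congrArg _ ?_)
    unfold sector
    split_ifs with h0 h1 h2 <;> first | rfl | omega
  · intro v hv e1 e2 e3
    refine (hlab₀ v hv ((hout v).2 (.inr (.inl e1)))).trans (congrArg _ ?_)
    unfold sector
    split_ifs with h0 h1 h2 <;> first | rfl | omega
  · intro v hv e1 e2 e3
    refine (hlab₀ v hv ((hout v).2 (.inr (.inr (.inl e1))))).trans (congrArg _ ?_)
    unfold sector
    split_ifs with h0 h1 h2 <;> first | rfl | omega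
  · intro v hv e1 e2 e3
    refine (hlab₀ v hv ((hout v).2 (.inr (.inr (.inr e1))))).trans (congrArg _ ?_)
    unfold sector
    split_ifs with h0 h1 h2 <;> first | rfl | omega
  · intro v hv v' hv' j hj hj'
    obtain ⟨w, ⟨rfl, -⟩, hl, -⟩ := hg v _ (hlab v hv _ hj)
    obtain ⟨w', ⟨rfl, -⟩, hl', -⟩ := hg v' _ (hlab v' hv' _ hj')
    exact (hl.trans (hl'.symm hexAdj_symm)).mono (hset _)
  · intro v hv s hvs
    obtain ⟨w, ⟨hw, hwi, hws⟩, hl, -⟩ := hg v _ (hlab v hv _ hvs)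
    exact ⟨w, hw, (hout w).1 hwi, hl.mono (hset _)⟩
  · intro v hv h
    have := hloc v hv _ h
    simp only [quad, Matrix.cons_val] at this
    omega
  · intro v hv h
    have := hloc v hv _ h
    simpa only [quad, Matrix.cons_val] using this
  · intro v hv h
    have := hloc v hv _ h
    simp only [quad, Matrix.cons_val] at this
    omega
  · intro v hv h
    have := hloc v hv _ h
    simpa only [quad, Matrix.cons_val] using this
  · intro v hv j hj
    obtain ⟨w, ⟨rfl, -⟩, -, hd⟩ := hg v _ (hlab v hv _ hj)
    exact hd
  · intro v hv v' hv' j j' hj hj' hne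
    obtain ⟨w, ⟨rfl, hw⟩, -⟩ := hg v _ (hlab v hv _ hj)
    obtain ⟨w', ⟨rfl, hw'⟩, -⟩ := hg v' _ (hlab v' hv' _ hj')
    exact hJsep _ hw _ hw' hne

end FineGrid

theorem le_norm_gridPoint {m N : ℕ} (hm : 0 < m) {v : ℤ × ℤ} (hv : v ∉ innerBoard (N * m)) :
    N ≤ ‖gridPoint m v‖ := by
  have hm' : (0 : ℝ) < m := by exact_mod_cast hm
  have key : ∀ k : ℤ, (N * m : ℕ) ≤ |k| → (N : ℝ) ≤ |(k : ℝ)| / m := fun k h => by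
    rw [le_div_iff₀ hm']
    exact_mod_cast h
  have h : (N * m : ℕ) ≤ |v.1| ∨ (N * m : ℕ) ≤ |v.2| := by
    simp only [le_abs]
    simp only [innerBoard, Set.mem_ofPred_eq] at hv
    omega
  rw [Prod.norm_def, le_max_iff]
  simp only [gridPoint, norm_div, Real.norm_eq_abs, Nat.abs_cast]
  exact h.imp (key _) (key _)

/-- The axis-parallel rays issuing from `a`: left, right, down, up. -/
def ray (s : Fin 4) (a : ℝ × ℝ) : Set (ℝ × ℝ) :=
  {b | (s = 0 → b.1 ≤ a.1 ∧ b.2 = a.2) ∧ (s = 1 → a.1 ≤ b.1 ∧ b.2 = a.2) ∧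
    (s = 2 → b.2 ≤ a.2 ∧ b.1 = a.1) ∧ (s = 3 → a.2 ≤ b.2 ∧ b.1 = a.1)}

/-- A square tiling whose combinatorics is that of a decomposition of `Z` into small pieces,
together with one big piece around `p`. -/
structure FineTiling {Z : Type*} [MetricSpace Z] (φ : ℝ × ℝ → Z) (p : Z) (K : ℝ) (N : ℕ)
    (ε : ℝ) where
  I : Type
  fin : Fintype I
  S : SqTiling I
  P : Option I → Set Z
  node : Z → Option I
  center : I → Z
  node_surjective : Function.Surjective node
  node_pole : node p = none
  exists_close : ∀ m m', S.nadj m m' → ∃ a ∈ P m, ∃ a' ∈ P m', dist a a' ≤ ε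
  dist_center_le : ∀ i, ∀ a ∈ P (some i), dist a (center i) ≤ K * ε
  norm_ge : ∀ b, φ b ∈ P none → N ≤ ‖b‖
  sep : ∀ i j, i ≠ j → ε ≤ dist (center i) (center j)
  linked : ∀ X : Set Z, IsPreconnected X → ∀ z ∈ X, ∀ z' ∈ X,
    Linked S.nadj {k | ∃ a ∈ P k, ∃ κ ∈ X, dist a κ ≤ ε} (node z) (node z')
  ray_linked : ∀ a : ℝ × ℝ, a = (0, 0) ∨ a = (1, 0) → ∃ i, node (φ a) = some i ∧ ∀ s : Fin 4,
    ∃ j ∈ ![S.sL, S.sR, S.sB, S.sT] s,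
      Linked S.adj {j | ∃ b ∈ ray s a, ‖b‖ ≤ N + 1 ∧ φ b ∈ P (some j)} i j

theorem FineGrid.exists_fineTiling {Z : Type*} [MetricSpace Z] {φ : ℝ × ℝ → Z} {p : Z} {m n : ℕ}
    {K ε : ℝ} (G : FineGrid φ p m n ε) (hε : 0 < ε) {N : ℕ} (hN : 2 ≤ N)
    (T : BoardLabelling n ((N + 1) * m) (N * m) (ℤ × ℤ))
    (hd : ∀ v ∈ board n, ∀ j, T.lab v = .inl j →
      dist (φ (gridPoint m v)) (φ (gridPoint m j)) ≤ K * ε)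
    (hsep : ∀ v ∈ board n, ∀ v' ∈ board n, ∀ j j', T.lab v = .inl j → T.lab v' = .inl j' → j ≠ j' →
      ε ≤ dist (φ (gridPoint m j)) (φ (gridPoint m j'))) :
    Nonempty (FineTiling φ p K N ε) := by
  have hm := G.m_pos
  have hmr : (0 : ℝ) < m := by exact_mod_cast hm
  obtain ⟨I, hI, S, ν, c, hc, hadj, hnone, hnadj, hsurj, hlab, hray⟩ := T.exists_sqTiling
  have hinr : ∀ w ∈ board n, w ∉ innerBoard ((N + 1) * m) → ν w = none := by
    intro w hw hwi
    rcases T.outer_cases hw (by simp only [innerBoard, Set.mem_ofPred_eq] at hwi; omega) with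
      h | h | h | h
    all_goals exact hnone _ _ h.1
  have hborder : ∀ w ∈ board n, w ∈ border n → ν w = none := by
    intro w hw hwb
    refine hinr w hw fun hwi => ?_
    have := T.le
    obtain ⟨h1, h2, h3, h4⟩ := hwi
    rcases hwb with h | h | h | h <;> omega
  have hnode : ∀ v ∈ board n, ν (G.vertex (φ (gridPoint m v))) = ν v := fun v hv => by
    rw [G.vertex_gridPoint hv]
  have hpole : ν (G.vertex p) = none := hborder _ (G.vertex_mem_board p) G.vertex_pole_mem_border
  refine ⟨⟨I, hI, S, fun k => {z | ∃ v ∈ board n, ν v = k ∧ φ (gridPoint m v) = z},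
    fun z => ν (G.vertex z), fun i => φ (gridPoint m (c i)), ?_, hpole, ?_, ?_, ?_, ?_, ?_, ?_⟩⟩
  · rintro (_ | i)
    · exact ⟨p, hpole⟩
    · obtain ⟨v, hv, hvi⟩ := hsurj i
      exact ⟨_, (hnode v hv).trans hvi⟩
  · intro k k' hk
    obtain ⟨v, hv, v', hv', hvv, rfl, rfl⟩ := hnadj k k' hk
    exact ⟨_, ⟨v, hv, rfl, rfl⟩, _, ⟨v', hv', rfl, rfl⟩, G.dist_le_of_fineAdj (.inl hvv)⟩
  · rintro i _ ⟨v, hv, hvi, rfl⟩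
    exact hd v hv _ (hlab v i hvi)
  · rintro b ⟨v, hv, hvn, hvb⟩
    rw [← G.chart.isOpenEmbedding.injective hvb]
    refine le_norm_gridPoint hm fun hvi => ?_
    obtain ⟨i, hi, -⟩ := hray v hvi
    simp [hvn] at hi
  · intro i j hij
    obtain ⟨v, hv, hvi⟩ := hsurj i
    obtain ⟨w, hw, hwj⟩ := hsurj j
    exact hsep v hv w hw _ _ (hlab v i hvi) (hlab w j hwj) fun h => hij (hc h)
  · intro X hX z hz z' hz'
    have hmem : ∀ u ∈ board n ∩ {u | ∃ κ ∈ X, dist (φ (gridPoint m u)) κ ≤ ε},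
        ν u ∈ {k | ∃ a ∈ {z | ∃ v ∈ board n, ν v = k ∧ φ (gridPoint m v) = z}, ∃ κ ∈ X,
          dist a κ ≤ ε} := by
      rintro u ⟨hu, κ, hκ, hd⟩
      exact ⟨_, ⟨u, hu, rfl, rfl⟩, κ, hκ, hd⟩
    refine (G.linked_of_isPreconnected hε hX hz hz').map ν hmem fun a ha b hb hab => ?_
    have : ν a = ν b ∨ S.nadj (ν a) (ν b) := by
      rcases hab with h | h
      · exact hadj a ha.1 b hb.1 h
      · exact .inl ((hborder a ha.1 h.1).trans (hborder b hb.1 h.2).symm)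
    rcases this with h | h
    · rw [← h]
      exact .refl (hmem a ha)
    · exact .single (hmem a ha) (hmem b hb) h
  · intro a ha
    obtain ⟨v, hvi, rfl⟩ : ∃ v ∈ innerBoard (N * m), gridPoint m v = a := by
      have hNm : 2 * m ≤ N * m := Nat.mul_le_mul_right m hN
      rcases ha with rfl | rfl
      · refine ⟨(0, 0), ?_, by simp [gridPoint]⟩
        simp only [innerBoard, Set.mem_ofPred_eq]
        omega
      · refine ⟨(m, 0), ?_, by simp [gridPoint, hmr.ne']⟩
        simp only [innerBoard, Set.mem_ofPred_eq]
        omega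
    have hvb : v ∈ board n := by
      have h1 := T.lt
      have h2 := T.le
      simp only [innerBoard, board, Set.mem_ofPred_eq] at hvi ⊢
      omega
    obtain ⟨i, hi, hs⟩ := hray v hvi
    refine ⟨i, (hnode v hvb).trans hi, fun s => ?_⟩
    obtain ⟨j, hj, hl⟩ := hs s
    refine ⟨j, hj, hl.mono ?_⟩
    rintro j' ⟨w, hw, h0, h1, h2, h3, hwj⟩
    refine ⟨gridPoint m w, ?_, ?_, w, hw, hwj, rfl⟩
    · have hle : ∀ a b : ℤ, a ≤ b → (a : ℝ) / m ≤ b / m := fun a b h =>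
        div_le_div_of_nonneg_right (by exact_mod_cast h) hmr.le
      refine ⟨fun h => ?_, fun h => ?_, fun h => ?_, fun h => ?_⟩
      · exact ⟨hle _ _ (h0 h).1, by simp only [gridPoint, (h0 h).2]⟩
      · exact ⟨hle _ _ (h1 h).1, by simp only [gridPoint, (h1 h).2]⟩
      · exact ⟨hle _ _ (h2 h).1, by simp only [gridPoint, (h2 h).2]⟩
      · exact ⟨hle _ _ (h3 h).1, by simp only [gridPoint, (h3 h).2]⟩
    · by_cases hwi : w ∈ innerBoard ((N + 1) * m)
      · exact_mod_cast norm_gridPoint_le hm hwi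
      · simp [hinr w hw hwi] at hwj

theorem IsPlaneChart.exists_fineTiling {Z : Type*} [MetricSpace Z] [CompactSpace Z]
    {φ : ℝ × ℝ → Z} {p : Z} (h : IsPlaneChart φ p) {Λ : ℝ} (hΛ : 1 ≤ Λ)
    (hllc : LinLocConnected Z Λ) {C₀ : ℝ}
    (hcount : ∀ (x : Z) (r ε : ℝ), 0 < ε → ε ≤ r → ∀ A : Finset Z, (∀ a ∈ A, dist a x ≤ r) →
      (∀ a ∈ A, ∀ b ∈ A, a ≠ b → ε ≤ dist a b) → (A.card : ℝ) ≤ C₀ * (r / ε) ^ 2) :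
    ∃ K : ℝ, 1 ≤ K ∧ ∀ N : ℕ, 2 ≤ N → ∃ ε₀ > 0, ∀ ε, 0 < ε → ε < ε₀ →
      Nonempty (FineTiling φ p K N ε) := by
  obtain ⟨k, hk⟩ := exists_nat_ge (C₀ * (2 * (Λ + 1)) ^ 2)
  have hk0 : (0 : ℝ) ≤ k := k.cast_nonneg
  refine ⟨(k + 1) * (2 * (Λ + 1)), by nlinarith, fun N hN => ?_⟩
  have hsepS : ∀ s : Fin 4, ∃ κ > 0,
      ∀ a ∈ Metric.closedBall (0 : ℝ × ℝ) (N + 1) ∩ {a | quad s a ≤ N},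
      κ ≤ dist (φ a) p ∧ ∀ b ∈ {b | (N : ℝ) + 1 ≤ quad s b}, κ ≤ dist (φ a) (φ b) := fun s =>
    h.exists_separation ((isCompact_closedBall _ _).inter_right
      (isClosed_le (continuous_quad s) continuous_const))
      (isClosed_le continuous_const (continuous_quad s))
      (Set.disjoint_left.2 fun a ha hb => by
        have h1 := ha.2
        simp only [Set.mem_ofPred_eq] at h1 hb
        linarith)
  choose κ hκ hκs using hsepS
  obtain ⟨κ', hκ', hp⟩ := h.exists_separation (isCompact_closedBall (0 : ℝ × ℝ) (N + 1))
      isClosed_empty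
    (Set.disjoint_empty _)
  have hpos : 0 < (k + 1) * (2 * (Λ + 1)) := by positivity
  refine ⟨min (κ' / (Λ + 2))
      ((Finset.univ.inf' Finset.univ_nonempty κ) / ((k + 1) * (2 * (Λ + 1)))),
    ?_, fun ε hε hlt => ?_⟩
  · refine lt_min (by positivity) (div_pos ?_ hpos)
    rw [Finset.lt_inf'_iff]
    exact fun s _ => hκ s
  obtain ⟨h1, h2⟩ := lt_min_iff.1 hlt
  rw [lt_div_iff₀ (by positivity)] at h1
  rw [lt_div_iff₀ hpos, Finset.lt_inf'_iff] at h2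
  obtain ⟨m, N', hN', G⟩ := h.exists_fineGrid hε (N + 1)
  obtain ⟨T, hT1, hT2⟩ := G.exists_labelling hε hΛ hllc hcount hk (N := N) (by omega)
    (by rw [mul_comm m]; exact Nat.mul_le_mul_right m hN')
    (fun a ha => by
      have := (hp a (by simpa using ha)).1
      linarith)
    (fun s a b ha hqa hqb => by
      have := (hκs s a ⟨by simpa using ha, hqa⟩).2 b hqb
      linarith [h2 s (Finset.mem_univ s)])
  exact G.exists_fineTiling hε hN T hT1 hT2

theorem Linked.eq_or_exists_adj {α : Type*} {adj : α → α → Prop} {A : Set α} {u v : α}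
    (h : Linked adj A u v) : u = v ∨ ∃ w, adj u w ∧ Linked adj (A \ {u}) w v := by
  refine h.induction (P := fun x => u = x ∨ ∃ w, adj u w ∧ Linked adj (A \ {u}) w x) (.inl rfl) ?_
  rintro a b - ih hab hb
  rcases eq_or_ne b u with rfl | hbu
  · exact .inl rfl
  rcases ih with rfl | ⟨w, huw, hw⟩
  · exact .inr ⟨b, hab, .refl ⟨hb, hbu⟩⟩
  · exact .inr ⟨w, huw, hw.tail hab ⟨hb, hbu⟩⟩

/-- The variation of a function along a chain of sets is at most the sum of its oscillations. -/
theorem Linked.abs_sub_le_sum {α X : Type*} [PseudoMetricSpace X] {adj : α → α → Prop}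
    {P : α → Set X} {u : X → ℝ} {v : α → ℝ} {ε : ℝ}
    (hadj : ∀ m m', adj m m' → ∃ a ∈ P m, ∃ a' ∈ P m', dist a a' ≤ ε) (hv0 : ∀ m, 0 ≤ v m)
    (hv : ∀ m, ∀ a ∈ P m, ∀ a' ∈ P m, ∀ b, dist a' b ≤ ε → |u a - u b| ≤ v m) (A : Finset α)
    {m m' : α} (h : Linked adj (A : Set α) m m') {a a' b : X} (ha : a ∈ P m) (ha' : a' ∈ P m')
    (hb : dist a' b ≤ ε) : |u a - u b| ≤ ∑ n ∈ A, v n := by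
  classical
  induction A using Finset.strongInduction generalizing m a with
  | H A ih =>
    have hmA : m ∈ A := h.left_mem
    rcases h.eq_or_exists_adj with rfl | ⟨w, hw, hl⟩
    · exact (hv _ a ha a' ha' b hb).trans (Finset.single_le_sum (fun n _ => hv0 n) hmA)
    · obtain ⟨c, hc, c', hc', hcc⟩ := hadj m w hw
      have h1 := ih (A.erase m) (Finset.erase_ssubset hmA) (by rwa [Finset.coe_erase]) hc'
      have h2 := hv m a ha c hc c' hcc
      rw [← Finset.add_sum_erase A v hmA]
      linarith [abs_sub_le (u a) (u c') (u b)]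

theorem sum_one_div_sq_le {I : Type*} [Fintype I] {d : I → ℝ} {ρ B : ℝ} (hρ : 0 < ρ)
    (hcount : ∀ l : ℕ, ((Finset.univ.filter fun i => d i ≤ 2 ^ l * ρ).card : ℝ) ≤
      B * (2 ^ l * ρ) ^ 2) (k : ℕ) :
    ∑ i with d i ≤ 2 ^ k * ρ, 1 / (max (d i) ρ) ^ 2 ≤ 4 * B * (k + 1) := by
  classical
  have hB : 0 ≤ B := by
    have := (Nat.cast_nonneg _).trans (hcount 0)
    exact nonneg_of_mul_nonneg_left this (by positivity)
  have bound : ∀ (s : Finset I) (l : ℕ) (q : ℝ), 0 < q →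
      s ⊆ Finset.univ.filter (fun i => d i ≤ 2 ^ l * ρ) →
      (∀ i ∈ s, q ≤ max (d i) ρ) → ∑ i ∈ s, 1 / (max (d i) ρ) ^ 2 ≤
        B * (2 ^ l * ρ) ^ 2 * (1 / q ^ 2) := by
    intro s l q hq hs h
    calc ∑ i ∈ s, 1 / (max (d i) ρ) ^ 2 ≤ ∑ i ∈ s, 1 / q ^ 2 :=
          Finset.sum_le_sum fun i hi => one_div_le_one_div_of_le (by positivity)
            (pow_le_pow_left₀ hq.le (h i hi) 2)
      _ = s.card * (1 / q ^ 2) := by rw [Finset.sum_const, nsmul_eq_mul]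
      _ ≤ _ := mul_le_mul_of_nonneg_right ((Nat.cast_le.2 (Finset.card_le_card hs)).trans
          (hcount l)) (by positivity)
  induction k with
  | zero =>
    have := bound _ 0 ρ hρ subset_rfl fun i _ => le_max_right _ _
    rw [pow_zero, one_mul] at this
    rw [mul_assoc, mul_one_div_cancel (by positivity)] at this
    simp only [pow_zero, one_mul, Nat.cast_zero]
    linarith
  | succ k ih =>
    have hsub : Finset.univ.filter (fun i => d i ≤ 2 ^ (k + 1) * ρ) ⊆
        Finset.univ.filter (fun i => d i ≤ 2 ^ k * ρ) ∪
          Finset.univ.filter (fun i => 2 ^ k * ρ < d i ∧ d i ≤ 2 ^ (k + 1) * ρ) := by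
      intro i
      simp only [Finset.mem_union, Finset.mem_filter, Finset.mem_univ, true_and]
      intro h
      rcases le_or_gt (d i) (2 ^ k * ρ) with h' | h'
      · exact .inl h'
      · exact .inr ⟨h', h⟩
    have h1 := Finset.sum_le_sum_of_subset_of_nonneg (f := fun i => 1 / (max (d i) ρ) ^ 2) hsub
      fun i _ _ => by positivity
    have hdisj : Disjoint (Finset.univ.filter (fun i => d i ≤ 2 ^ k * ρ))
        (Finset.univ.filter (fun i => 2 ^ k * ρ < d i ∧ d i ≤ 2 ^ (k + 1) * ρ)) := by
      rw [Finset.disjoint_filter]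
      intro i _ h h'
      linarith [h'.1]
    rw [Finset.sum_union hdisj] at h1
    have h2 := bound (Finset.univ.filter (fun i => 2 ^ k * ρ < d i ∧ d i ≤ 2 ^ (k + 1) * ρ)) (k + 1)
      (2 ^ k * ρ) (by positivity) (fun i hi => by
        simp only [Finset.mem_filter, Finset.mem_univ, true_and] at hi ⊢
        exact hi.2) fun i hi => by
        simp only [Finset.mem_filter, Finset.mem_univ, true_and] at hi
        exact hi.1.le.trans (le_max_left _ _)
    have h3 : B * (2 ^ (k + 1) * ρ) ^ 2 * (1 / (2 ^ k * ρ) ^ 2) = 4 * B := by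
      field_simp
      ring
    push_cast
    linarith

/-- The logarithmic potential of the annulus of radii `ρ < R` about `x` varies slowly. -/
theorem abs_log_clamp_sub_le {ρ R α β q : ℝ} (hq : 0 < q) (hα : q ≤ max ρ (min R α))
    (hβ : q ≤ max ρ (min R β)) :
    |Real.log (max ρ (min R α)) - Real.log (max ρ (min R β))| ≤ |α - β| / q := by
  have key : ∀ a b : ℝ, q ≤ a → q ≤ b → Real.log a - Real.log b ≤ |a - b| / q := by
    intro a b ha hb
    have ha0 := hq.trans_le ha
    have hb0 := hq.trans_le hb
    rw [← Real.log_div ha0.ne' hb0.ne']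
    calc Real.log (a / b) ≤ a / b - 1 := Real.log_le_sub_one_of_pos (by positivity)
      _ = (a - b) / b := by field_simp
      _ ≤ |a - b| / b := div_le_div_of_nonneg_right (le_abs_self _) hb0.le
      _ ≤ |a - b| / q := div_le_div_of_nonneg_left (abs_nonneg _) hq hb
  have hl : |max ρ (min R α) - max ρ (min R β)| ≤ |α - β| :=
    (abs_max_sub_max_le_max _ _ _ _).trans (max_le (by simp)
      ((abs_min_sub_min_le_max _ _ _ _).trans (max_le (by simp) le_rfl)))
  refine le_trans ?_ (div_le_div_of_nonneg_right hl hq.le)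
  rw [abs_le]
  constructor
  · have := key _ _ hβ hα
    rw [abs_sub_comm] at this
    linarith
  · exact key _ _ hα hβ

namespace FineTiling

variable {Z : Type*} [MetricSpace Z] {φ : ℝ × ℝ → Z} {p : Z} {K ε : ℝ} {N : ℕ}

theorem center_injective (T : FineTiling φ p K N ε) (hε : 0 < ε) : Function.Injective T.center := by
  intro i j h
  by_contra hij
  have := T.sep i j hij
  rw [h, dist_self] at this
  linarith

/-- An annulus of the plane is not crossed by two continua of `Z` which are separated by an annulus
of large modulus. -/
theorem no_crossing (T : FineTiling φ p K N ε) (hε : 0 < ε) (hK : 1 ≤ K) {C₀ : ℝ}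
    (hcount : ∀ (x : Z) (r ε : ℝ), 0 < ε → ε ≤ r → ∀ A : Finset Z, (∀ a ∈ A, dist a x ≤ r) →
      (∀ a ∈ A, ∀ b ∈ A, a ≠ b → ε ≤ dist a b) → (A.card : ℝ) ≤ C₀ * (r / ε) ^ 2)
    {k : ℕ} (hk2 : 2 ≤ k * Real.log 2)
    (hk : 64 * C₀ * (K + 1) ^ 2 * (k + 2) / (k * Real.log 2) ^ 2 < 1 / 256)
    {x : Z} {r τ : ℝ} (hr : 4 * ((K + 1) * ε) ≤ r) (hτ : 2 * τ + ε ≤ r)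
    (hnone : ∀ a ∈ T.P none, dist a p ≤ τ) {E F : Set Z} (hE : IsPreconnected E)
    (hF : IsPreconnected F) (hEr : ∀ e ∈ E, dist e x + ε ≤ r) (hFr : ∀ f ∈ F, 2 ^ k * r ≤ dist f x)
    {e₁ e₂ f₁ f₂ : Z} (he₁ : e₁ ∈ E) (he₂ : e₂ ∈ E) (hf₁ : f₁ ∈ F) (hf₂ : f₂ ∈ F)
    {y : ℝ × ℝ} {s : ℝ} (hs : 0 < s) {a₁ a₂ b₁ b₂ : ℝ × ℝ}
    (ha₁ : a₁ ∈ T.S.Q (T.node e₁)) (ha₁s : dist a₁ y ≤ s)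
    (ha₂ : a₂ ∈ T.S.Q (T.node e₂)) (ha₂s : 2 * s ≤ dist a₂ y)
    (hb₁ : b₁ ∈ T.S.Q (T.node f₁)) (hb₁s : dist b₁ y ≤ s)
    (hb₂ : b₂ ∈ T.S.Q (T.node f₂)) (hb₂s : 2 * s ≤ dist b₂ y) : False := by
  classical
  have := T.fin
  set D := (K + 1) * ε with hD
  have hD0 : 0 < D := by positivity
  have hr0 : 0 < r := by linarith
  have hkl : 0 < k * Real.log 2 := by linarith
  set R := 2 ^ k * r with hR
  have hrR : r ≤ R := le_mul_of_one_le_left hr0.le (one_le_pow₀ one_le_two)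
  set u : Z → ℝ := fun z => Real.log (max r (min R (dist z x))) / (k * Real.log 2) with hu
  set v : Option T.I → ℝ := fun m => m.elim (1 / (k * Real.log 2)) fun i =>
    if dist (T.center i) x ≤ 2 ^ (k + 1) * r then
      4 * D / (k * Real.log 2) * (1 / max (dist (T.center i) x) r) else 0 with hv
  have hmax : ∀ i, 0 < max (dist (T.center i) x) r := fun i => lt_max_of_lt_right hr0
  have hv0 : ∀ m, 0 ≤ v m := by
    rintro (_ | i)
    · exact (one_div_pos.2 hkl).le
    · simp only [hv, Option.elim_some]
      split_ifs
      · have := hmax i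
        positivity
      · exact le_rfl
  have huv : ∀ m, ∀ a ∈ T.P m, ∀ a' ∈ T.P m, ∀ b, dist a' b ≤ ε → |u a - u b| ≤ v m := by
    intro m a ha a' ha' b hb
    have hsplit : |u a - u b| = |Real.log (max r (min R (dist a x))) -
        Real.log (max r (min R (dist b x)))| / (k * Real.log 2) := by
      rw [hu]
      simp only
      rw [← sub_div, abs_div, abs_of_pos hkl]
    have hab : |dist a x - dist b x| ≤ dist a b := abs_dist_sub_le a b x
    rw [hsplit]
    rcases m with _ | i
    · refine div_le_div_of_nonneg_right ?_ hkl.le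
      refine (abs_log_clamp_sub_le hr0 (le_max_left _ _) (le_max_left _ _)).trans ?_
      rw [div_le_one hr0]
      have h1 := hnone a ha
      have h2 := hnone a' ha'
      have h3 := dist_triangle4 a p a' b
      rw [dist_comm p a'] at h3
      linarith
    · have h1 := T.dist_center_le i a ha
      have h2 := T.dist_center_le i a' ha'
      have hac : dist a (T.center i) ≤ D := by rw [hD]; linarith
      have hbc : dist b (T.center i) ≤ D := by
        have := dist_triangle b a' (T.center i)
        rw [dist_comm b a'] at this
        rw [hD]; linarith
      have h3 := dist_triangle_left (T.center i) x a
      have h4 := dist_triangle_left (T.center i) x b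
      have h5 := dist_triangle_right a b (T.center i)
      simp only [hv, Option.elim_some]
      have h2R : 2 ^ (k + 1) * r = 2 * R := by rw [hR]; ring
      rw [h2R]
      split_ifs with hi
      · set q := max (dist (T.center i) x) r with hq
        have hq0 : 0 < q := hmax i
        have hq2 : ∀ α, dist (T.center i) x ≤ D + α → q / 2 ≤ max r (min R α) := by
          intro α hα
          rcases le_total (dist (T.center i) x) r with h | h
          · exact le_max_of_le_left (by rw [hq, max_eq_right h]; linarith)
          · rw [hq, max_eq_left h]
            rcases le_total (dist (T.center i) x) (2 * r) with h' | h'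
            · exact le_max_of_le_left (by linarith)
            · exact le_max_of_le_right (le_min (by linarith) (by linarith))
        have h6 := abs_log_clamp_sub_le (half_pos hq0) (hq2 (dist a x) (by linarith))
          (hq2 (dist b x) (by linarith))
        have h7 : |dist a x - dist b x| / (q / 2) ≤ 2 * D / (q / 2) :=
          div_le_div_of_nonneg_right (by linarith) (half_pos hq0).le
        calc _ ≤ 2 * D / (q / 2) / (k * Real.log 2) :=
              div_le_div_of_nonneg_right (h6.trans h7) hkl.le
          _ = _ := by field_simp; ring
      · push Not at hi
        rw [min_eq_left (by linarith), min_eq_left (by linarith)]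
        simp
  have hmain := T.S.length_area y hs hv0 (by
    simp only [hv, Option.elim_none]
    rw [div_le_iff₀ hkl]
    linarith) ?_
  · have hsum : ∑ i, v (some i) ^ 2 = (4 * D / (k * Real.log 2)) ^ 2 *
        ∑ i with dist (T.center i) x ≤ 2 ^ (k + 1) * r,
          1 / (max (dist (T.center i) x) r) ^ 2 := by
      rw [Finset.mul_sum, Finset.sum_filter]
      refine Finset.sum_congr rfl fun i _ => ?_
      simp only [hv, Option.elim_some]
      split_ifs
      · rw [mul_pow, one_div_pow]
      · ring
    have hc : ∀ l : ℕ, ((Finset.univ.filter fun i => dist (T.center i) x ≤ 2 ^ l * r).card : ℝ) ≤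
        C₀ / ε ^ 2 * (2 ^ l * r) ^ 2 := by
      intro l
      have h1 : r ≤ 2 ^ l * r := le_mul_of_one_le_left hr0.le (one_le_pow₀ one_le_two)
      have h2 := hcount x (2 ^ l * r) ε hε (by nlinarith)
        ((Finset.univ.filter fun i => dist (T.center i) x ≤ 2 ^ l * r).image T.center)
        (by
          intro a ha
          obtain ⟨i, hi, rfl⟩ := Finset.mem_image.1 ha
          exact (Finset.mem_filter.1 hi).2)
        (by
          intro a ha b hb hab
          obtain ⟨i, hi, rfl⟩ := Finset.mem_image.1 ha
          obtain ⟨j, hj, rfl⟩ := Finset.mem_image.1 hb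
          exact T.sep i j fun h => hab (h ▸ rfl))
      rw [Finset.card_image_of_injective _ (T.center_injective hε)] at h2
      calc _ ≤ _ := h2
        _ = _ := by rw [div_pow]; ring
    have h3 := sum_one_div_sq_le hr0 hc (k + 1)
    rw [hsum] at hmain
    have h4 := mul_le_mul_of_nonneg_left h3 (sq_nonneg (4 * D / (k * Real.log 2)))
    have h5 : (4 * D / (k * Real.log 2)) ^ 2 * (4 * (C₀ / ε ^ 2) * (((k + 1 : ℕ) : ℝ) + 1)) =
        64 * C₀ * (K + 1) ^ 2 * (k + 2) / (k * Real.log 2) ^ 2 := by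
      have hk0 : (k : ℝ) ≠ 0 := by rintro h; rw [h] at hkl; simp at hkl
      have hl0 : Real.log 2 ≠ 0 := (Real.log_pos one_lt_two).ne'
      rw [hD]
      push_cast
      field_simp
      ring
    linarith
  · intro t hst ht hg
    have ht0 : 0 ≤ t := (hs.trans hst).le
    obtain ⟨m, ⟨a, ha, κ, hκ, haκ⟩, hm⟩ := T.S.exists_mem_hits_sphere ht0
      (T.linked E hE e₁ he₁ e₂ he₂) ha₁ (ha₁s.trans hst.le) ha₂ (ht.le.trans ha₂s)
    obtain ⟨m', ⟨a', ha', b, hb, hab⟩, hm'⟩ := T.S.exists_mem_hits_sphere ht0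
      (T.linked F hF f₁ hf₁ f₂ hf₂) hb₁ (hb₁s.trans hst.le) hb₂ (ht.le.trans hb₂s)
    refine ⟨(T.S.hits (Metric.sphere y t)).toFinite.toFinset, by simp, ?_⟩
    have hl := T.S.sphere_linked ht0 hg hm hm'
    have h1 := Linked.abs_sub_le_sum (u := u) T.exists_close hv0 huv
      (T.S.hits (Metric.sphere y t)).toFinite.toFinset (by rwa [Set.Finite.coe_toFinset]) ha ha' hab
    refine le_trans ?_ h1
    have h2 := dist_triangle a κ x
    have h3 := hEr κ hκ
    have h4 : u a = Real.log r / (k * Real.log 2) := by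
      simp only [hu]
      rw [max_eq_left ((min_le_right _ _).trans (by linarith))]
    have h5 : u b = (k * Real.log 2 + Real.log r) / (k * Real.log 2) := by
      simp only [hu]
      rw [min_eq_left (hFr b hb), max_eq_right hrR, hR,
        Real.log_mul (by positivity) hr0.ne', Real.log_pow]
    rw [h4, h5, ← sub_div, abs_div, abs_of_pos hkl, sub_add_cancel_right, abs_neg, abs_of_pos hkl,
      div_self hkl.ne']

end FineTiling

namespace SqTiling

variable {I : Type*} {S : SqTiling I} {i j j' : I} {c : ℝ × ℝ} {t : ℝ}

theorem mem_Q_some {z : ℝ × ℝ} : z ∈ S.Q (some i) ↔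
    (S.x i ≤ z.1 ∧ z.1 ≤ S.x i + S.w i) ∧ S.y i ≤ z.2 ∧ z.2 ≤ S.y i + S.w i := Iff.rfl

/-- A tile which can be joined to the left and the right sides lies in the rectangle. -/
theorem mem_rectangle {A A' : Set I} (hc : c ∈ S.Q (some i)) (hj : j ∈ S.sL)
    (hl : Linked S.adj A i j) (hj' : j' ∈ S.sR) (hr : Linked S.adj A' i j') :
    0 ≤ c.1 ∧ c.1 ≤ S.L ∧ 0 ≤ c.2 ∧ c.2 ≤ S.H := by
  by_contra hcon
  have hpos : ∀ a, c ∈ S.Q (some a) → S.w a = 0 := by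
    intro a ha
    by_contra hw
    have h1 := S.inR a ((S.w_nonneg a).lt_of_ne' hw)
    obtain ⟨⟨h2, h3⟩, h4, h5⟩ := ha
    exact hcon ⟨by linarith, by linarith, by linarith, by linarith⟩
  have key : ∀ (B : Set I) a, Linked S.adj B i a → c ∈ S.Q (some a) := by
    intro B a h
    refine h.induction (P := fun a => c ∈ S.Q (some a)) hc ?_
    intro a b _ ha hab _
    have hw := hpos a ha
    obtain ⟨⟨h2, h3⟩, h4, h5⟩ := ha
    have h6 := S.adj_x _ _ hab
    have h7 := S.adj_y _ _ hab
    have h8 := S.adj_x _ _ (S.adj_symm hab)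
    have h9 := S.adj_y _ _ (S.adj_symm hab)
    exact ⟨⟨by linarith, by linarith⟩, by linarith, by linarith⟩
  have h1 := key A j hl
  have h2 := key A' j' hr
  have h3 := hpos _ h1
  have h4 := hpos _ h2
  have h5 := S.x_sL j hj
  have h6 := S.x_sR j' hj'
  obtain ⟨⟨h7, h8⟩, -⟩ := h1
  obtain ⟨⟨h9, h10⟩, -⟩ := h2
  linarith [S.L_pos]

theorem Generic.w_pos (hg : S.Generic c t) (ht : 0 ≤ t) (hi : some i ∈ S.hits (Metric.sphere c t)) :
    0 < S.w i := by
  refine (S.w_nonneg i).lt_of_ne' fun hw => ?_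
  obtain ⟨z, ⟨⟨h1, h2⟩, h3, h4⟩, hz⟩ := hi
  obtain ⟨g1, -, g2, -, g3, -, g4, -⟩ := hg
  rw [Metric.mem_sphere, Prod.dist_eq, Real.dist_eq, Real.dist_eq] at hz
  rcases max_choice |z.1 - c.1| |z.2 - c.2| with h | h <;> rw [h] at hz <;>
    rcases (abs_eq ht).1 hz with h' | h'
  · exact (g1 i).1 (by linarith)
  · exact (g2 i).1 (by linarith)
  · exact (g3 i).1 (by linarith)
  · exact (g4 i).1 (by linarith)

open Classical in
/-- Small spheres meet few tiles. -/
theorem exists_card_hits_le [Fintype I] (S : SqTiling I) (c : ℝ × ℝ) :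
    ∃ t₀ > 0, ∀ t, 0 < t → t < t₀ →
    S.Generic c t →
    (Finset.univ.filter fun i => some i ∈ S.hits (Metric.sphere c t)).card ≤ 16 := by
  obtain ⟨t₀, ht₀, hmin⟩ : ∃ t₀ > 0, ∀ i, 0 < S.w i → t₀ ≤ S.w i := by
    rcases (Finset.univ.filter fun i => 0 < S.w i).eq_empty_or_nonempty with h | h
    · exact ⟨1, one_pos, fun i hi =>
        absurd hi (Finset.filter_eq_empty_iff.1 h (Finset.mem_univ i))⟩
    · obtain ⟨i, hi, hmin⟩ := Finset.exists_min_image _ S.w h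
      exact ⟨S.w i, (Finset.mem_filter.1 hi).2, fun j hj => hmin j (by simpa using hj)⟩
  refine ⟨t₀, ht₀, fun t ht htt hg => ?_⟩
  have h1 := S.sum_min_sq_le c ht
  have h2 : ∑ i with some i ∈ S.hits (Metric.sphere c t), t ^ 2 ≤
      ∑ i with some i ∈ S.hits (Metric.closedBall c t), min (S.w i) t ^ 2 := by
    refine le_trans (Finset.sum_le_sum fun i hi => ?_)
      (Finset.sum_le_sum_of_subset_of_nonneg ?_ fun i _ _ => sq_nonneg _)
    · have := hmin i (hg.w_pos ht.le (Finset.mem_filter.1 hi).2)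
      rw [min_eq_right (by linarith)]
    · intro i hi
      rw [Finset.mem_filter] at hi ⊢
      exact ⟨hi.1, S.hits_mono Metric.sphere_subset_closedBall hi.2⟩
  rw [Finset.sum_const, nsmul_eq_mul] at h2
  have h3 := le_of_mul_le_mul_right (h2.trans h1) (by positivity)
  exact_mod_cast h3

end SqTiling

namespace FineTiling

variable {Z : Type*} [MetricSpace Z] {φ : ℝ × ℝ → Z} {p : Z} {K ε κ : ℝ} {N : ℕ}

/-- The squares of two adjacent lattice points are disjoint. -/
theorem disjoint_Q (T : FineTiling φ p K N ε) (hε : 0 < ε) (hK : 1 ≤ K)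
    (hκ : 16 * (2 * K * ε + ε) < κ)
    (hsep : ∀ b b' : ℝ × ℝ, ‖b‖ ≤ N + 1 → ‖b'‖ ≤ N + 1 → 1 ≤ |b.1 - b'.1| → κ ≤ dist (φ b) (φ b')) :
    Disjoint (T.S.Q (T.node (φ (0, 0)))) (T.S.Q (T.node (φ (1, 0)))) := by
  classical
  have := T.fin
  rw [Set.disjoint_left]
  intro c hc₁ hc₂
  obtain ⟨i₁, hi₁, hray₁⟩ := T.ray_linked (0, 0) (.inl rfl)
  obtain ⟨i₂, hi₂, hray₂⟩ := T.ray_linked (1, 0) (.inr rfl)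
  rw [hi₁] at hc₁
  rw [hi₂] at hc₂
  obtain ⟨h1, h2, h3, h4⟩ : 0 ≤ c.1 ∧ c.1 ≤ T.S.L ∧ 0 ≤ c.2 ∧ c.2 ≤ T.S.H := by
    obtain ⟨j, hj, hl⟩ := hray₁ 0
    obtain ⟨j', hj', hr⟩ := hray₁ 1
    exact T.S.mem_rectangle hc₁ hj hl hj' hr
  obtain ⟨t₀, ht₀, hcard⟩ := T.S.exists_card_hits_le c
  have hL := T.S.L_pos
  have hH := T.S.H_pos
  obtain ⟨t, ⟨ht, htt⟩, hg⟩ : ∃ t ∈ Set.Ioo 0 (min t₀ (min (T.S.L / 2) (T.S.H / 2))),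
      T.S.Generic c t := by
    by_contra hcon
    push Not at hcon
    exact (Set.Ioo_infinite (by positivity)) ((T.S.finite_not_generic c).subset hcon)
  simp only [lt_min_iff] at htt
  obtain ⟨htt, htL, htH⟩ := htt
  have cross : ∀ (i : T.I) (a : ℝ × ℝ) (s : Fin 4), c ∈ T.S.Q (some i) →
      (∃ j ∈ ![T.S.sL, T.S.sR, T.S.sB, T.S.sT] s,
        Linked T.S.adj {j | ∃ b ∈ ray s a, ‖b‖ ≤ N + 1 ∧ φ b ∈ T.P (some j)} i j) →
      (∀ j ∈ ![T.S.sL, T.S.sR, T.S.sB, T.S.sT] s, ∃ z ∈ T.S.Q (some j), t ≤ dist z c) →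
      ∃ k, some k ∈ T.S.hits (Metric.sphere c t) ∧
        ∃ b ∈ ray s a, ‖b‖ ≤ N + 1 ∧ φ b ∈ T.P (some k) := by
    rintro i a s hc ⟨j, hj, hl⟩ hz
    obtain ⟨z, hz, hzt⟩ := hz j hj
    obtain ⟨_, ⟨k, hk, rfl⟩, hk'⟩ := T.S.exists_mem_hits_sphere ht.le
      (T.S.linked_some (fun i hi => Set.mem_image_of_mem some hi) hl) hc
          (by simpa using ht.le) hz hzt
    exact ⟨k, hk', hk⟩
  have corner : ∀ j, (T.S.x j, T.S.y j) ∈ T.S.Q (some j) ∧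
      (T.S.x j + T.S.w j, T.S.y j + T.S.w j) ∈ T.S.Q (some j) := fun j => by
    have := T.S.w_nonneg j
    simp only [SqTiling.mem_Q_some]
    refine ⟨⟨⟨?_, ?_⟩, ?_, ?_⟩, ⟨?_, ?_⟩, ?_, ?_⟩ <;> linarith
  have hfst : ∀ z : ℝ × ℝ, t ≤ |z.1 - c.1| → t ≤ dist z c := fun z h => by
    rw [Prod.dist_eq]; exact le_max_of_le_left h
  have hsnd : ∀ z : ℝ × ℝ, t ≤ |z.2 - c.2| → t ≤ dist z c := fun z h => by
    rw [Prod.dist_eq]; exact le_max_of_le_right h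
  have column : ∀ (i : T.I) (a : ℝ × ℝ), c ∈ T.S.Q (some i) →
      (∀ s, ∃ j ∈ ![T.S.sL, T.S.sR, T.S.sB, T.S.sT] s,
        Linked T.S.adj {j | ∃ b ∈ ray s a, ‖b‖ ≤ N + 1 ∧ φ b ∈ T.P (some j)} i j) →
      ∃ k, some k ∈ T.S.hits (Metric.sphere c t) ∧
        ∃ b : ℝ × ℝ, b.1 = a.1 ∧ ‖b‖ ≤ N + 1 ∧ φ b ∈ T.P (some k) := by
    intro i a hc h
    rcases le_total (T.S.H / 2) c.2 with hh | hh
    · obtain ⟨k, hk, b, hb, hb'⟩ := cross i a 2 hc (h 2) fun j hj => ⟨_, (corner j).1, hsnd _ (by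
        rw [T.S.y_sB j hj, abs_sub_comm]
        exact le_abs.2 (.inl (by linarith)))⟩
      exact ⟨k, hk, b, (hb.2.2.1 rfl).2, hb'⟩
    · obtain ⟨k, hk, b, hb, hb'⟩ := cross i a 3 hc (h 3) fun j hj => ⟨_, (corner j).2, hsnd _ (by
        have := T.S.y_sT j hj
        exact le_abs.2 (.inl (by linarith)))⟩
      exact ⟨k, hk, b, (hb.2.2.2 rfl).2, hb'⟩
  obtain ⟨k, hk, k', hk', b, b', hb, hb', hbk, hbk', hbb⟩ :
      ∃ k, some k ∈ T.S.hits (Metric.sphere c t) ∧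
      ∃ k', some k' ∈ T.S.hits (Metric.sphere c t) ∧ ∃ b b' : ℝ × ℝ, ‖b‖ ≤ N + 1 ∧ ‖b'‖ ≤ N + 1 ∧
      φ b ∈ T.P (some k) ∧ φ b' ∈ T.P (some k') ∧ 1 ≤ |b.1 - b'.1| := by
    rcases le_total (T.S.L / 2) c.1 with hh | hh
    · obtain ⟨k, hk, b, hb, hb1, hb2⟩ := cross i₁ _ 0 hc₁ (hray₁ 0) fun j hj =>
        ⟨_, (corner j).1, hfst _ (by
          rw [T.S.x_sL j hj, abs_sub_comm]
          exact le_abs.2 (.inl (by linarith)))⟩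
      obtain ⟨k', hk', b', hb', hb1', hb2'⟩ := column i₂ _ hc₂ hray₂
      refine ⟨k, hk, k', hk', b, b', hb1, hb1', hb2, hb2', le_abs.2 (.inr ?_)⟩
      have := (hb.1 rfl).1
      simp only at this hb'
      linarith
    · obtain ⟨k, hk, b, hb, hb1, hb2⟩ := cross i₂ _ 1 hc₂ (hray₂ 1) fun j hj =>
        ⟨_, (corner j).2, hfst _ (by
          have := T.S.x_sR j hj
          exact le_abs.2 (.inl (by linarith)))⟩
      obtain ⟨k', hk', b', hb', hb1', hb2'⟩ := column i₁ _ hc₁ hray₁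
      refine ⟨k, hk, k', hk', b, b', hb1, hb1', hb2, hb2', le_abs.2 (.inl ?_)⟩
      have := (hb.2.1 rfl).1
      simp only at this hb'
      linarith
  have hl := T.S.sphere_linked_tiles ht.le hg h1 h2 h3 h4 (by linarith) (by linarith) hk hk'
  have hdiam : ∀ m, ∀ a ∈ T.P (some m), ∀ a' ∈ T.P (some m), dist a a' ≤ 2 * K * ε :=
    fun m a ha a' ha' => by
      linarith [T.dist_center_le m a ha, T.dist_center_le m a' ha',
          dist_triangle_right a a' (T.center m)]
  have hsum := Linked.abs_sub_le_sum (u := fun z => dist z (φ b')) (v := fun _ => 2 * K * ε + ε)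
    (adj := T.S.adj) (P := fun i => T.P (some i))
      (fun m m' h => T.exists_close (some m) (some m') h)
    (fun m => by positivity)
    (fun m a ha a' ha' z hz => by
      have h5 := abs_dist_sub_le a z (φ b')
      have h6 := dist_triangle a a' z
      have h7 := hdiam m a ha a' ha'
      linarith)
    (Finset.univ.filter fun i => some i ∈ T.S.hits (Metric.sphere c t))
    (by simpa only [Finset.coe_filter, Finset.mem_univ, true_and] using hl) hbk hbk' (b := φ b')
        (by simpa using hε.le)
  rw [dist_self, sub_zero, abs_of_nonneg dist_nonneg, Finset.sum_const, nsmul_eq_mul] at hsum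
  have h5 : ((Finset.univ.filter fun i => some i ∈ T.S.hits (Metric.sphere c t)).card : ℝ) ≤
      16 := by
    exact_mod_cast hcard t ht htt hg
  have h6 := mul_le_mul_of_nonneg_right h5 (show 0 ≤ 2 * K * ε + ε by positivity)
  linarith [hsep b b' hb hb' hbb]

end FineTiling

/-- No plane annulus is crossed by two continua of `Z` separated, at scales at least `ρ`, by an
annulus of ratio `M`; points of `Z` are represented by plane sets. -/
def NoCrossing {Z : Type*} [MetricSpace Z] (Q : Z → Set (ℝ × ℝ)) (M ρ : ℝ) : Prop :=
  ∀ (x : Z) (r : ℝ), ρ ≤ r → ∀ E F : Set Z, IsPreconnected E → IsPreconnected F →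
    (∀ e ∈ E, dist e x ≤ r) → (∀ f ∈ F, M * r ≤ dist f x) →
    ∀ e₁ ∈ E, ∀ e₂ ∈ E, ∀ f₁ ∈ F, ∀ f₂ ∈ F, ∀ (y : ℝ × ℝ) (s : ℝ), 0 < s →
    ∀ a₁ ∈ Q e₁, ∀ a₂ ∈ Q e₂, ∀ b₁ ∈ Q f₁, ∀ b₂ ∈ Q f₂,
    dist a₁ y ≤ s → 2 * s ≤ dist a₂ y → dist b₁ y ≤ s → 2 * s ≤ dist b₂ y → False

theorem NoCrossing.chord_le {Z : Type*} [MetricSpace Z] {Q : Z → Set (ℝ × ℝ)} {M ρ Λ d σ : ℝ}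
    (hQ : NoCrossing Q M ρ) (hρ : 0 < ρ) (hM : 1 ≤ M) (hΛ : 1 ≤ Λ) (hZ : LinLocConnected Z Λ)
    (hd : ∀ x y : Z, dist x y ≤ d) (hσ : 0 < σ) {z₁ z₂ p : Z} (h₁₂ : 2 * σ ≤ dist z₁ z₂)
    (h₁p : 2 * σ ≤ dist z₁ p) (h₂p : 2 * σ ≤ dist z₂ p) (h0 : (0 : ℝ × ℝ) ∈ Q z₁) {U : ℝ × ℝ}
    (hU : U ∈ Q z₂) (hU1 : ‖U‖ = 1) (hp : ∀ R : ℝ, ∃ W ∈ Q p, R ≤ ‖W‖) {x a b : Z}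
    {X A B : ℝ × ℝ} (hX : X ∈ Q x) (hA : A ∈ Q a) (hB : B ∈ Q b)
    (hab : 2 * Λ ^ 2 * M * (1 + d / σ) * max (dist x b) ρ ≤ dist x a) :
    chord X B ≤ 400 * chord X A := by
  by_contra hcon
  push Not at hcon
  set r := max (dist x b) ρ with hr
  have hr0 : 0 < r := lt_max_of_lt_right hρ
  have hd0 : 0 ≤ d := dist_nonneg.trans (hd x x)
  have hxa : 2 * Λ ^ 2 * M * r ≤ dist x a :=
    le_trans (by
      have : 0 ≤ 2 * Λ ^ 2 * M * (d / σ) * r := by positivity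
      nlinarith) hab
  have hfar : ∀ ω : Z, σ ≤ dist ω x → 2 * Λ ^ 2 * M * r ≤ dist ω x := by
    intro ω h
    refine le_trans ?_ h
    have h1 := hab.trans (hd x a)
    have h2 : 2 * Λ ^ 2 * M * r * (d + σ) ≤ σ * (d + σ) := by
      have : 2 * Λ ^ 2 * M * (1 + d / σ) * r * σ = 2 * Λ ^ 2 * M * r * (d + σ) := by
        field_simp
        ring
      nlinarith
    exact le_of_mul_le_mul_right h2 (by positivity)
  obtain ⟨E, hE, hEc, hxE, hbE⟩ := hZ.inside x (2 * r) x b (by rw [dist_self]; linarith) (by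
    rw [dist_comm]; linarith [le_max_left (dist x b) ρ])
  have hEr : ∀ e ∈ E, dist e x ≤ 2 * Λ * r := fun e he => by
    have := Metric.mem_ball.1 (hE he)
    linarith
  have hρr : ρ ≤ 2 * Λ * r := by nlinarith [le_max_right (dist x b) ρ]
  have hF : ∀ ω, σ ≤ dist ω x → ∃ F : Set Z, IsPreconnected F ∧ a ∈ F ∧ ω ∈ F ∧
      ∀ f ∈ F, M * (2 * Λ * r) ≤ dist f x := by
    intro ω h
    obtain ⟨F, hF, hFc, haF, hωF⟩ := hZ.outside x (M * (2 * Λ * r)) a ω (by positivity)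
      (by rw [dist_comm]; linarith) (by linarith [hfar ω h])
    refine ⟨F, hFc, haF, hωF, fun f hf => ?_⟩
    simpa using hF hf
  have hcr : ‖X - A‖ * 400 * (1 + ‖B‖) < ‖X - B‖ * (1 + ‖A‖) := by
    have h1 := norm_nonneg X
    have h2 := norm_nonneg A
    have h3 := norm_nonneg B
    rw [chord, chord, dist_eq_norm, dist_eq_norm, ← mul_div_assoc,
      div_lt_div_iff₀ (by positivity) (by positivity)] at hcon
    refine lt_of_mul_lt_mul_right (a := 1 + ‖X‖) ?_ (by positivity)
    linarith
  have hXB := norm_sub_le X B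
  have hXA : ‖A‖ ≤ ‖X‖ + ‖X - A‖ := by
    have := norm_sub_norm_le A X
    rw [norm_sub_rev] at this
    linarith
  have hXA' : ‖X‖ ≤ ‖A‖ + ‖X - A‖ := by linarith [norm_sub_norm_le X A]
  have hXB' : ‖X‖ ≤ ‖B‖ + ‖X - B‖ := by linarith [norm_sub_norm_le X B]
  have hX0 := norm_nonneg X
  have hB0 := norm_nonneg B
  have hA0 := norm_nonneg A
  have hXA0 := norm_nonneg (X - A)
  have hXB0 : 0 < ‖X - B‖ := by
    by_contra h
    push Not at h
    nlinarith [mul_nonneg hXA0 hB0]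
  rcases le_or_gt ‖X - A‖ ((1 + ‖X‖) / 16) with hcase | hcase
  · obtain ⟨ω, W, hW, hω, hWX⟩ : ∃ ω, ∃ W ∈ Q ω, σ ≤ dist ω x ∧ (1 + ‖X‖) / 8 ≤ dist W X := by
      by_contra hno
      push Not at hno
      obtain ⟨W, hW, hWn⟩ := hp (2 * (1 + ‖X‖))
      have hpx : dist p x < σ := by
        by_contra h
        have h1 := hno p W hW (not_lt.1 h)
        rw [dist_eq_norm] at h1
        linarith [norm_sub_norm_le W X]
      have h1 := hno z₁ 0 h0 (by linarith [dist_triangle_right z₁ p x])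
      have h2 := hno z₂ U hU (by linarith [dist_triangle_right z₂ p x])
      rw [dist_eq_norm] at h1 h2
      rw [zero_sub, norm_neg] at h1
      linarith [norm_sub_norm_le U X]
    obtain ⟨F, hFc, haF, hωF, hFr⟩ := hF ω hω
    have hAB : 2 * ‖X - A‖ ≤ ‖X - B‖ := by
      rcases le_or_gt ‖X - B‖ ((1 + ‖X‖) / 2) with h | h
      · have h1 : (1 + ‖X‖) / 2 ≤ 1 + ‖B‖ := by linarith
        have h2 : ‖X - A‖ * 400 * ((1 + ‖X‖) / 2) < ‖X - B‖ * (2 * (1 + ‖X‖)) :=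
          calc _ ≤ ‖X - A‖ * 400 * (1 + ‖B‖) := by gcongr
            _ < _ := hcr
            _ ≤ _ := by gcongr; linarith
        have h3 : ‖X - A‖ * 200 < ‖X - B‖ * 2 :=
          lt_of_mul_lt_mul_right (a := 1 + ‖X‖) (by linarith) (by positivity)
        linarith
      · linarith
    refine hQ x _ hρr E F hEc hFc hEr hFr x hxE b hbE a haF ω hωF X
      (min (‖X - B‖ / 2) ((1 + ‖X‖) / 16)) (by positivity) X hX B hB A hA W hW ?_ ?_ ?_ ?_
    · rw [dist_self]; positivity
    · rw [dist_comm, dist_eq_norm]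
      linarith [min_le_left (‖X - B‖ / 2) ((1 + ‖X‖) / 16)]
    · rw [dist_comm, dist_eq_norm]
      exact le_min (by linarith) hcase
    · linarith [min_le_right (‖X - B‖ / 2) ((1 + ‖X‖) / 16)]
  · obtain ⟨ω, W, hW, hω, hW1⟩ : ∃ ω, ∃ W ∈ Q ω, σ ≤ dist ω x ∧ ‖W‖ ≤ 1 := by
      rcases le_or_gt σ (dist z₁ x) with h | h
      · exact ⟨z₁, 0, h0, h, by simp⟩
      · exact ⟨z₂, U, hU, by linarith [dist_triangle_left z₁ z₂ x, dist_comm x z₁, dist_comm x z₂],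
          hU1.le⟩
    obtain ⟨F, hFc, haF, hωF, hFr⟩ := hF ω hω
    obtain ⟨hX2, hA2⟩ : 2 * (1 + ‖B‖) ≤ ‖X‖ ∧ 2 * (1 + ‖B‖) ≤ ‖A‖ := by
      rcases le_or_gt (2 * (1 + ‖X‖)) (1 + ‖A‖) with h | h
      · have h1 : (1 + ‖A‖) / 2 ≤ ‖X - A‖ := by linarith
        have h2 : 200 * (1 + ‖B‖) < ‖X - B‖ := by
          refine lt_of_mul_lt_mul_right (a := 1 + ‖A‖) (lt_of_le_of_lt ?_ hcr) (by positivity)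
          nlinarith
        constructor <;> linarith
      · have h1 : 25 * (1 + ‖X‖) * (1 + ‖B‖) < ‖X - B‖ * (1 + ‖A‖) :=
          lt_of_le_of_lt (by nlinarith) hcr
        have h2 : 25 * (1 + ‖B‖) < 2 * ‖X - B‖ := by
          refine lt_of_mul_lt_mul_right (a := 1 + ‖X‖) ?_ (by positivity)
          linarith [mul_le_mul_of_nonneg_left h.le hXB0.le]
        have h3 : 2 * (1 + ‖B‖) ≤ ‖X‖ := by linarith
        refine ⟨h3, ?_⟩
        have h4 : 25 * (1 + ‖B‖) < 2 * (1 + ‖A‖) := by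
          refine lt_of_mul_lt_mul_right (a := 1 + ‖X‖) ?_ (by positivity)
          have : ‖X - B‖ ≤ 2 * (1 + ‖X‖) := by linarith
          linarith [mul_le_mul_of_nonneg_right this (show 0 ≤ 1 + ‖A‖ by positivity)]
        linarith
    refine hQ x _ hρr E F hEc hFc hEr hFr b hbE x hxE ω hωF a haF 0
      (1 + ‖B‖) (by positivity) B hB X hX W hW A hA ?_ ?_ ?_ ?_
    all_goals rw [dist_zero_right]; linarith

theorem SqTiling.Q_nonempty {I : Type*} (S : SqTiling I) : ∀ m, (S.Q m).Nonempty
  | none => ⟨(0, 0), fun h => lt_irrefl _ h.1⟩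
  | some i => ⟨(S.x i, S.y i), mem_Q_some.2
      ⟨⟨le_rfl, le_add_of_nonneg_right (S.w_nonneg i)⟩, le_rfl, le_add_of_nonneg_right
          (S.w_nonneg i)⟩⟩

theorem exists_modulus_lt (c : ℝ) :
    ∃ k : ℕ, 2 ≤ k * Real.log 2 ∧ c * (k + 2) / (k * Real.log 2) ^ 2 < 1 / 256 := by
  obtain ⟨k, hk⟩ := exists_nat_gt (max 4 (2048 * c))
  have h4 : (4 : ℝ) < k := (le_max_left _ _).trans_lt hk
  have hc : 2048 * c < k := (le_max_right _ _).trans_lt hk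
  have hl : 1 / 2 ≤ Real.log 2 := by linarith [Real.log_two_gt_d9]
  have hkl : (k : ℝ) / 2 ≤ k * Real.log 2 := by nlinarith
  refine ⟨k, by linarith, ?_⟩
  rw [div_lt_iff₀ (by positivity)]
  have h1 : ((k : ℝ) / 2) ^ 2 ≤ (k * Real.log 2) ^ 2 := by gcongr
  nlinarith

theorem IsPlaneChart.exists_separation_strip {Z : Type*} [MetricSpace Z] {φ : ℝ × ℝ → Z} {p : Z}
    (h : IsPlaneChart φ p) (R : ℝ) : ∃ κ > 0, ∀ b b' : ℝ × ℝ, ‖b‖ ≤ R → ‖b'‖ ≤ R →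
      1 ≤ |b.1 - b'.1| → κ ≤ dist (φ b) (φ b') := by
  set s : Set ((ℝ × ℝ) × (ℝ × ℝ)) := (Metric.closedBall 0 R ×ˢ Metric.closedBall 0 R) ∩
    {q | 1 ≤ |q.1.1 - q.2.1|} with hs
  have hsc : IsCompact s := ((isCompact_closedBall _ _).prod (isCompact_closedBall _ _)).inter_right
    (isClosed_le continuous_const (by fun_prop))
  have hmem : ∀ b b' : ℝ × ℝ, ‖b‖ ≤ R → ‖b'‖ ≤ R → 1 ≤ |b.1 - b'.1| → (b, b') ∈ s :=
    fun b b' h1 h2 h3 => ⟨⟨by simpa using h1, by simpa using h2⟩, h3⟩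
  rcases s.eq_empty_or_nonempty with he | hne
  · exact ⟨1, one_pos, fun b b' h1 h2 h3 => absurd (hmem b b' h1 h2 h3) (by simp [he])⟩
  · have hcont : Continuous fun q : (ℝ × ℝ) × (ℝ × ℝ) => dist (φ q.1) (φ q.2) :=
      (h.continuous.comp continuous_fst).dist (h.continuous.comp continuous_snd)
    obtain ⟨q, hq, hmin⟩ := hsc.exists_isMinOn hne hcont.continuousOn
    refine ⟨_, dist_pos.2 fun he => ?_, fun b b' h1 h2 h3 => hmin (hmem b b' h1 h2 h3)⟩
    have h1 : (1 : ℝ) ≤ |q.1.1 - q.2.1| := hq.2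
    rw [h.isOpenEmbedding.injective he, sub_self, abs_zero] at h1
    linarith

/-- Approximate uniformizations of `Z` at all scales, normalised at three points. -/
theorem IsPlaneChart.exists_noCrossing {Z : Type*} [MetricSpace Z] [CompactSpace Z]
    {φ : ℝ × ℝ → Z} {p : Z} (h : IsPlaneChart φ p) {Λ C₀ : ℝ} (hΛ : 1 ≤ Λ)
    (hllc : LinLocConnected Z Λ)
    (hcount : ∀ (x : Z) (r ε : ℝ), 0 < ε → ε ≤ r → ∀ A : Finset Z, (∀ a ∈ A, dist a x ≤ r) →
      (∀ a ∈ A, ∀ b ∈ A, a ≠ b → ε ≤ dist a b) → (A.card : ℝ) ≤ C₀ * (r / ε) ^ 2) :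
    ∃ M : ℝ, 1 ≤ M ∧ ∀ ρ > 0, ∃ Q : Z → Set (ℝ × ℝ), (∀ z, (Q z).Nonempty) ∧ NoCrossing Q M ρ ∧
      0 ∈ Q (φ (0, 0)) ∧ (∃ U ∈ Q (φ (1, 0)), ‖U‖ = 1) ∧ (∀ R : ℝ, ∃ W ∈ Q p, R ≤ ‖W‖) ∧
      ∀ X, ∃ z, X ∈ Q z := by
  obtain ⟨K, hK, hfine⟩ := h.exists_fineTiling hΛ hllc hcount
  obtain ⟨k, hk2, hk⟩ := exists_modulus_lt (64 * C₀ * (K + 1) ^ 2)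
  refine ⟨2 ^ (k + 1), one_le_pow₀ one_le_two, fun ρ hρ => ?_⟩
  obtain ⟨N, hN2, hN⟩ : ∃ N : ℕ, 2 ≤ N ∧ ∀ b, N ≤ ‖b‖ → dist (φ b) p ≤ ρ / 4 := by
    have := h.tendsto.eventually (Metric.closedBall_mem_nhds p (show 0 < ρ / 4 by positivity))
    rw [← Metric.cobounded_eq_cocompact, ← comap_norm_atTop, Filter.eventually_comap,
        Filter.eventually_atTop] at this
    obtain ⟨R, hR⟩ := this
    obtain ⟨N, hN⟩ := exists_nat_ge (max 2 R)
    exact ⟨N, by exact_mod_cast (le_max_left _ _).trans hN,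
      fun b hb => hR ‖b‖ (((le_max_right _ _).trans hN).trans hb) b rfl⟩
  obtain ⟨ε₀, hε₀, hfine⟩ := hfine N hN2
  obtain ⟨κ, hκ, hsep⟩ := h.exists_separation_strip (N + 1)
  obtain ⟨ε, hε, hεε, hερ, hεκ⟩ : ∃ ε > 0, ε < ε₀ ∧ 4 * ((K + 1) * ε) ≤ ρ ∧
      16 * (2 * K * ε + ε) < κ := by
    refine ⟨min (ε₀ / 2) (min (ρ / (4 * (K + 1))) (κ / (32 * (2 * K + 1)))),
        by positivity, ?_, ?_, ?_⟩
    · exact (min_le_left _ _).trans_lt (half_lt_self hε₀)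
    · have := (min_le_right (ε₀ / 2) _).trans (min_le_left (ρ / (4 * (K + 1)))
        (κ / (32 * (2 * K + 1))))
      rw [le_div_iff₀ (by positivity)] at this
      linarith
    · have := (min_le_right (ε₀ / 2) _).trans (min_le_right (ρ / (4 * (K + 1)))
        (κ / (32 * (2 * K + 1))))
      rw [le_div_iff₀ (by positivity)] at this
      linarith
  obtain ⟨T⟩ := hfine ε hε hεε
  have hnone : ∀ a ∈ T.P none, dist a p ≤ ρ / 4 := by
    intro a ha
    by_cases hap : a = p
    · rw [hap, dist_self]; positivity
    · obtain ⟨b, rfl⟩ := h.exists_eq hap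
      exact hN b (T.norm_ge b ha)
  obtain ⟨y₁, hy₁⟩ := T.S.Q_nonempty (T.node (φ (0, 0)))
  obtain ⟨y₂, hy₂⟩ := T.S.Q_nonempty (T.node (φ (1, 0)))
  have hy : y₂ - y₁ ≠ 0 := sub_ne_zero.2 fun he =>
    Set.disjoint_left.1 (T.disjoint_Q hε hK hεκ hsep) hy₁ (he ▸ hy₂)
  set l := ‖y₂ - y₁‖ with hl
  have hl0 : 0 < l := norm_pos_iff.2 hy
  have hdist : ∀ X Y : ℝ × ℝ, dist (y₁ + l • X) (y₁ + l • Y) = l * dist X Y := fun X Y => by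
    rw [dist_add_left, dist_smul₀, Real.norm_of_nonneg hl0.le]
  have hinv : ∀ y : ℝ × ℝ, y₁ + l • (l⁻¹ • (y - y₁)) = y := fun y => by
    rw [smul_inv_smul₀ hl0.ne']; abel
  refine ⟨fun z => {X | y₁ + l • X ∈ T.S.Q (T.node z)}, ?_, ?_, ?_, ?_, ?_, ?_⟩
  · intro z
    obtain ⟨y, hy⟩ := T.S.Q_nonempty (T.node z)
    exact ⟨l⁻¹ • (y - y₁), by rwa [Set.mem_ofPred_eq, hinv]⟩
  · intro x r hr E F hE hF hEr hFr e₁ he₁ e₂ he₂ f₁ hf₁ f₂ hf₂ y s hs a₁ ha₁ a₂ ha₂ b₁ hb₁ b₂ hb₂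
      ha₁s ha₂s hb₁s hb₂s
    have hεr : ε ≤ r := by nlinarith
    refine T.no_crossing hε hK hcount hk2 hk (x := x) (r := r + ε) (by linarith)
      (by nlinarith : 2 * (ρ / 4) + ε ≤ r + ε) hnone hE hF (fun e he => by linarith [hEr e he])
      (fun f hf => (hFr f hf).trans' ?_) he₁ he₂ hf₁ hf₂ (y := y₁ + l • y) (mul_pos hl0 hs)
      ha₁ ?_ ha₂ ?_ hb₁ ?_ hb₂ ?_
    · calc (2 : ℝ) ^ k * (r + ε) ≤ 2 ^ k * (r + r) := by gcongr
        _ = _ := by ring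
    all_goals rw [hdist]; nlinarith
  · simpa using hy₁
  · refine ⟨l⁻¹ • (y₂ - y₁), by rwa [Set.mem_ofPred_eq, hinv], ?_⟩
    rw [norm_smul, norm_inv, Real.norm_of_nonneg hl0.le, ← hl, inv_mul_cancel₀ hl0.ne']
  · intro R
    refine ⟨(-(|y₁.1| / l + |R|), 0), ?_, ?_⟩
    · rw [Set.mem_ofPred_eq, T.node_pole]
      intro hm
      have h1 : 0 < y₁.1 + l * -(|y₁.1| / l + |R|) := hm.1
      have h2 : y₁.1 + l * -(|y₁.1| / l + |R|) = y₁.1 - |y₁.1| - l * |R| := by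
        field_simp
        ring
      have h3 := mul_nonneg hl0.le (abs_nonneg R)
      linarith [le_abs_self y₁.1]
    · have h1 : 0 ≤ |y₁.1| / l := by positivity
      refine le_trans ?_ (norm_fst_le _)
      rw [norm_neg, Real.norm_eq_abs]
      exact (le_abs_self R).trans ((le_add_of_nonneg_left h1).trans (le_abs_self _))
  · intro X
    obtain ⟨m, hm⟩ := T.S.exists_Q (y₁ + l • X)
    obtain ⟨z, rfl⟩ := T.node_surjective m
    exact ⟨z, hm⟩

theorem LinLocConnected.exists_weakQS {Z : Type*} [MetricSpace Z] [CompactSpace Z]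
    [PreconnectedSpace Z] (e : Z ≃ₜ Metric.sphere (0 : EuclideanSpace ℝ (Fin 3)) 1) {Λ C₀ : ℝ}
    (hΛ : 1 ≤ Λ) (hZ : LinLocConnected Z Λ)
    (hcount : ∀ (x : Z) (r ε : ℝ), 0 < ε → ε ≤ r → ∀ A : Finset Z, (∀ a ∈ A, dist a x ≤ r) →
      (∀ a ∈ A, ∀ b ∈ A, a ≠ b → ε ≤ dist a b) → (A.card : ℝ) ≤ C₀ * (r / ε) ^ 2) :
    ∃ M : ℝ, 1 ≤ M ∧ ∃ F : Z ≃ₜ Metric.sphere (0 : EuclideanSpace ℝ (Fin 3)) 1,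
      WeakQS M 2400 F := by
  obtain ⟨φ, hφ⟩ := exists_isPlaneChart_prod e (e.symm (stereoPt 0))
  set p := e.symm (stereoPt 0)
  have h₁₂ : φ (0, 0) ≠ φ (1, 0) := fun h => by simpa using hφ.isOpenEmbedding.injective h
  obtain ⟨σ, hσ, h₁₂σ, h₁pσ, h₂pσ⟩ : ∃ σ > 0, 2 * σ ≤ dist (φ (0, 0)) (φ (1, 0)) ∧
      2 * σ ≤ dist (φ (0, 0)) p ∧ 2 * σ ≤ dist (φ (1, 0)) p := by
    have h1 := dist_pos.2 h₁₂
    have h2 := dist_pos.2 (hφ.ne (0, 0))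
    have h3 := dist_pos.2 (hφ.ne (1, 0))
    obtain ⟨σ, hσ, hσ'⟩ := exists_between (lt_min h1 (lt_min h2 h3))
    simp only [lt_min_iff] at hσ'
    exact ⟨σ / 2, by positivity, by linarith, by linarith, by linarith⟩
  obtain ⟨M, hM, hstage⟩ := hφ.exists_noCrossing hΛ hZ hcount
  have hd : ∀ x y : Z, dist x y ≤ Metric.diam (Set.univ : Set Z) := fun x y =>
    Metric.dist_le_diam_of_mem isCompact_univ.isBounded (Set.mem_univ x) (Set.mem_univ y)
  choose Q hQne hQ h0 hU hp hcov using fun n : ℕ => hstage (1 / ((n : ℝ) + 1)) (by positivity)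
  set M' := 2 * Λ ^ 2 * M * (1 + Metric.diam (Set.univ : Set Z) / σ) with hM'
  have hM'1 : 1 ≤ M' := by
    have h1 : 1 ≤ Λ ^ 2 := one_le_pow₀ hΛ
    have h2 : 1 ≤ 1 + Metric.diam (Set.univ : Set Z) / σ :=
      le_add_of_nonneg_right (div_nonneg Metric.diam_nonneg hσ.le)
    have h3 : 1 ≤ Λ ^ 2 * M := one_le_mul_of_one_le_of_one_le h1 hM
    have h4 := one_le_mul_of_one_le_of_one_le h3 h2
    rw [hM']
    linarith
  refine ⟨M', hM'1, ?_⟩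
  refine exists_weakQS_of_approx (by linarith) (fun n z => stereoPt '' Q n z)
    (fun n z => (hQne n z).image _) ?_ dense_range_stereoPt ?_ (hφ.ne (0, 0)) one_half_pos ?_
  · rintro n x a b _ ⟨X, hX, rfl⟩ _ ⟨A, hA, rfl⟩ _ ⟨B, hB, rfl⟩ hab
    obtain ⟨U, hU, hU1⟩ := hU n
    have h1 := (hQ n).chord_le (by positivity) hM hΛ hZ hd hσ h₁₂σ h₁pσ h₂pσ (h0 n) hU hU1 (hp n)
      hX hA hB hab
    calc dist (stereoPt X) (stereoPt B) ≤ 6 * chord X B := dist_le_chord X B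
      _ ≤ 2400 * chord X A := by linarith
      _ ≤ 2400 * dist (stereoPt X) (stereoPt A) := by
        have := chord_le_dist X A
        change _ ≤ 2400 * dist (invStereo X) (invStereo A)
        gcongr
  · rintro n _ ⟨X, rfl⟩
    obtain ⟨z, hz⟩ := hcov n X
    exact ⟨z, X, hz, rfl⟩
  · intro n
    obtain ⟨W, hW, hW1⟩ := hp n 1
    refine ⟨_, ⟨0, h0 n, rfl⟩, _, ⟨W, hW, rfl⟩, le_trans ?_ (chord_le_dist 0 W)⟩
    rw [chord, dist_zero_left, norm_zero, add_zero, one_mul, div_le_div_iff₀ two_pos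
        (by positivity)]
    linarith

/-- Bonk–Kleiner Theorem 1.1: an Ahlfors 2-regular metric space homeomorphic to the
2-sphere is quasisymmetrically homeomorphic to the standard sphere `S²` if and only if
it is linearly locally contractible. -/
theorem stmt_19 (Z : Type) [MetricSpace Z] [MeasurableSpace Z] [BorelSpace Z]
    (hhomeo : Nonempty (Z ≃ₜ ↥(Metric.sphere (0 : EuclideanSpace ℝ (Fin 3)) 1)))
    (C : ℝ) (hC : 1 ≤ C)
    (hreg : AhlforsRegular (MeasureTheory.Measure.hausdorffMeasure 2 : Measure Z) 2 C) :
    (∃ (f : Z ≃ₜ ↥(Metric.sphere (0 : EuclideanSpace ℝ (Fin 3)) 1)) (η : ℝ → ℝ),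
        ControlFunction η ∧ IsQuasisymmetricWith η ⇑f) ↔
      ∃ lam : ℝ, 1 ≤ lam ∧ LinLocContractible Z lam := by
  obtain ⟨e⟩ := hhomeo
  have hrank : Module.finrank ℝ (EuclideanSpace ℝ (Fin 3)) = 2 + 1 := by simp
  have : Fact (Module.finrank ℝ (EuclideanSpace ℝ (Fin 3)) = 2 + 1) := ⟨hrank⟩
  have : CompactSpace Z := e.symm.compactSpace
  have hS : ConnectedSpace (Metric.sphere (0 : EuclideanSpace ℝ (Fin 3)) 1) :=
    Subtype.connectedSpace (isConnected_sphere
      (by rw [← Module.finrank_eq_rank, hrank]; norm_num) 0 zero_le_one)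
  have : ConnectedSpace Z := e.symm.surjective.connectedSpace e.symm.continuous
  have : LocallyConnectedSpace (Metric.sphere (0 : EuclideanSpace ℝ (Fin 3)) 1) :=
    ChartedSpace.locallyConnectedSpace (EuclideanSpace ℝ (Fin 2)) _
  have : LocallyConnectedSpace Z := e.isOpenEmbedding.locallyConnectedSpace
  constructor
  · rintro ⟨f, η, hη, hf⟩
    exact exists_linLocContractible_of_quasisymmetric f hη hf
  · rintro ⟨lam, hlam, h⟩
    obtain ⟨C₀, -, hcount⟩ := exists_card_le_of_ahlforsRegular hC hreg
    obtain ⟨M, hM, F, hF⟩ := (h.linLocConnected e hlam).exists_weakQS e (by linarith) hcount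
    have hF' : WeakQS M 2400 F.toEquiv := hF
    obtain ⟨η, hη, hq⟩ := hF'.exists_quasisymmetric (uniformlyPacked_of_ahlforsRegular hC hreg)
      (uniformlyPacked_subtype _) hM (by norm_num)
    exact ⟨F, η, hη, hq⟩
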